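/- Assume MDZH holds with constant C > 4 (for every number field K ≠ ℚ, with d = [K:ℚ] and Δ the absolute value of its discriminant, ζ_K has no zero ρ = β + iγ with 0 < β < 1 satisfying both |γ| ≥ (1 + 4 log Δ)^{-1} and β ≥ 1 − ((log(d·log(3Δ)))^C·log(|γ|+2))^{-1}, and no real zero in (0,1) ∩ (1 − (log(d·log(3Δ)))^{-C}, 1)). Then there is a constant c > 0, depending only on C, such that for every number field K ≠ ℚ and every real x ≥ exp(4·(log log(3Δ))²·(log(d·log(3Δ)))^{C²}), one has π_K(x) ≥ x·(1/log x − c·exp(−(log x)^{1/C}/(log(d·log(3Δ)))^C)), where π_K(x) is the number of prime ideals 𝔭 of the ring of integers O_K with N𝔭 ≤ x. -/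

import Mathlib

open scoped Classical

noncomputable section

/-- `zeta` is the (unique) analytic continuation of the Dedekind zeta function of the
number field `K`: it is analytic away from `s = 1` and agrees with the Dirichlet series
`∑_𝔞 (N𝔞)^{-s}` (sum over nonzero integral ideals) for `Re s > 1`. -/
def IsDedekindZeta (K : Type) [Field K] [NumberField K] (zeta : ℂ → ℂ) : Prop :=
  DifferentiableOn ℂ zeta {s : ℂ | s ≠ 1} ∧
    ∀ s : ℂ, 1 < s.re →
      zeta s = ∑' I : {I : Ideal (NumberField.RingOfIntegers K) // I ≠ ⊥},
        (Ideal.absNorm (I : Ideal (NumberField.RingOfIntegers K)) : ℂ) ^ (-s)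

/-- MDZH with constant `C`. -/
def MDZH (C : ℝ) : Prop :=
  ∀ (K : Type) [Field K] [NumberField K],
    1 < Module.finrank ℚ K →
    ∀ zeta : ℂ → ℂ, IsDedekindZeta K zeta →
      (∀ ρ : ℂ, zeta ρ = 0 → 0 < ρ.re → ρ.re < 1 →
        ¬ ((1 + 4 * Real.log ((NumberField.discr K).natAbs))⁻¹ ≤ |ρ.im| ∧
            1 - ((Real.log ((Module.finrank ℚ K : ℝ) *
                    Real.log (3 * ((NumberField.discr K).natAbs : ℝ)))) ^ C *
                  Real.log (|ρ.im| + 2))⁻¹ ≤ ρ.re)) ∧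
      (∀ β : ℝ, zeta (β : ℂ) = 0 → 0 < β → β < 1 →
        ¬ (1 - (Real.log ((Module.finrank ℚ K : ℝ) *
              Real.log (3 * ((NumberField.discr K).natAbs : ℝ)))) ^ (-C) < β))

/-- `π_K(x)` is the number of (nonzero) prime ideals of `𝓞 K` of norm at most `x`. -/
def piK (K : Type) [Field K] [NumberField K] (x : ℝ) : ℕ :=
  {P : Ideal (NumberField.RingOfIntegers K) |
    P.IsPrime ∧ P ≠ ⊥ ∧ (Ideal.absNorm P : ℝ) ≤ x}.ncard

section
open scoped Classical
open Real MeasureTheory Filter Topology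

namespace HZ

lemma summable_pi_prod {ι : Type*} [Fintype ι] (f : ℤ → ℝ) (h0 : ∀ m, 0 ≤ f m) (hf : Summable f) :
    Summable (fun m : ι → ℤ => ∏ i, f (m i)) := by
  refine summable_of_sum_le (c := ∏ _i : ι, ∑' m, f m)
    (fun m => Finset.prod_nonneg fun i _ => h0 _) fun s => ?_
  calc ∑ m ∈ s, ∏ i, f (m i) ≤ ∑ m ∈ Fintype.piFinset (fun i => s.image (fun m => m i)), ∏ i, f (m i) := by
        refine Finset.sum_le_sum_of_subset_of_nonneg ?_ fun m _ _ => Finset.prod_nonneg fun i _ => h0 _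
        intro m hm
        rw [Fintype.mem_piFinset]
        exact fun i => Finset.mem_image_of_mem _ hm
    _ = ∏ i, ∑ j ∈ s.image (fun m => m i), f j := (Finset.prod_univ_sum _ _).symm
    _ ≤ _ := Finset.prod_le_prod (fun i _ => Finset.sum_nonneg fun j _ => h0 j)
        fun i _ => hf.sum_le_tsum _ fun j _ => h0 j

lemma summable_gauss_int {c : ℝ} (hc : 0 < c) : Summable (fun m : ℤ => rexp (-c * (m : ℝ) ^ 2)) := by
  have := ((summable_jacobiTheta₂_term_iff 0 (Complex.I * ((c / π : ℝ) : ℂ))).2 (by simp; positivity)).norm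
  refine this.congr fun m => ?_
  rw [jacobiTheta₂_term, Complex.norm_exp]
  congr 1
  have : (2 * π * Complex.I * m * 0 + π * Complex.I * m ^ 2 * (Complex.I * ((c / π : ℝ) : ℂ)) : ℂ) = ((-c * (m : ℝ) ^ 2 : ℝ) : ℂ) := by
    push_cast
    have : (π : ℂ) ≠ 0 := by exact_mod_cast pi_ne_zero
    field_simp
    linear_combination (m:ℂ)^2 * c * Complex.I_sq
  rw [this, Complex.ofReal_re]

lemma summable_gauss_pi {ι : Type*} [Fintype ι] {c : ℝ} (hc : 0 < c) :
    Summable (fun m : ι → ℤ => rexp (-c * ∑ i, (m i : ℝ) ^ 2)) := by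
  refine (summable_pi_prod _ (fun m => (exp_pos _).le) (summable_gauss_int hc)).congr fun m => ?_
  rw [← Real.exp_sum, Finset.mul_sum]

variable {ι : Type*} [Fintype ι] [DecidableEq ι]

/-- the quadratic form. -/
noncomputable def Q (A : Matrix ι ι ℝ) (x : ι → ℝ) : ℝ := ∑ i, (A.mulVec x) i ^ 2

lemma Q_cont (A : Matrix ι ι ℝ) : Continuous (Q A) := by
  unfold Q Matrix.mulVec dotProduct; fun_prop

lemma Q_lower (A : Matrix ι ι ℝ) (hA : A.det ≠ 0) :
    ∃ c > 0, ∀ x, c * ∑ i, x i ^ 2 ≤ Q A x := by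
  have hu : IsUnit A.det := isUnit_iff_ne_zero.2 hA
  obtain ⟨C, hC0, hC⟩ : ∃ C > 0, ∀ v : ι → ℝ, ∑ i, (A⁻¹.mulVec v) i ^ 2 ≤ C * ∑ i, v i ^ 2 := by
    refine ⟨(∑ i, ∑ j, (A⁻¹ i j) ^ 2) + 1, by positivity, fun v => ?_⟩
    have : ∑ i, (A⁻¹.mulVec v) i ^ 2 ≤ ∑ i, (∑ j, (A⁻¹ i j) ^ 2) * ∑ j, v j ^ 2 :=
      Finset.sum_le_sum fun i _ => by
        unfold Matrix.mulVec dotProduct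
        exact Finset.sum_mul_sq_le_sq_mul_sq _ _ _
    rw [← Finset.sum_mul] at this
    nlinarith [Finset.sum_nonneg fun i (_ : i ∈ Finset.univ) => sq_nonneg (v i)]
  refine ⟨C⁻¹, by positivity, fun x => ?_⟩
  have := hC (A.mulVec x)
  rw [Matrix.mulVec_mulVec, Matrix.nonsing_inv_mul _ hu, Matrix.one_mulVec] at this
  rw [inv_mul_le_iff₀ hC0]
  exact this

lemma summable_Q (A : Matrix ι ι ℝ) (hA : A.det ≠ 0) {a : ℝ} (ha : 0 < a) :
    Summable (fun m : ι → ℤ => rexp (-a * Q A (fun i => (m i : ℝ)))) := by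
  obtain ⟨c, hc, h⟩ := Q_lower A hA
  refine Summable.of_nonneg_of_le (fun _ => (exp_pos _).le) (fun m => ?_)
    (summable_gauss_pi (ι := ι) (mul_pos ha hc))
  apply exp_le_exp.2
  nlinarith [h (fun i => (m i : ℝ))]

/-- Gaussian with a character. -/
noncomputable def gss (A : Matrix ι ι ℝ) (k : ι → ℤ) (x : ι → ℝ) : ℂ :=
  Complex.exp (-(2 * π * Complex.I) * (∑ i, (k i : ℂ) * x i)) * (rexp (-π * Q A x) : ℝ)

lemma gss_cont (A : Matrix ι ι ℝ) (k : ι → ℤ) : Continuous (gss A k) := by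
  have := Q_cont A
  unfold gss; fun_prop

lemma gss_norm (A : Matrix ι ι ℝ) (k : ι → ℤ) (x : ι → ℝ) : ‖gss A k x‖ = rexp (-π * Q A x) := by
  unfold gss
  rw [norm_mul, Complex.norm_exp, Complex.norm_real, Real.norm_of_nonneg (exp_pos _).le]
  have : (-(2 * π * Complex.I) * (∑ i, (k i : ℂ) * x i)) = ((-(2 * π * ∑ i, (k i : ℝ) * x i) : ℝ) : ℂ) * Complex.I := by
    push_cast; ring
  rw [this, Complex.re_ofReal_mul]; simp

lemma gss_integrable (A : Matrix ι ι ℝ) (hA : A.det ≠ 0) (k : ι → ℤ) : Integrable (gss A k) := by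
  obtain ⟨c, hc, h⟩ := Q_lower A hA
  have h1 := (GaussianFourier.integrable_cexp_neg_mul_sum_add (ι := ι) (b := ((π * c : ℝ) : ℂ))
    (by rw [Complex.ofReal_re]; positivity) 0).norm
  refine h1.mono' (gss_cont A k).aestronglyMeasurable (Eventually.of_forall fun x => ?_)
  rw [gss_norm, Complex.norm_exp]
  apply exp_le_exp.2
  have : (-((π * c : ℝ) : ℂ) * ∑ i, (x i : ℂ) ^ 2 + ∑ i, (0 : ι → ℂ) i * x i).re =
    -(π * c) * ∑ i, (x i) ^ 2 := by
    rw [show (-((π * c : ℝ) : ℂ) * ∑ i, (x i : ℂ) ^ 2 + ∑ i, (0 : ι → ℂ) i * x i) =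
      ((-(π * c) * ∑ i, (x i) ^ 2 : ℝ) : ℂ) by push_cast; simp, Complex.ofReal_re]
  rw [this]
  nlinarith [h x, pi_pos]

lemma gss_integral (A : Matrix ι ι ℝ) (hA : A.det ≠ 0) (k : ι → ℤ) :
    ∫ x, gss A k x = ((|A.det|⁻¹ * rexp (-π * Q (A⁻¹).transpose (fun i => (k i : ℝ))) : ℝ) : ℂ) := by
  have hu : IsUnit A.det := isUnit_iff_ne_zero.2 hA
  set w : ι → ℝ := (A⁻¹).transpose.mulVec (fun i => (k i : ℝ)) with hw
  set g : (ι → ℝ) → ℂ := fun u => Complex.exp (-(π : ℂ) * ∑ i, (u i : ℂ) ^ 2 +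
    ∑ i, (-(2 * π * Complex.I) * w i) * u i) with hg
  have h1 : ∀ x, gss A k x = g (Matrix.toLin' A x) := fun x => by
    simp only [hg, gss, Q, Matrix.toLin'_apply]
    rw [Complex.ofReal_exp, ← Complex.exp_add, add_comm]
    congr 1
    have h2 : ∑ i, (k i : ℝ) * x i = ∑ i, w i * (A.mulVec x) i := by
      change (fun i => (k i : ℝ)) ⬝ᵥ x = w ⬝ᵥ A.mulVec x
      rw [hw, Matrix.mulVec_transpose, ← Matrix.dotProduct_mulVec, Matrix.mulVec_mulVec,
        Matrix.nonsing_inv_mul _ hu, Matrix.one_mulVec]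
    have h3 : (∑ i, (k i : ℂ) * x i) = ∑ i, (w i : ℂ) * ((A.mulVec x) i : ℝ) := by exact_mod_cast h2
    rw [h3]
    push_cast
    simp_rw [mul_assoc, Finset.mul_sum]
  simp_rw [h1]
  have hgc : Continuous g := by rw [hg]; fun_prop
  have hm := Real.map_matrix_volume_pi_eq_smul_volume_pi hA
  rw [← integral_map (f := g) ((Matrix.toLin' A).continuous_of_finiteDimensional.measurable.aemeasurable)
    hgc.aestronglyMeasurable, hm, integral_smul_measure, hg,
    GaussianFourier.integral_cexp_neg_mul_sum_add (by simpa using pi_pos)]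
  rw [div_self (by exact_mod_cast pi_ne_zero), Complex.one_cpow, one_mul, abs_inv,
    ENNReal.toReal_ofReal (by positivity), Complex.ofReal_mul, Complex.ofReal_exp, Complex.real_smul]
  congr 2
  have : (π : ℂ) ≠ 0 := by exact_mod_cast pi_ne_zero
  rw [div_eq_iff (by simpa using this)]
  simp only [Q, mul_pow, ← hw]
  push_cast
  rw [← Finset.mul_sum]
  rw [neg_sq, mul_pow, Complex.I_sq]
  ring

/-- unit cubes -/
def cube (m : ι → ℤ) : Set (ι → ℝ) := {x | ∀ i, x i - m i ∈ Set.Ioc (0:ℝ) (0 + 1)}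

lemma cube_meas (m : ι → ℤ) : MeasurableSet (cube m) := by
  have : cube m = Set.pi Set.univ (fun i => {t : ℝ | t - m i ∈ Set.Ioc (0:ℝ) (0 + 1)}) := by
    ext x; simp [cube]
  rw [this]
  refine MeasurableSet.univ_pi fun i => ?_
  exact (measurable_id.sub_const _) measurableSet_Ioc

lemma cube_disj : Pairwise (Function.onFun Disjoint (cube (ι := ι))) := by
  intro m m' h
  rw [Function.onFun, Set.disjoint_left]
  intro x hx hx'
  apply h; ext i
  have h1 := hx i; have h2 := hx' i
  simp only [Set.mem_Ioc] at h1 h2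
  have a1 : (m i : ℝ) < m' i + 1 := by linarith
  have a2 : (m' i : ℝ) < m i + 1 := by linarith
  norm_cast at a1 a2
  omega

lemma cube_univ : (⋃ m, cube (ι := ι) m) = Set.univ := by
  ext x
  simp only [Set.mem_iUnion, Set.mem_univ, iff_true]
  refine ⟨fun i => ⌈x i⌉ - 1, fun i => ?_⟩
  simp only [Set.mem_Ioc]
  push_cast
  constructor <;> linarith [Int.le_ceil (x i), Int.ceil_lt_add_one (x i)]

lemma cube_integral {E : Type*} [NormedAddCommGroup E] [NormedSpace ℝ E] (f : (ι → ℝ) → E) (m : ι → ℤ) :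
    ∫ x in cube m, f x = ∫ x in cube 0, f (x + fun i => (m i : ℝ)) := by
  rw [← (measurePreserving_add_right volume (fun i => (m i : ℝ))).setIntegral_preimage_emb
    (measurableEmbedding_addRight _)]
  congr 2
  ext x; simp [cube]

lemma cube_hasSum (f : (ι → ℝ) → ℂ) (hf : Integrable f) :
    HasSum (fun m : ι → ℤ => ∫ x in cube 0, f (x + fun i => (m i : ℝ))) (∫ x, f x) := by
  have := hasSum_integral_iUnion (f := f) (μ := volume) (s := cube (ι := ι)) cube_meas cube_disj
    (by rw [cube_univ]; exact hf.integrableOn)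
  rw [cube_univ, setIntegral_univ] at this
  have h2 : (fun m : ι → ℤ => ∫ x in cube 0, f (x + fun i => (m i : ℝ))) = fun m => ∫ x in cube m, f x :=
    funext fun m => (cube_integral f m).symm
  rw [h2]; exact this

lemma gss_add (A : Matrix ι ι ℝ) (k : ι → ℤ) (x : ι → ℝ) (m : ι → ℤ) :
    gss A k (x + fun i => (m i : ℝ)) = Complex.exp (-(2 * π * Complex.I) * (∑ i, (k i : ℂ) * x i)) *
      gss A 0 (x + fun i => (m i : ℝ)) := by
  unfold gss
  simp only [Pi.add_apply, Complex.ofReal_add, mul_add, Finset.sum_add_distrib, Complex.exp_add]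
  have : Complex.exp (-(2 * π * Complex.I) * ∑ i, (k i : ℂ) * ((m i : ℝ) : ℂ)) = 1 := by
    have := Complex.exp_int_mul_two_pi_mul_I (-(∑ i, k i * m i))
    rw [← this]; push_cast; ring_nf
  rw [this]; simp

lemma gss_summable (A : Matrix ι ι ℝ) (hA : A.det ≠ 0) : 
    Continuous (fun x => ∑' m : ι → ℤ, gss A 0 (x + fun i => (m i : ℝ))) ∧
    ∀ x, Summable (fun m : ι → ℤ => gss A 0 (x + fun i => (m i : ℝ))) := by
  obtain ⟨c, hc, h⟩ := Q_lower A hA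
  have key : ∀ R : ℝ, ∀ m : ι → ℤ, ∀ x ∈ Metric.ball (0 : ι → ℝ) R,
      ‖gss A 0 (x + fun i => (m i : ℝ))‖ ≤ rexp (π * c * (Fintype.card ι * R ^ 2)) *
        rexp (-(π * c / 2) * ∑ i, (m i : ℝ) ^ 2) := by
    intro R m x hx
    rw [gss_norm, ← Real.exp_add]
    apply exp_le_exp.2
    have h1 := h (x + fun i => (m i : ℝ))
    have hR : ∀ i, x i ^ 2 ≤ R ^ 2 := fun i => by
      have : ‖x i‖ ≤ R := (norm_le_pi_norm x i).trans (mem_ball_zero_iff.1 hx).le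
      exact sq_le_sq' (by linarith [neg_abs_le (x i), Real.norm_eq_abs (x i)]) (by linarith [le_abs_self (x i), Real.norm_eq_abs (x i)])
    have h2 : (1/2) * ∑ i, (m i : ℝ) ^ 2 - Fintype.card ι * R ^ 2 ≤ ∑ i, ((x + fun i => (m i : ℝ)) i) ^ 2 := by
      have : (Fintype.card ι : ℝ) * R ^ 2 = ∑ _i : ι, R ^ 2 := by simp
      rw [this, Finset.mul_sum, ← Finset.sum_sub_distrib]
      refine Finset.sum_le_sum fun i _ => ?_
      simp only [Pi.add_apply]
      nlinarith [hR i, sq_nonneg (2 * x i + m i)]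
    have h3 : c * ((1/2) * ∑ i, (m i : ℝ) ^ 2 - Fintype.card ι * R ^ 2) ≤ Q A (x + fun i => (m i : ℝ)) :=
      (mul_le_mul_of_nonneg_left h2 hc.le).trans h1
    nlinarith [mul_le_mul_of_nonneg_left h3 pi_pos.le]
  have hs : ∀ R : ℝ, Summable (fun m : ι → ℤ => rexp (π * c * (Fintype.card ι * R ^ 2)) *
        rexp (-(π * c / 2) * ∑ i, (m i : ℝ) ^ 2)) := fun R =>
    (summable_gauss_pi (by positivity)).mul_left _
  constructor
  · rw [continuous_iff_continuousAt]
    intro x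
    have : ContinuousOn (fun x => ∑' m : ι → ℤ, gss A 0 (x + fun i => (m i : ℝ))) (Metric.ball 0 (‖x‖ + 1)) :=
      continuousOn_tsum (fun m => ((gss_cont A 0).comp (by fun_prop)).continuousOn) (hs (‖x‖ + 1))
        (key (‖x‖ + 1))
    exact this.continuousAt (Metric.isOpen_ball.mem_nhds (by simp))
  · intro x
    exact Summable.of_norm_bounded (hs (‖x‖ + 1)) fun m => key (‖x‖ + 1) m x (by simp)

theorem poisson_gauss (A : Matrix ι ι ℝ) (hA : A.det ≠ 0) :
    ∑' m : ι → ℤ, rexp (-π * Q A (fun i => (m i : ℝ))) =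
      |A.det|⁻¹ * ∑' k : ι → ℤ, rexp (-π * Q (A⁻¹).transpose (fun i => (k i : ℝ))) := by
  obtain ⟨hpc, hps⟩ := gss_summable A hA
  set p : (ι → ℝ) → ℂ := fun x => ∑' m : ι → ℤ, gss A 0 (x + fun i => (m i : ℝ)) with hp
  have hper : ∀ x (m : ι → ℤ), p (x + fun i => (m i : ℝ)) = p x := by
    intro x m
    simp only [hp]
    rw [← (Equiv.addLeft m).tsum_eq (fun m => gss A 0 (x + fun i => (m i : ℝ)))]
    refine tsum_congr fun m' => ?_
    congr 1; ext i; simp [add_assoc]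
  let pr : (ι → ℝ) → UnitAddTorus ι := Pi.map (fun _ t => (t : UnitAddCircle))
  have hpr : IsOpenQuotientMap pr :=
    IsOpenQuotientMap.piMap fun i => QuotientAddGroup.isOpenQuotientMap_mk
  have hex : ∀ z, ∃ x, pr x = z := hpr.surjective
  choose σ hσ using hex
  have hP : ∀ x, p (σ (pr x)) = p x := by
    intro x
    have h1 := hσ (pr x)
    have h2 : ∀ i, ∃ m : ℤ, σ (pr x) i = x i + m := by
      intro i
      have := congrFun h1 i
      simp only [pr, Pi.map_apply] at this
      obtain ⟨m, hm⟩ := AddSubgroup.mem_zmultiples_iff.1 (QuotientAddGroup.eq.1 this)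
      exact ⟨-m, by push_cast; simp at hm; linarith⟩
    choose m hm using h2
    rw [show σ (pr x) = x + fun i => (m i : ℝ) from funext hm, hper]
  let P : C(UnitAddTorus ι, ℂ) := ⟨fun z => p (σ z), by
    rw [hpr.isQuotientMap.continuous_iff]
    exact hpc.congr fun x => (hP x).symm⟩
  have hcoef : ∀ k, UnitAddTorus.mFourierCoeff P k =
      ((|A.det|⁻¹ * rexp (-π * Q (A⁻¹).transpose (fun i => (k i : ℝ))) : ℝ) : ℂ) := by
    intro k
    rw [UnitAddTorus.mFourierCoeff_eq_integral _ _ 0, ← gss_integral A hA k]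
    have h0 : {x : ι → ℝ | ∀ i, x i ∈ Set.Ioc ((0 : ι → ℝ) i) ((0 : ι → ℝ) i + 1)} = cube 0 := by
      ext x; simp [cube]
    rw [h0]
    have h1 : ∀ x : ι → ℝ, UnitAddTorus.mFourier (-k) (fun i => (x i : UnitAddCircle)) • P (fun i => (x i : UnitAddCircle)) =
        ∑' m : ι → ℤ, gss A k (x + fun i => (m i : ℝ)) := by
      intro x
      have : P (fun i => (x i : UnitAddCircle)) = p x := hP x
      rw [this]
      simp_rw [gss_add A k x]
      rw [tsum_mul_left, smul_eq_mul]
      congr 1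
      simp only [UnitAddTorus.mFourier, ContinuousMap.coe_mk, fourier_coe_apply, ← Complex.exp_sum]
      rw [Finset.mul_sum]
      congr 1
      refine Finset.sum_congr rfl fun i _ => ?_
      simp; ring
    simp_rw [h1]
    have hint : ∀ m : ι → ℤ, Integrable (fun x => gss A k (x + fun i => (m i : ℝ))) (volume.restrict (cube 0)) :=
      fun m => ((gss_integrable A hA k).comp_add_right _).restrict
    have hn := cube_hasSum (fun x => ((‖gss A k x‖ : ℝ) : ℂ)) (gss_integrable A hA k).norm.ofReal
    have hn' : Summable (fun m : ι → ℤ => ∫ x in cube 0, ‖gss A k (x + fun i => (m i : ℝ))‖) := by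
      have := hn.summable
      simp_rw [integral_complex_ofReal] at this
      exact_mod_cast this
    have := hasSum_integral_of_summable_integral_norm hint hn'
    rw [← this.tsum_eq, (cube_hasSum _ (gss_integrable A hA k)).tsum_eq]
  have hd : ((A⁻¹).transpose).det ≠ 0 := by
    rw [Matrix.det_transpose]
    exact (Matrix.isUnit_nonsing_inv_det _ (isUnit_iff_ne_zero.2 hA)).ne_zero
  have hsum : Summable (fun k : ι → ℤ => |A.det|⁻¹ * rexp (-π * Q (A⁻¹).transpose (fun i => (k i : ℝ)))) :=
    (summable_Q _ hd pi_pos).mul_left _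
  have hfin := UnitAddTorus.hasSum_mFourier_series_apply_of_summable (f := P)
    (by rw [show UnitAddTorus.mFourierCoeff P = _ from funext hcoef]; exact_mod_cast hsum) (pr 0)
  have h2 := hfin.tsum_eq
  have h3 : P (pr 0) = p 0 := hP 0
  rw [h3] at h2
  have h4 : ∀ i, UnitAddTorus.mFourier i (pr 0) = 1 := by
    intro i; simp [UnitAddTorus.mFourier, pr]
  simp_rw [h4, hcoef, smul_eq_mul, mul_one] at h2
  rw [← tsum_mul_left]
  have h5 : p 0 = ((∑' m : ι → ℤ, rexp (-π * Q A (fun i => (m i : ℝ))) : ℝ) : ℂ) := by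
    rw [Complex.ofReal_tsum]
    simp only [hp, gss]; simp
  rw [h5] at h2
  exact_mod_cast h2.symm

end HZ
end

section
open scoped Classical
open Real MeasureTheory Filter Topology

noncomputable section
namespace HZ
open NumberField NumberField.InfinitePlace NumberField.mixedEmbedding Module nonZeroDivisors

lemma tsum_span {ι K : Type*} [Fintype ι] [Field K] [CharZero K] (b : Basis ι ℚ K) (S : Set K)
    (hS : ∀ x, x ∈ Submodule.span ℤ (Set.range b) ↔ x ∈ S) (f : K → ENNReal) :
    ∑' x : S, f x = ∑' m : ι → ℤ, f (∑ i, (m i : ℤ) • b i) := by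
  let e1 : S ≃ Submodule.span ℤ (Set.range b) := Equiv.subtypeEquivRight fun x => (hS x).symm
  let e := e1.trans (b.restrictScalars ℤ).equivFun.toEquiv
  rw [← e.symm.tsum_eq]
  refine tsum_congr fun m => ?_
  congr 1
  change (((b.restrictScalars ℤ).equivFun.symm m : Submodule.span ℤ (Set.range b)) : K) = _
  rw [Basis.equivFun_symm_apply]
  simp [Basis.restrictScalars_apply]

section
variable (K : Type*) [Field K] [NumberField K]

variable {K} in
def emb (x : K) : index K → ℝ
  | .inl w => (w.1.embedding x).re
  | .inr (w, j) => if j = 0 then √2 * (w.1.embedding x).re else √2 * (w.1.embedding x).im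

def pl : index K → InfinitePlace K
  | .inl w => w.1
  | .inr (w, _) => w.1

def sg : index K → ℝ
  | .inl _ => 1
  | .inr (_, j) => if j = 0 then 1 else -1

variable {K} in
lemma sum_index (h : index K → ℝ) (H : InfinitePlace K → ℝ) (h1 : ∀ w, h (.inl w) = H w.1)
    (h2 : ∀ w, h (.inr (w, 0)) + h (.inr (w, 1)) = H w.1) : ∑ j, h j = ∑ w, H w := by
  rw [Fintype.sum_sum_type, Fintype.sum_prod_type]
  simp_rw [Fin.sum_univ_two, h1, h2]
  rw [← Fintype.sum_subtype_add_sum_subtype (fun w : InfinitePlace K => IsReal w) H]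
  congr 1
  exact Fintype.sum_equiv (Equiv.subtypeEquivRight fun w => not_isReal_iff_isComplex.symm) _ _ fun w => rfl

variable {K} in
lemma prod_index (s : InfinitePlace K → ℝ) : ∏ j, s (pl K j) = ∏ w, s w ^ mult w := by
  rw [Fintype.prod_sum_type, Fintype.prod_prod_type]
  simp_rw [Fin.prod_univ_two]
  rw [prod_eq_prod_mul_prod]
  simp [pl, pow_two]

lemma emb_sum {ι : Type*} [Fintype ι] (m : ι → ℤ) (b : ι → K) (j : index K) :
    emb (∑ i, m i • b i) j = ∑ i, emb (b i) j * m i := by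
  rcases j with w | ⟨w, j⟩
  · simp [emb, mul_comm]
  · by_cases hj : j = 0
    · simp [emb, hj, Finset.mul_sum, mul_comm, mul_left_comm, mul_assoc]
    · simp [emb, hj, Finset.mul_sum, mul_comm, mul_left_comm, mul_assoc]

variable {K} in
lemma re_embedding (φ : K →+* ℂ) (x : K) : ((InfinitePlace.mk φ).embedding x).re = (φ x).re := by
  rcases embedding_mk_eq φ with h | h <;> rw [h]
  simp [ComplexEmbedding.conjugate_coe_eq]

variable {K} in
lemma trace_places (x : K) :
    ((Algebra.trace ℚ K x : ℚ) : ℝ) = ∑ w : InfinitePlace K, mult w * (w.embedding x).re := by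
  have h := congrArg Complex.re (trace_eq_sum_embeddings ℂ (K := ℚ) (x := x))
  rw [Complex.re_sum, ← Fintype.sum_equiv (RingHom.equivRatAlgHom K ℂ) (fun f => (f x).re)
      (fun φ => (φ x).re) fun _ => by simp [RingHom.equivRatAlgHom_apply],
      ← Finset.sum_fiberwise Finset.univ InfinitePlace.mk (fun φ => (φ x).re)] at h
  have h' (w : InfinitePlace K) (φ) (hφ : φ ∈ ({φ | InfinitePlace.mk φ = w} : Finset _)) :
      (φ x).re = (w.embedding x).re := by rw [← (Finset.mem_filter.mp hφ).2, re_embedding]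
  simp_rw [Finset.sum_congr rfl (h' _), Finset.sum_const, card_filter_mk_eq, nsmul_eq_mul] at h
  rw [← h]
  simp

variable {K} in
lemma emb_trace (x y : K) :
    ∑ j, emb x j * sg K j * emb y j = ((Algebra.trace ℚ K (x * y) : ℚ) : ℝ) := by
  rw [trace_places]
  have h2 : √2 * √2 = 2 := Real.mul_self_sqrt (by norm_num)
  refine sum_index _ _ (fun w => ?_) fun w => ?_
  · have h0 : (w.1.embedding x).im = 0 := by
      have := w.2
      rw [InfinitePlace.isReal_iff] at this
      exact Complex.conj_eq_iff_im.1 (RingHom.congr_fun this x)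
    simp [emb, sg, mult_isReal, h0]
  · simp only [emb, sg, mult_isComplex, map_mul, Complex.mul_re]
    simp
    linear_combination ((w.1.embedding x).re * (w.1.embedding y).re - (w.1.embedding x).im * (w.1.embedding y).im) * h2

variable {K} in
/-- weighted norm form -/
def qf (t : InfinitePlace K → ℝ) (x : K) : ℝ := ∑ w, mult w * t w * w x ^ 2

variable {K} in
lemma emb_sq (t : InfinitePlace K → ℝ) (x : K) :
    ∑ j, t (pl K j) * emb x j ^ 2 = qf t x := by
  have h2 : √2 ^ 2 = 2 := Real.sq_sqrt (by norm_num)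
  refine sum_index _ _ (fun w => ?_) fun w => ?_
  · have h0 : (w.1.embedding x).im = 0 := by
      have := w.2
      rw [InfinitePlace.isReal_iff] at this
      exact Complex.conj_eq_iff_im.1 (RingHom.congr_fun this x)
    simp only [emb, pl, mult_isReal, ← norm_embedding_eq w.1 x]
    rw [Complex.sq_norm, Complex.normSq_apply, h0]; ring
  · simp only [emb, pl, mult_isComplex, ← norm_embedding_eq w.1 x]
    rw [Complex.sq_norm, Complex.normSq_apply]
    simp [mul_pow, h2]; ring

variable {K} in
def EM (s : InfinitePlace K → ℝ) (b : index K → K) : Matrix (index K) (index K) ℝ :=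
  Matrix.of fun j i => s (pl K j) * emb (b i) j

variable {K} in
lemma Q_EM (s : InfinitePlace K → ℝ) (b : index K → K) (m : index K → ℤ) :
    Q (EM s b) (fun i => (m i : ℝ)) = qf (fun w => s w ^ 2) (∑ i, m i • b i) := by
  rw [← emb_sq]
  refine Finset.sum_congr rfl fun j _ => ?_
  rw [emb_sum, ← mul_pow, Finset.mul_sum]
  simp only [Matrix.mulVec, dotProduct, EM, Matrix.of_apply, mul_assoc]

variable {K} in
lemma EM_mul (s : InfinitePlace K → ℝ) (hs : ∀ w, s w ≠ 0) (b b' : index K → K) :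
    (EM s b).transpose * (Matrix.diagonal (sg K) * EM (fun w => (s w)⁻¹) b') =
      Matrix.of fun i k => ((Algebra.trace ℚ K (b i * b' k) : ℚ) : ℝ) := by
  ext i k
  rw [Matrix.mul_apply, Matrix.of_apply, ← emb_trace]
  refine Finset.sum_congr rfl fun j _ => ?_
  rw [Matrix.diagonal_mul]
  simp only [EM, Matrix.transpose_apply, Matrix.of_apply]
  have := hs (pl K j)
  field_simp

variable {K} in
lemma EM_det (s : InfinitePlace K → ℝ) (b : index K → K) :
    |(EM s b).det| = |∏ w, s w ^ mult w| * √|((Algebra.discr ℚ b : ℚ) : ℝ)| := by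
  have h1 : EM s b = Matrix.diagonal (fun j => s (pl K j)) * EM (fun _ => 1) b := by
    ext i j; simp [EM, Matrix.diagonal_mul]
  rw [h1, Matrix.det_mul, Matrix.det_diagonal, abs_mul, prod_index]
  congr 1
  have h2 := congrArg Matrix.det (EM_mul (fun _ => (1:ℝ)) (by simp) b b)
  rw [Matrix.det_mul, Matrix.det_mul, Matrix.det_transpose, Matrix.det_diagonal] at h2
  have h3 : (Matrix.of fun i k => ((Algebra.trace ℚ K (b i * b k) : ℚ) : ℝ)).det = ((Algebra.discr ℚ b : ℚ) : ℝ) := by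
    rw [Algebra.discr_def, ← eq_ratCast (algebraMap ℚ ℝ), RingHom.map_det]
    congr 1
  rw [h3] at h2
  have h4 : |∏ j, sg K j| = 1 := by
    rw [Finset.abs_prod]
    refine Finset.prod_eq_one fun j _ => ?_
    rcases j with w | ⟨w, j⟩
    · simp [sg]
    · by_cases hj : j = 0 <;> simp [sg, hj]
  rw [← h2, abs_mul, abs_mul, h4, one_mul]
  simp only [inv_one]
  rw [Real.sqrt_mul_self (abs_nonneg _)]

def Dab : ℝ := ((discr K).natAbs : ℝ)

lemma Dab_ge_one : 1 ≤ Dab K := by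
  unfold Dab
  exact_mod_cast Nat.one_le_iff_ne_zero.2 (Int.natAbs_ne_zero.2 (discr_ne_zero K))

variable {K} in
lemma exists_basis (I : (FractionalIdeal (𝓞 K)⁰ K)ˣ) :
    ∃ b : Basis (index K) ℚ K, (∀ x, x ∈ Submodule.span ℤ (Set.range b) ↔ x ∈ (I.1 : Set K)) ∧
     |((Algebra.discr ℚ b : ℚ) : ℝ)| = (FractionalIdeal.absNorm I.1 : ℝ) ^ 2 * Dab K := by
  have hc : Fintype.card (Free.ChooseBasisIndex ℤ (𝓞 K)) = Fintype.card (Free.ChooseBasisIndex ℤ I) := by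
    rw [← finrank_eq_card_chooseBasisIndex, ← finrank_eq_card_chooseBasisIndex, fractionalIdeal_rank]
  let e := Fintype.equivOfCardEq hc
  have hc2 : Fintype.card (Free.ChooseBasisIndex ℤ I) = Fintype.card (index K) := by
    rw [← finrank_eq_card_basis (basisOfFractionalIdeal K I), ← finrank_eq_card_basis (stdBasis K),
      mixedEmbedding.finrank]
  let e2 := Fintype.equivOfCardEq hc2
  refine ⟨(basisOfFractionalIdeal K I).reindex e2, fun x => ?_, ?_⟩
  · rw [Basis.range_reindex, mem_span_basisOfFractionalIdeal]
  · have h1 := det_basisOfFractionalIdeal_eq_absNorm K I e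
    rw [Basis.coe_reindex, Algebra.discr_reindex, ← Algebra.discr_reindex (b := basisOfFractionalIdeal K I) (f := e.symm)]
    have h2 := Algebra.discr_of_matrix_vecMul (integralBasis K)
      ((integralBasis K).toMatrix ((basisOfFractionalIdeal K I).reindex e.symm))
    rw [Basis.toMatrix_map_vecMul, ← Basis.det_apply, Basis.coe_reindex, Equiv.symm_symm] at h2
    rw [Equiv.symm_symm, h2, ← h1, ← coe_discr, Dab]
    push_cast
    rw [abs_mul, abs_pow, sq_abs, Nat.cast_natAbs, Int.cast_abs, Basis.coe_reindex, Equiv.symm_symm, sq_abs]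

variable {K} in
/-- trace dual -/
def dl (I : (FractionalIdeal (𝓞 K)⁰ K)ˣ) : (FractionalIdeal (𝓞 K)⁰ K)ˣ :=
  Units.mk0 (FractionalIdeal.dual ℤ ℚ I.1) (FractionalIdeal.dual_ne_zero ℤ ℚ I.ne_zero)

variable {K} in
lemma mem_dl (I : (FractionalIdeal (𝓞 K)⁰ K)ˣ) (b : Basis (index K) ℚ K)
    (hb : ∀ x, x ∈ Submodule.span ℤ (Set.range b) ↔ x ∈ (I.1 : Set K)) :
    ∀ x, x ∈ Submodule.span ℤ (Set.range b.traceDual) ↔ x ∈ ((dl I).1 : Set K) := by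
  intro x
  have h1 : (I.1 : Submodule (𝓞 K) K).restrictScalars ℤ = Submodule.span ℤ (Set.range b) := by
    ext x; rw [hb]; rfl
  rw [← Submodule.traceDual_span_of_basis ℤ (I.1 : Submodule (𝓞 K) K) b h1,
    Submodule.restrictScalars_mem, ← FractionalIdeal.coe_dual ℤ ℚ I.ne_zero]
  rfl

variable {K} in
lemma theta_gen_aux (b : Basis (index K) ℚ K) (N : ℝ) (hN : 0 < N)
    (hd : |((Algebra.discr ℚ b : ℚ) : ℝ)| = N ^ 2 * Dab K) (t : InfinitePlace K → ℝ) (ht : ∀ w, 0 < t w) :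
    ∑' m : index K → ℤ, ENNReal.ofReal (rexp (-π * qf t (∑ i, (m i : ℤ) • b i))) ≠ ⊤ ∧ 
    ∑' m : index K → ℤ, ENNReal.ofReal (rexp (-π * qf t (∑ i, (m i : ℤ) • b i))) =
      ENNReal.ofReal ((N * √(Dab K) * √(∏ w, t w ^ mult w))⁻¹) *
      ∑' m : index K → ℤ, ENNReal.ofReal (rexp (-π * qf (fun w => (t w)⁻¹) (∑ i, (m i : ℤ) • b.traceDual i))) := by
  set s : InfinitePlace K → ℝ := fun w => √(t w) with hs
  have hs0 : ∀ w, s w ≠ 0 := fun w => (Real.sqrt_pos.2 (ht w)).ne'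
  have ht1 : t = fun w => s w ^ 2 := funext fun w => (Real.sq_sqrt (ht w).le).symm
  have ht2 : (fun w => (t w)⁻¹) = fun w => (s w)⁻¹ ^ 2 := funext fun w => by
    rw [inv_pow, hs, Real.sq_sqrt (ht w).le]
  have hD := Dab_ge_one K
  have hP : 0 < ∏ w, t w ^ mult w := Finset.prod_pos fun w _ => pow_pos (ht w) _
  have hdet : |(EM s b).det| = N * √(Dab K) * √(∏ w, t w ^ mult w) := by
    rw [EM_det, hd, Real.sqrt_mul (by positivity), Real.sqrt_sq hN.le, mul_comm]
    congr 1
    rw [Finset.abs_prod, ← Real.sqrt_sq (Finset.prod_nonneg fun w _ => abs_nonneg _)]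
    congr 1
    rw [← Finset.prod_pow]
    refine Finset.prod_congr rfl fun w _ => ?_
    rw [sq_abs, ← pow_mul, mul_comm, pow_mul, hs, Real.sq_sqrt (ht w).le]
  have hdet0 : (EM s b).det ≠ 0 := by
    rw [← abs_pos, hdet]; positivity
  have hinv : ((EM s b)⁻¹).transpose = Matrix.diagonal (sg K) * EM (fun w => (s w)⁻¹) b.traceDual := by
    have h1 : (EM s b).transpose * (Matrix.diagonal (sg K) * EM (fun w => (s w)⁻¹) b.traceDual) = 1 := by
      rw [EM_mul s hs0]
      ext i k
      rw [Matrix.of_apply, Basis.trace_mul_traceDual, Matrix.one_apply]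
      by_cases h : i = k <;> simp [h]
    rw [Matrix.transpose_nonsing_inv]
    exact Matrix.inv_eq_right_inv h1
  have hQ : ∀ k : index K → ℤ, Q ((EM s b)⁻¹).transpose (fun i => (k i : ℝ)) =
      qf (fun w => (t w)⁻¹) (∑ i, k i • b.traceDual i) := by
    intro k
    rw [hinv, ht2, ← Q_EM]
    unfold Q
    refine Finset.sum_congr rfl fun j _ => ?_
    rw [← Matrix.mulVec_mulVec, Matrix.mulVec_diagonal, mul_pow]
    have : sg K j ^ 2 = 1 := by
      rcases j with w | ⟨w, j⟩
      · simp [sg]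
      · by_cases hj : j = 0 <;> simp [sg, hj]
    rw [this, one_mul]
  have hQ2 : ∀ k : index K → ℤ, qf t (∑ i, k i • b i) = Q (EM s b) (fun i => (k i : ℝ)) := by
    intro k; rw [Q_EM, ← ht1]
  have hp := poisson_gauss (EM s b) hdet0
  have hsum1 := summable_Q (EM s b) hdet0 pi_pos
  have hsum2 := summable_Q ((EM s b)⁻¹).transpose (by 
    rw [Matrix.det_transpose]
    exact (Matrix.isUnit_nonsing_inv_det _ (isUnit_iff_ne_zero.2 hdet0)).ne_zero) pi_pos
  have e1 : ∑' m : index K → ℤ, ENNReal.ofReal (rexp (-π * qf t (∑ i, (m i : ℤ) • b i))) =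
      ENNReal.ofReal (∑' m : index K → ℤ, rexp (-π * Q (EM s b) (fun i => (m i : ℝ)))) := by
    rw [ENNReal.ofReal_tsum_of_nonneg (fun _ => (exp_pos _).le) hsum1]
    exact tsum_congr fun m => by rw [hQ2]
  have e2 : ∑' m : index K → ℤ, ENNReal.ofReal (rexp (-π * qf (fun w => (t w)⁻¹) (∑ i, (m i : ℤ) • b.traceDual i))) =
      ENNReal.ofReal (∑' m : index K → ℤ, rexp (-π * Q ((EM s b)⁻¹).transpose (fun i => (m i : ℝ)))) := by
    rw [ENNReal.ofReal_tsum_of_nonneg (fun _ => (exp_pos _).le) hsum2]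
    exact tsum_congr fun m => by rw [hQ]
  refine ⟨?_, ?_⟩
  · rw [e1]; exact ENNReal.ofReal_ne_top
  · rw [e1, e2, hp, hdet, ENNReal.ofReal_mul (by positivity)]

variable {K} in
lemma absNorm_pos (I : (FractionalIdeal (𝓞 K)⁰ K)ˣ) : (0:ℝ) < FractionalIdeal.absNorm I.1 := by
  exact_mod_cast lt_of_le_of_ne (FractionalIdeal.absNorm_nonneg _)
    (Ne.symm (mt FractionalIdeal.absNorm_eq_zero_iff.1 I.ne_zero))

variable {K} in
lemma theta_gen (I : (FractionalIdeal (𝓞 K)⁰ K)ˣ) (t : InfinitePlace K → ℝ) (ht : ∀ w, 0 < t w) :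
    ∑' x : (I.1 : Set K), ENNReal.ofReal (rexp (-π * qf t x)) ≠ ⊤ ∧ 
    ∑' x : (I.1 : Set K), ENNReal.ofReal (rexp (-π * qf t x)) =
      ENNReal.ofReal ((FractionalIdeal.absNorm I.1 * √(Dab K) * √(∏ w, t w ^ mult w))⁻¹) *
      ∑' y : ((dl I).1 : Set K), ENNReal.ofReal (rexp (-π * qf (fun w => (t w)⁻¹) y)) := by
  obtain ⟨b, hb, hd⟩ := exists_basis I
  rw [tsum_span b _ hb (fun x => ENNReal.ofReal (rexp (-π * qf t x))),
    tsum_span b.traceDual _ (mem_dl I b hb) (fun x => ENNReal.ofReal (rexp (-π * qf (fun w => (t w)⁻¹) x)))]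
  exact theta_gen_aux b _ (absNorm_pos I) hd t ht

variable {K} in
lemma absNorm_dl (I : (FractionalIdeal (𝓞 K)⁰ K)ˣ) :
    (FractionalIdeal.absNorm (dl I).1 : ℝ) * (FractionalIdeal.absNorm I.1 * Dab K) = 1 := by
  have h1 : (dl I).1 = FractionalIdeal.dual ℤ ℚ 1 * I.1⁻¹ := FractionalIdeal.dual_eq_mul_inv ℤ ℚ I.1
  have h2 := coeIdeal_differentIdeal ℤ ℚ K (𝓞 K)
  have h3 := congrArg FractionalIdeal.absNorm h2
  rw [FractionalIdeal.coeIdeal_absNorm, absNorm_differentIdeal K (𝓞 K)] at h3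
  rw [h1, map_mul, Dab]
  have h4 : (FractionalIdeal.absNorm I.1⁻¹) * FractionalIdeal.absNorm I.1 = 1 := by
    rw [← map_mul, inv_mul_cancel₀ I.ne_zero, map_one]
  have h5 : (FractionalIdeal.absNorm (FractionalIdeal.dual ℤ ℚ (1 : FractionalIdeal (𝓞 K)⁰ K))) * ((discr K).natAbs : ℚ) = 1 := by
    rw [h3, ← map_mul, mul_inv_cancel₀ (FractionalIdeal.dual_ne_zero ℤ ℚ (one_ne_zero (α := FractionalIdeal (𝓞 K)⁰ K))), map_one]
  have h4' : ((FractionalIdeal.absNorm I.1⁻¹ : ℚ) : ℝ) * FractionalIdeal.absNorm I.1 = 1 := by exact_mod_cast h4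
  have h5' : ((FractionalIdeal.absNorm (FractionalIdeal.dual ℤ ℚ (1 : FractionalIdeal (𝓞 K)⁰ K)) : ℚ) : ℝ) * ((discr K).natAbs : ℝ) = 1 := by exact_mod_cast h5
  push_cast
  linear_combination (((FractionalIdeal.absNorm I.1⁻¹ : ℚ) : ℝ) * FractionalIdeal.absNorm I.1) * h5' + h4'

end
end HZ
end
end

section
open scoped Classical
open Real MeasureTheory Filter Topology

noncomputable section
namespace HZ
open NumberField NumberField.InfinitePlace NumberField.mixedEmbedding Module nonZeroDivisors
open NumberField.Units NumberField.Units.dirichletUnitTheorem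
section
variable {K : Type*} [Field K] [NumberField K]

def ex (u : logSpace K) (w : InfinitePlace K) : ℝ := if h : w = w₀ then -∑ v, u v else u ⟨w, h⟩

def tt (u : logSpace K) (w : InfinitePlace K) : ℝ := rexp (2 * ex u w / mult w)

lemma ex_add (u v : logSpace K) (w : InfinitePlace K) : ex (u + v) w = ex u w + ex v w := by
  unfold ex; split_ifs <;> simp [Finset.sum_add_distrib]; ring

lemma ex_neg (u : logSpace K) (w : InfinitePlace K) : ex (-u) w = -ex u w := by
  unfold ex; split_ifs <;> simp

lemma sum_split (f : InfinitePlace K → ℝ) :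
    ∑ w, f w = f w₀ + ∑ v : {w : InfinitePlace K // w ≠ w₀}, f v.1 := by
  rw [← Fintype.sum_subtype_add_sum_subtype (fun w : InfinitePlace K => w = w₀) f]
  congr 1
  simp only [Finset.univ_unique, Finset.sum_singleton]
  exact congrArg f (default : {w : InfinitePlace K // w = w₀}).2

lemma ex_sum (u : logSpace K) : ∑ w, ex u w = 0 := by
  rw [sum_split]
  have : ∀ v : {w : InfinitePlace K // w ≠ w₀}, ex u v.1 = u v := fun v => by
    simp [ex, v.2]
  simp_rw [this]; simp [ex]

lemma tt_pos (u : logSpace K) (w : InfinitePlace K) : 0 < tt u w := exp_pos _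

lemma tt_neg (u : logSpace K) (w : InfinitePlace K) : tt (-u) w = (tt u w)⁻¹ := by
  rw [tt, tt, ex_neg, ← Real.exp_neg]; congr 1; ring

lemma prod_tt (u : logSpace K) : ∏ w, tt u w ^ mult w = 1 := by
  have : ∀ w : InfinitePlace K, tt u w ^ mult w = rexp (2 * ex u w) := fun w => by
    rw [tt, ← Real.exp_nat_mul]
    have := mult_coe_ne_zero (w := w)
    congr 1; field_simp
  simp_rw [this]
  rw [← Real.exp_sum, ← Finset.mul_sum, ex_sum]; simp

lemma ex_cont (w : InfinitePlace K) : Continuous (fun u : logSpace K => ex u w) := by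
  unfold ex; split_ifs <;> fun_prop

lemma qf_cont (x : K) : Continuous (fun u : logSpace K => qf (tt u) x) := by
  unfold qf tt
  have := ex_cont (K := K)
  fun_prop

def Nr (x : K) : ℝ := |(Algebra.norm ℚ x : ℝ)|

lemma Nr_pos {x : K} (hx : x ≠ 0) : 0 < Nr x := by
  unfold Nr
  rw [abs_pos]
  exact_mod_cast Algebra.norm_ne_zero_iff.2 hx

def lm (x : K) : logSpace K := logMap (mixedEmbedding K x)

lemma sum_mult_log {x : K} (hx : x ≠ 0) : ∑ w : InfinitePlace K, mult w * Real.log (w x) = Real.log (Nr x) := by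
  have h := prod_eq_abs_norm x
  have h2 : Nr x = ∏ w : InfinitePlace K, w x ^ mult w := by
    rw [h, Nr]; simp
  rw [h2, Real.log_prod (fun w _ => pow_ne_zero _ (by simpa using hx))]
  simp_rw [Real.log_pow]

lemma ex_lm {x : K} (hx : x ≠ 0) (w : InfinitePlace K) :
    ex (lm x) w = mult w * (Real.log (w x) - Real.log (Nr x) / finrank ℚ K) := by
  have hv : ∀ v : {w : InfinitePlace K // w ≠ w₀}, (lm x) v = mult v.1 * (Real.log (v.1 x) - Real.log (Nr x) / finrank ℚ K) := by
    intro v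
    rw [lm, logMap_apply, normAtPlace_apply, norm_eq_norm, div_eq_mul_inv, Nr]
    simp
  unfold ex
  split_ifs with h
  · have h1 : ∑ w : InfinitePlace K, mult w * (Real.log (w x) - Real.log (Nr x) / finrank ℚ K) = 0 := by
      simp_rw [mul_sub, Finset.sum_sub_distrib]
      rw [sum_mult_log hx, ← Finset.sum_mul, ← Nat.cast_sum, sum_mult_eq]
      have : (finrank ℚ K : ℝ) ≠ 0 := by exact_mod_cast finrank_pos.ne'
      field_simp; ring
    rw [sum_split] at h1
    simp_rw [hv]
    rw [h]; linarith
  · exact hv ⟨w, h⟩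

lemma qf_tt {x : K} (hx : x ≠ 0) (u : logSpace K) :
    qf (tt u) x = Nr x ^ (2 / finrank ℚ K : ℝ) * qf (tt (u + lm x)) 1 := by
  unfold qf
  rw [Finset.mul_sum]
  refine Finset.sum_congr rfl fun w _ => ?_
  have hw : 0 < w x := InfinitePlace.pos_iff.2 hx
  have h1 : tt (u + lm x) w = tt u w * (w x ^ 2 * Nr x ^ (-(2 / finrank ℚ K : ℝ))) := by
    rw [tt, tt, ex_add, ex_lm hx, ← Real.rpow_natCast, Real.rpow_def_of_pos hw, Real.rpow_def_of_pos (Nr_pos hx), ← Real.exp_add, ← Real.exp_add]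
    congr 1
    have := mult_coe_ne_zero (w := w)
    push_cast
    field_simp
    ring
  rw [h1]
  have h2 : Nr x ^ (2 / finrank ℚ K : ℝ) * Nr x ^ (-(2 / finrank ℚ K : ℝ)) = 1 := by
    rw [← Real.rpow_add (Nr_pos hx)]; simp
  simp only [map_one, one_pow, mul_one]
  linear_combination -(mult w * tt u w * w x ^ 2) * h2

lemma lm_unit (ε : (𝓞 K)ˣ) {x : K} (hx : x ≠ 0) :
    lm ((ε : K) * x) = logEmbedding K (Additive.ofMul ε) + lm x := by
  unfold lm
  rw [map_mul, logMap_mul, logMap_eq_logEmbedding]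
  · rw [norm_unit]; norm_num
  · rw [norm_eq_norm]; have := Nr_pos hx; unfold Nr at this; simpa using this.ne'

variable (K) in
/-- fundamental domain for the unit lattice -/
def FD : Set (logSpace K) := ZSpan.fundamentalDomain ((basisUnitLattice K).ofZLatticeBasis ℝ)

variable (K) in
lemma FD_isfd : IsAddFundamentalDomain (unitLattice K) (FD K) volume :=
  ZLattice.isAddFundamentalDomain _ _

lemma unfold1 (H : logSpace K → ENNReal) (v : logSpace K) :
    ∑' l : unitLattice K, ∫⁻ u in FD K, H (u + l + v) = ∫⁻ u, H u := by
  have : VAddInvariantMeasure (unitLattice K) (logSpace K) volume :=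
    inferInstanceAs <| VAddInvariantMeasure (unitLattice K).toAddSubgroup (logSpace K) volume
  rw [← lintegral_add_right_eq_self _ v, (FD_isfd K).lintegral_eq_tsum'']
  refine tsum_congr fun l => ?_
  refine lintegral_congr fun u => ?_
  change H (u + l + v) = H (l + u + v)
  rw [add_comm u]

lemma unfold2 (H : logSpace K → ENNReal) (v : logSpace K) :
    ∑' l : unitLattice K, ∫⁻ u in FD K, H (-u + l + v) = ∫⁻ u, H u := by
  rw [← lintegral_neg_eq_self, ← unfold1 _ (-v), ← (Equiv.neg (unitLattice K)).tsum_eq]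
  refine tsum_congr fun l => lintegral_congr fun u => ?_
  congr 1
  simp; abel

lemma tsum_units (G : logSpace K → ENNReal) :
    ∑' ε : (𝓞 K)ˣ, G (logEmbedding K (Additive.ofMul ε)) =
      (Nat.card (torsion K) : ENNReal) * ∑' l : unitLattice K, G l := by
  let e : (𝓞 K)ˣ ≃ (((𝓞 K)ˣ ⧸ torsion K) × torsion K) := Subgroup.groupEquivQuotientProdSubgroup
  rw [← e.symm.tsum_eq]
  have h1 : ∀ p : (((𝓞 K)ˣ ⧸ torsion K) × torsion K), ((e.symm p : (𝓞 K)ˣ) : (𝓞 K)ˣ ⧸ torsion K) = p.1 := by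
    intro p
    conv_rhs => rw [← e.apply_symm_apply p]
    rfl
  have h2 : ∀ p, logEmbedding K (Additive.ofMul (e.symm p)) = (logEmbeddingEquiv K (Additive.ofMul p.1) : logSpace K) := by
    intro p
    rw [← h1 p]
    exact (logEmbeddingEquiv_apply K _).symm
  simp_rw [h2]
  rw [ENNReal.tsum_prod']
  simp_rw [ENNReal.tsum_const]
  rw [ENNReal.tsum_mul_left]
  congr 1
  · rw [ENat.card_eq_coe_natCard]; simp
  · rw [← (Additive.ofMul.trans (logEmbeddingEquiv K).toEquiv).tsum_eq (fun l : unitLattice K => G l)]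
    rfl

end
end HZ
end
end

section
open scoped Classical
open Real MeasureTheory Filter Topology

noncomputable section
namespace HZ
open NumberField NumberField.InfinitePlace NumberField.mixedEmbedding Module nonZeroDivisors
open NumberField.Units NumberField.Units.dirichletUnitTheorem FractionalIdeal
section
variable (K : Type*) [Field K] [NumberField K]

abbrev FI := (FractionalIdeal (𝓞 K)⁰ K)ˣ
abbrev ID := {I : Ideal (𝓞 K) // I ≠ ⊥}

variable {K}
def U (J : ID K) : FI K := Units.mk0 (J.1 : FractionalIdeal (𝓞 K)⁰ K) (coeIdeal_ne_zero.2 J.2)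

abbrev NX (a : FI K) := {x : K // x ∈ a.1 ∧ x ≠ 0}

lemma exists_fib (a : FI K) (x : NX a) : ∃ J : ID K, spanSingleton (𝓞 K)⁰ x.1 = (U J * a).1 := by
  have h1 : spanSingleton (𝓞 K)⁰ x.1 * (a⁻¹).1 ≤ 1 := by
    have := mul_le_mul_left (spanSingleton_le_iff_mem.2 x.2.1) (a⁻¹).1
    rwa [← Units.val_mul, mul_inv_cancel] at this
  obtain ⟨I, hI⟩ := le_one_iff_exists_coeIdeal.1 h1
  have h2 : spanSingleton (𝓞 K)⁰ x.1 = (I : FractionalIdeal (𝓞 K)⁰ K) * a.1 := by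
    rw [hI, mul_assoc, ← Units.val_mul]; simp
  refine ⟨⟨I, ?_⟩, h2⟩
  rintro rfl
  rw [coeIdeal_bot, zero_mul, spanSingleton_eq_zero_iff] at h2
  exact x.2.2 h2

def fib (a : FI K) (x : NX a) : ID K := (exists_fib a x).choose
lemma fib_spec (a : FI K) (x : NX a) : spanSingleton (𝓞 K)⁰ x.1 = (U (fib a x) * a).1 :=
  (exists_fib a x).choose_spec

lemma U_inj {J J' : ID K} (h : U J = U J') : J = J' := by
  have := congrArg Units.val h
  exact Subtype.ext (coeIdeal_inj.1 this)

lemma fib_iff (a : FI K) (x : NX a) (J : ID K) : fib a x = J ↔ spanSingleton (𝓞 K)⁰ x.1 = (U J * a).1 := by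
  constructor
  · rintro rfl; exact fib_spec a x
  · intro h
    rw [fib_spec] at h
    exact U_inj (mul_right_cancel (Units.ext h))

lemma Nr_span (x : K) : Nr x = (absNorm (spanSingleton (𝓞 K)⁰ x) : ℝ) := by
  rw [FractionalIdeal.absNorm_span_singleton, Nr]; simp

def Nid (J : ID K) : ℝ := (Ideal.absNorm J.1 : ℝ)

lemma Nid_ge (J : ID K) : 1 ≤ Nid J := by
  unfold Nid
  have : Ideal.absNorm J.1 ≠ 0 := by rw [Ne, Ideal.absNorm_eq_zero_iff]; exact J.2
  exact_mod_cast Nat.one_le_iff_ne_zero.2 this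

lemma Nr_fib (a : FI K) (x : NX a) : Nr x.1 = Nid (fib a x) * (absNorm a.1 : ℝ) := by
  rw [Nr_span, fib_spec, Units.val_mul, map_mul, Nid]
  have : (absNorm (U (fib a x)).1) = (Ideal.absNorm (fib a x).1 : ℚ) := coeIdeal_absNorm _
  rw [this]; simp

def mulx {a : FI K} (x : NX a) (ε : (𝓞 K)ˣ) : NX a := ⟨(ε : K) * x.1, by
  refine ⟨?_, mul_ne_zero (by simp) x.2.2⟩
  have := Submodule.smul_mem (a.1 : Submodule (𝓞 K) K) (ε : 𝓞 K) x.2.1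
  rwa [Algebra.smul_def] at this⟩

lemma mulx_fib {a : FI K} (x : NX a) (ε : (𝓞 K)ˣ) : fib a (mulx x ε) = fib a x := by
  rw [fib_iff, ← fib_spec]
  symm
  rw [spanSingleton_eq_spanSingleton]
  exact ⟨ε, by rw [Units.smul_def, Algebra.smul_def]; rfl⟩

lemma mulx_bij {a : FI K} (x : NX a) :
    Function.Bijective (fun ε => (⟨mulx x ε, mulx_fib x ε⟩ : {z : NX a // fib a z = fib a x})) := by
  constructor
  · intro ε ε' h
    have h1 : (ε : K) * x.1 = (ε' : K) * x.1 := congrArg (fun z => z.1.1) h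
    have h2 := mul_right_cancel₀ x.2.2 h1
    exact Units.ext (RingOfIntegers.ext h2)
  · rintro ⟨z, hz⟩
    have h1 : spanSingleton (𝓞 K)⁰ x.1 = spanSingleton (𝓞 K)⁰ z.1 := by
      rw [fib_spec, ← hz, ← fib_spec]
    obtain ⟨ε, he⟩ := spanSingleton_eq_spanSingleton.1 h1
    refine ⟨ε, Subtype.ext (Subtype.ext ?_)⟩
    rw [← he, Units.smul_def, Algebra.smul_def]; rfl

lemma fib_nonempty (a : FI K) (J : ID K) :
    (∃ x : NX a, fib a x = J) ↔ ClassGroup.mk K (U J) * ClassGroup.mk K a = 1 := by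
  rw [← map_mul, ClassGroup.mk_eq_one_iff, FractionalIdeal.isPrincipal_iff]
  constructor
  · rintro ⟨x, hx⟩
    exact ⟨x.1, ((fib_iff _ _ _).1 hx).symm⟩
  · rintro ⟨x, hx⟩
    have hx0 : x ≠ 0 := by
      rintro rfl
      rw [spanSingleton_zero] at hx
      exact (U J * a).ne_zero hx
    have hxa : x ∈ a.1 := by
      rw [← spanSingleton_le_iff_mem, ← hx, Units.val_mul]
      exact le_trans (mul_le_mul_left (coeIdeal_le_one (I := J.1)) a.1) (by rw [one_mul])
    exact ⟨⟨x, hxa, hx0⟩, (fib_iff _ _ _).2 hx.symm⟩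

variable (K) in
def Phi (τ : ℝ) : ENNReal := ∫⁻ u : logSpace K, ENNReal.ofReal (rexp (-π * (τ * qf (tt u) 1)))

variable (K) in
def wK : ENNReal := (Nat.card (torsion K) : ENNReal)

lemma unfold_ideal (a : FI K) (T : ℝ) (σ : logSpace K → logSpace K) (hσc : Continuous σ)
    (hσ : ∀ (H : logSpace K → ENNReal) (v : logSpace K),
      ∑' l : unitLattice K, ∫⁻ u in FD K, H (σ u + l + v) = ∫⁻ u, H u) :
    ∫⁻ u in FD K, ∑' x : NX a, ENNReal.ofReal (rexp (-π * (T * qf (tt (σ u)) x.1))) =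
      ∑' J : ID K, if ClassGroup.mk K (U J) * ClassGroup.mk K a = 1 then
        wK K * Phi K (T * (Nid J * (absNorm a.1 : ℝ)) ^ (2 / finrank ℚ K : ℝ)) else 0 := by
  have hcount : Countable K := Countable.of_equiv _ (finBasis ℚ K).equivFun.symm.toEquiv
  rw [lintegral_tsum]
  swap
  · intro x
    have := (qf_cont x.1).comp hσc
    refine (Continuous.measurable (ENNReal.continuous_ofReal.comp ?_)).aemeasurable
    simp only [Function.comp_def] at this
    fun_prop
  rw [← (Equiv.sigmaFiberEquiv (fib a)).tsum_eq, ENNReal.tsum_sigma']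
  refine tsum_congr fun J => ?_
  split_ifs with h
  · obtain ⟨x, rfl⟩ := (fib_nonempty a J).2 h
    rw [← (Equiv.ofBijective _ (mulx_bij x)).tsum_eq]
    let H : logSpace K → ENNReal := fun v => ENNReal.ofReal (rexp (-π * (T * (Nid (fib a x) * (absNorm a.1 : ℝ)) ^ (2 / finrank ℚ K : ℝ) * qf (tt v) 1)))
    have key : ∀ ε : (𝓞 K)ˣ, ∫⁻ u in FD K, ENNReal.ofReal (rexp (-π * (T * qf (tt (σ u)) ((Equiv.sigmaFiberEquiv (fib a)) ⟨fib a x, Equiv.ofBijective _ (mulx_bij x) ε⟩).1))) =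
        ∫⁻ u in FD K, H (σ u + logEmbedding K (Additive.ofMul ε) + lm x.1) := by
      intro ε
      refine lintegral_congr fun u => ?_
      have e1 : ((Equiv.sigmaFiberEquiv (fib a)) ⟨fib a x, Equiv.ofBijective _ (mulx_bij x) ε⟩) = mulx x ε := rfl
      rw [e1, qf_tt (mulx x ε).2.2, Nr_fib, mulx_fib]
      have e2 : lm (mulx x ε).1 = logEmbedding K (Additive.ofMul ε) + lm x.1 := lm_unit ε x.2.2
      simp only [H]
      rw [e2, add_assoc, mul_assoc T]
    have h5 := tsum_units (K := K) (fun l => ∫⁻ u in FD K, H (σ u + l + lm x.1))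
    rw [hσ] at h5
    exact (tsum_congr key).trans h5
  · have : IsEmpty {x : NX a // fib a x = J} := ⟨fun z => h ((fib_nonempty a J).1 ⟨z.1, z.2⟩)⟩
    simp

def cc (a : FI K) : ℝ := (Dab K * (absNorm a.1 : ℝ) ^ 2) ^ (1 / finrank ℚ K : ℝ)

lemma Dab_pos : (0 : ℝ) < Dab K := lt_of_lt_of_le one_pos (by exact_mod_cast Dab_ge_one K)

lemma npos : (0 : ℝ) < finrank ℚ K := by exact_mod_cast finrank_pos

lemma cc_pos (a : FI K) : 0 < cc a := by
  have := Dab_pos (K := K)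
  have := absNorm_pos a
  unfold cc; positivity

lemma cc_dl (a : FI K) : cc (dl a) = (cc a)⁻¹ := by
  have h0 := Dab_pos (K := K)
  have h1 := absNorm_pos a
  have h2 := absNorm_dl a
  unfold cc
  rw [← Real.inv_rpow (by positivity)]
  congr 1
  apply eq_inv_of_mul_eq_one_left
  linear_combination (((absNorm (dl a).1 : ℝ) * (absNorm a.1 * Dab K)) + 1) * h2

lemma tsum_zero_split (a : FI K) (f : K → ENNReal) :
    ∑' x : (a.1 : Set K), f x = f 0 + ∑' x : NX a, f x.1 := by
  have : (a.1 : Set K) = {0} ∪ {x | x ∈ a.1 ∧ x ≠ 0} := by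
    ext x
    by_cases h : x = 0
    · simp [h, FractionalIdeal.zero_mem]
    · simp [h]
  rw [this, Summable.tsum_union_disjoint (by simp) ENNReal.summable ENNReal.summable]
  congr 1
  exact tsum_singleton 0 f

lemma theta_int (a : FI K) (T : ℝ) (hT : 0 < T) (u : logSpace K) :
    1 + ∑' x : NX a, ENNReal.ofReal (rexp (-π * (T / cc a * qf (tt u) x.1))) =
     ENNReal.ofReal (T ^ (-(finrank ℚ K / 2 : ℝ))) *
      (1 + ∑' x : NX (dl a), ENNReal.ofReal (rexp (-π * (T⁻¹ / cc (dl a) * qf (tt (-u)) x.1)))) := by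
  have hc := cc_pos a
  have hq : ∀ (r : ℝ) (t : InfinitePlace K → ℝ) (x : K), qf (fun w => r * t w) x = r * qf t x := by
    intro r t x
    unfold qf; rw [Finset.mul_sum]; exact Finset.sum_congr rfl fun w _ => by ring
  have hq0 : ∀ (t : InfinitePlace K → ℝ), qf t 0 = 0 := by
    intro t; simp [qf]
  have h := (theta_gen a (fun w => T / cc a * tt u w) (fun w => mul_pos (by positivity) (tt_pos u w))).2
  have h0 : (((absNorm a.1 : ℝ) * √(Dab K) * √(∏ w, (T / cc a * tt u w) ^ mult w))⁻¹) = T ^ (-(finrank ℚ K / 2 : ℝ)) := by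
    simp_rw [mul_pow]
    rw [Finset.prod_mul_distrib, prod_tt, mul_one, Finset.prod_pow_eq_pow_sum, sum_mult_eq, Real.rpow_neg hT.le]
    congr 1
    have hD := Dab_pos (K := K)
    have hN := absNorm_pos a
    have e1 : cc a ^ finrank ℚ K = Dab K * (absNorm a.1 : ℝ) ^ 2 := by
      unfold cc
      rw [← Real.rpow_natCast, ← Real.rpow_mul (by positivity), one_div, inv_mul_cancel₀ npos.ne', Real.rpow_one]
    rw [div_pow, e1, Real.sqrt_div (by positivity), Real.sqrt_mul hD.le, Real.sqrt_sq hN.le]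
    have : T ^ (finrank ℚ K / 2 : ℝ) = √(T ^ finrank ℚ K) := by
      rw [Real.sqrt_eq_rpow, ← Real.rpow_natCast, ← Real.rpow_mul hT.le]
      congr 1; ring
    rw [this]
    field_simp
  rw [h0] at h
  have h3 : (fun w => (T / cc a * tt u w)⁻¹) = fun w => (T⁻¹ / cc (dl a)) * tt (-u) w := by
    funext w
    rw [cc_dl, tt_neg]
    field_simp
  rw [h3] at h
  rw [tsum_zero_split a (fun x => ENNReal.ofReal (rexp (-π * qf (fun w => T / cc a * tt u w) x))),
    tsum_zero_split (dl a) (fun x => ENNReal.ofReal (rexp (-π * qf (fun w => T⁻¹ / cc (dl a) * tt (-u) w) x)))] at h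
  simp only [hq, hq0] at h
  simpa using h

def Wf (a : FI K) (T : ℝ) : ENNReal :=
  ∑' J : ID K, if ClassGroup.mk K (U J) * ClassGroup.mk K a = 1 then
    wK K * Phi K (T * (Dab K : ℝ) ^ (-(1 / finrank ℚ K) : ℝ) * Nid J ^ (2 / finrank ℚ K : ℝ)) else 0

lemma Wf_eq (a : FI K) (T : ℝ) (σ : logSpace K → logSpace K) (hσc : Continuous σ)
    (hσ : ∀ (H : logSpace K → ENNReal) (v : logSpace K),
      ∑' l : unitLattice K, ∫⁻ u in FD K, H (σ u + l + v) = ∫⁻ u, H u) :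
    ∫⁻ u in FD K, (1 + ∑' x : NX a, ENNReal.ofReal (rexp (-π * (T / cc a * qf (tt (σ u)) x.1)))) =
      volume (FD K) + Wf a T := by
  rw [lintegral_add_left measurable_const, unfold_ideal a _ σ hσc hσ, Wf]
  congr 1
  · simp
  · refine tsum_congr fun J => ?_
    congr 3
    have hD := Dab_pos (K := K)
    have hN := absNorm_pos a
    have hJ : 0 < Nid J := lt_of_lt_of_le one_pos (Nid_ge J)
    have e : cc a = (Dab K : ℝ) ^ (1 / finrank ℚ K : ℝ) * (absNorm a.1 : ℝ) ^ (2 / finrank ℚ K : ℝ) := by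
      unfold cc
      rw [Real.mul_rpow (by positivity) (by positivity)]
      congr 1
      rw [← Real.rpow_natCast, ← Real.rpow_mul (by positivity)]
      congr 1; push_cast; ring
    rw [e, Real.mul_rpow hJ.le hN.le, Real.rpow_neg hD.le]
    field_simp

lemma Wf_fe (a : FI K) (T : ℝ) (hT : 0 < T) :
    volume (FD K) + Wf a T = ENNReal.ofReal (T ^ (-(finrank ℚ K / 2 : ℝ))) * (volume (FD K) + Wf (dl a) T⁻¹) := by
  rw [← Wf_eq a T id continuous_id unfold1, ← Wf_eq (dl a) T⁻¹ (fun u => -u) continuous_neg unfold2,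
    ← lintegral_const_mul' _ _ ENNReal.ofReal_ne_top]
  exact lintegral_congr fun u => theta_int a T hT u

variable (K) in
def Pf (T : ℝ) : ENNReal := ∑' J : ID K, wK K * Phi K (T * Nid J ^ (2 / finrank ℚ K : ℝ))

lemma sum_Wf (r : ClassGroup (𝓞 K) → FI K) (hr : Function.Bijective fun c => ClassGroup.mk K (r c)) (T : ℝ) :
    ∑ c, Wf (r c) T = Pf K (T * (Dab K : ℝ) ^ (-(1 / finrank ℚ K) : ℝ)) := by
  unfold Wf Pf
  rw [← Summable.tsum_finsetSum (fun _ _ => ENNReal.summable)]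
  refine tsum_congr fun J => ?_
  have : ∀ c, (ClassGroup.mk K (U J) * ClassGroup.mk K (r c) = 1) ↔
      ((Equiv.ofBijective _ hr).symm (ClassGroup.mk K (U J))⁻¹ = c) := by
    intro c
    rw [mul_eq_one_iff_eq_inv', Equiv.symm_apply_eq, eq_comm]
    rfl
  simp only [this]
  simp

lemma dl_eq (a : FI K) : dl a = dl 1 * a⁻¹ := by
  have h1 : ∀ a : FI K, (dl a).1 = FractionalIdeal.dual ℤ ℚ 1 * a.1⁻¹ := fun a => FractionalIdeal.dual_eq_mul_inv ℤ ℚ a.1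
  ext1
  rw [h1, Units.val_mul, h1]
  simp

variable (K) in
theorem Pf_fe (T : ℝ) (hT : 0 < T) :
    classNumber K * volume (FD K) + Pf K (T * (Dab K : ℝ) ^ (-(1 / finrank ℚ K) : ℝ)) =
     ENNReal.ofReal (T ^ (-(finrank ℚ K / 2 : ℝ))) *
      (classNumber K * volume (FD K) + Pf K (T⁻¹ * (Dab K : ℝ) ^ (-(1 / finrank ℚ K) : ℝ))) := by
  have hs : Function.Surjective (ClassGroup.mk K (R := 𝓞 K)) := by
    intro c
    obtain ⟨I, rfl⟩ := ClassGroup.mk0_surjective c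
    exact ⟨_, ClassGroup.mk_mk0 K I⟩
  let r := Function.surjInv hs
  have hr : ∀ c, ClassGroup.mk K (r c) = c := Function.surjInv_eq hs
  rw [← sum_Wf r, ← sum_Wf (fun c => dl (r c))]
  · have h1 : (classNumber K : ENNReal) * volume (FD K) = ∑ c : ClassGroup (𝓞 K), volume (FD K) := by
      simp [classNumber]
    rw [h1, ← Finset.sum_add_distrib, ← Finset.sum_add_distrib, Finset.mul_sum]
    exact Finset.sum_congr rfl fun c _ => Wf_fe _ T hT
  · have : (fun c => ClassGroup.mk K (dl (r c))) = fun c => ClassGroup.mk K (dl 1) * c⁻¹ := by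
      funext c
      rw [dl_eq, map_mul, map_inv, hr]
    rw [this]
    exact (Group.mulLeft_bijective _).comp (inv_involutive.bijective)
  · simp only [hr]; exact Function.bijective_id

end
end HZ
end
end

section
open scoped Classical
open Real MeasureTheory Filter Topology

noncomputable section
namespace HZ
open NumberField NumberField.InfinitePlace NumberField.mixedEmbedding Module nonZeroDivisors
open NumberField.Units NumberField.Units.dirichletUnitTheorem FractionalIdeal
section
variable (K : Type*) [Field K] [NumberField K]

lemma oneD {m p : ℝ} (hm : 0 < m) (hp : 0 < p) :
    Integrable (fun v : ℝ => rexp (-(π * m * rexp v) + m * p * v)) ∧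
    ∫ v : ℝ, rexp (-(π * m * rexp v) + m * p * v) = (1 / (π * m)) ^ (m * p) * Gamma (m * p) := by
  have h1 : ∀ v : ℝ, rexp (-(π * m * rexp v) + m * p * v) = |rexp v| • (fun t => t ^ (m * p - 1) * rexp (-(π * m * t))) (rexp v) := by
    intro v
    simp only [smul_eq_mul, abs_of_pos (exp_pos v)]
    rw [← Real.exp_mul, ← Real.exp_add, ← Real.exp_add]
    congr 1; ring
  have him : rexp '' Set.univ = Set.Ioi 0 := by simp
  constructor
  · simp_rw [h1]
    have := (integrableOn_image_iff_integrableOn_abs_deriv_smul (s := Set.univ) (f := rexp) (f' := rexp) MeasurableSet.univ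
      (fun x _ => (Real.hasDerivAt_exp x).hasDerivWithinAt) (exp_injective.injOn) (fun t => t ^ (m * p - 1) * rexp (-(π * m * t)))).1
    rw [him, integrableOn_univ] at this
    apply this
    by_contra hc
    have h2 := integral_rpow_mul_exp_neg_mul_Ioi (a := m * p) (r := π * m) (by positivity) (by positivity)
    rw [integral_undef hc] at h2
    have : 0 < (1 / (π * m)) ^ (m * p) * Gamma (m * p) := mul_pos (by positivity) (Gamma_pos_of_pos (by positivity))
    linarith
  · simp_rw [h1]
    have := integral_image_eq_integral_abs_deriv_smul (s := Set.univ) (f := rexp) (f' := rexp) MeasurableSet.univ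
      (fun x _ => (Real.hasDerivAt_exp x).hasDerivWithinAt) (exp_injective.injOn) (fun t => t ^ (m * p - 1) * rexp (-(π * m * t)))
    rw [him, setIntegral_univ] at this
    rw [← this]
    exact integral_rpow_mul_exp_neg_mul_Ioi (by positivity) (by positivity)

def Gp (p : ℝ) : ℝ := ∏ w : InfinitePlace K, ((1 / (π * mult w)) ^ (mult w * p) * Gamma (mult w * p))

def eL : (ℝ × logSpace K) →ₗ[ℝ] (InfinitePlace K → ℝ) where
  toFun q w := q.1 + 2 * ex q.2 w / mult w
  map_add' q r := by
    funext w
    simp [ex_add]; ring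
  map_smul' a q := by
    funext w
    have : ex (a • q.2) w = a * ex q.2 w := by
      unfold ex; split_ifs <;> simp [Finset.mul_sum]
    simp [this]; ring

lemma eL_inj : Function.Injective (eL K) := by
  rw [← LinearMap.ker_eq_bot, LinearMap.ker_eq_bot']
  rintro ⟨v, u⟩ h
  have h1 : ∀ w : InfinitePlace K, v + 2 * ex u w / mult w = 0 := fun w => congrFun h w
  have h2 : ∀ w : InfinitePlace K, mult w * v + 2 * ex u w = 0 := fun w => by
    have := mult_coe_ne_zero (w := w)
    have := h1 w
    field_simp at this
    linarith
  have h3 : ∑ w : InfinitePlace K, (mult w * v + 2 * ex u w) = 0 := Finset.sum_eq_zero fun w _ => h2 w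
  rw [Finset.sum_add_distrib, ← Finset.mul_sum, ex_sum, ← Finset.sum_mul, ← Nat.cast_sum, sum_mult_eq, mul_zero, add_zero] at h3
  have hv : v = 0 := by
    rcases mul_eq_zero.1 h3 with h | h
    · exact absurd h npos.ne'
    · exact h
  refine Prod.ext hv ?_
  funext w
  have := h2 w.1
  rw [hv] at this
  simp [ex, w.2] at this
  simpa using this

def eC : (ℝ × logSpace K) ≃L[ℝ] (InfinitePlace K → ℝ) :=
  ((eL K).linearEquivOfInjective (eL_inj K) (by
    have : 0 < Fintype.card (InfinitePlace K) := Fintype.card_pos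
    simp [logSpace, Fintype.card_subtype_compl]
    omega)).toContinuousLinearEquiv

lemma haar_const : ∃ c : ENNReal, c ≠ 0 ∧ c ≠ ⊤ ∧ ∀ H : (InfinitePlace K → ℝ) → ENNReal, Measurable H →
    ∫⁻ v : ℝ, ∫⁻ u : logSpace K, H (eL K (v, u)) = c * ∫⁻ z, H z := by
  have hV : (volume : Measure (ℝ × logSpace K)).IsAddHaarMeasure :=
    inferInstanceAs ((volume : Measure ℝ).prod (volume : Measure (logSpace K))).IsAddHaarMeasure
  have hM : (Measure.map (eC K) (volume : Measure (ℝ × logSpace K))).IsAddHaarMeasure :=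
    (eC K).isAddHaarMeasure_map volume
  have h := Measure.isAddLeftInvariant_eq_smul (Measure.map (eC K) (volume : Measure (ℝ × logSpace K))) (volume : Measure (InfinitePlace K → ℝ))
  set κ := Measure.addHaarScalarFactor (Measure.map (eC K) (volume : Measure (ℝ × logSpace K))) (volume : Measure (InfinitePlace K → ℝ)) with hκ
  have hpos : 0 < κ := Measure.addHaarScalarFactor_pos_of_isAddHaarMeasure _ _
  refine ⟨κ, by exact_mod_cast hpos.ne', ENNReal.coe_ne_top, fun H hH => ?_⟩
  have h1 : ∫⁻ q : ℝ × logSpace K, H (eC K q) = κ * ∫⁻ z, H z := by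
    rw [← lintegral_map hH (eC K).continuous.measurable, h]
    simp [lintegral_smul_measure]
    rfl
  rw [← h1]
  symm
  exact lintegral_prod (μ := (volume : Measure ℝ)) (ν := (volume : Measure (logSpace K))) (fun q => H (eC K q))
    (hH.comp (eC K).continuous.measurable).aemeasurable

lemma mellin_Phi : ∃ c : ENNReal, c ≠ 0 ∧ c ≠ ⊤ ∧ ∀ p : ℝ, 0 < p →
    ∫⁻ v : ℝ, Phi K (rexp v) * ENNReal.ofReal (rexp (finrank ℚ K * p * v)) = c * ENNReal.ofReal (Gp K p) := by
  obtain ⟨c, h0, h1, h2⟩ := haar_const K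
  refine ⟨c, h0, h1, fun p hp => ?_⟩
  have hm : ∀ w : InfinitePlace K, (0 : ℝ) < mult w := fun w => by exact_mod_cast mult_pos
  have h3 := h2 (fun z => ENNReal.ofReal (∏ w, rexp (-(π * mult w * rexp (z w)) + mult w * p * z w))) (by fun_prop)
  have h4 : ∫⁻ z : InfinitePlace K → ℝ, ENNReal.ofReal (∏ w, rexp (-(π * mult w * rexp (z w)) + mult w * p * z w)) = ENNReal.ofReal (Gp K p) := by
    rw [← ofReal_integral_eq_lintegral_ofReal]
    · congr 1
      rw [integral_fintype_prod_volume_eq_prod (fun (w : InfinitePlace K) (t : ℝ) => rexp (-(π * mult w * rexp t) + mult w * p * t)), Gp]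
      exact Finset.prod_congr rfl fun w _ => (oneD (hm w) hp).2
    · exact Integrable.fintype_prod (f := fun (w : InfinitePlace K) (t : ℝ) => rexp (-(π * mult w * rexp t) + mult w * p * t)) fun w => (oneD (hm w) hp).1
    · exact Eventually.of_forall fun z => by positivity
  rw [← h4, ← h3]
  refine lintegral_congr fun v => ?_
  rw [Phi, ← lintegral_mul_const' _ _ ENNReal.ofReal_ne_top]
  refine lintegral_congr fun u => ?_
  rw [← ENNReal.ofReal_mul (by positivity), ← Real.exp_add, ← Real.exp_sum]
  congr 2
  rw [Finset.sum_add_distrib, qf]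
  congr 1
  · rw [Finset.mul_sum, Finset.mul_sum]
    refine Finset.sum_congr rfl fun w _ => ?_
    change _ = -(π * mult w * rexp (v + 2 * ex u w / mult w))
    rw [Real.exp_add, tt]; simp; ring
  · have : ∀ w : InfinitePlace K, mult w * p * (eL K (v, u)) w = mult w * (p * v) + 2 * p * ex u w := fun w => by
      change _ * (v + 2 * ex u w / mult w) = _
      have := (hm w).ne'
      field_simp
    simp_rw [this]
    rw [Finset.sum_add_distrib, ← Finset.mul_sum, ex_sum, ← Finset.sum_mul, ← Nat.cast_sum, sum_mult_eq]
    ring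

end
end HZ
end
end

section
open scoped Classical
set_option linter.unusedSectionVars false
open Real MeasureTheory Filter Topology

noncomputable section
namespace HZ
open NumberField Module nonZeroDivisors
section
variable (K : Type*) [Field K] [NumberField K]

abbrev PR := {P : Ideal (𝓞 K) // P.IsPrime ∧ P ≠ ⊥}

variable {K}
def PR.id (P : PR K) : ID K := ⟨P.1, P.2.2⟩

def pu (P : PR K) : ℕ := Ideal.absNorm (Ideal.under ℤ P.1)

lemma pu_prime (P : PR K) : (pu P).Prime := by
  have := P.2.1
  have : NeZero P.1 := ⟨P.2.2⟩
  exact Nat.absNorm_under_prime P.1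

lemma pu_le (P : PR K) : (pu P : ℝ) ≤ Nid P.id := by
  unfold Nid
  have h : Ideal.absNorm P.1 ≠ 0 := by rw [Ne, Ideal.absNorm_eq_zero_iff]; exact P.2.2
  exact_mod_cast Nat.le_of_dvd (Nat.pos_of_ne_zero h) (Int.absNorm_under_dvd_absNorm P.1)

lemma NP_ge (P : PR K) : 2 ≤ Nid P.id := le_trans (by exact_mod_cast (pu_prime P).two_le) (pu_le P)

lemma card_fiber (m : ℕ) : ENat.card {P : PR K // pu P = m} ≤ finrank ℚ K := by
  by_cases hm : m.Prime
  · have hp0 : (Ideal.span {(m : ℤ)}) ≠ ⊥ := by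
      rw [Ne, Ideal.span_singleton_eq_bot]; exact_mod_cast hm.ne_zero
    have : (Ideal.span {(m : ℤ)}).IsPrime := by
      rw [Ideal.span_singleton_prime (by exact_mod_cast hm.ne_zero)]
      exact Nat.prime_iff_prime_int.1 hm
    have : (Ideal.span {(m : ℤ)}).IsMaximal := this.isMaximal hp0
    have h1 := Ideal.card_primesOverFinset_le_finrank (𝓞 K) ℚ K hp0
    let f : {P : PR K // pu P = m} → IsDedekindDomain.primesOverFinset (Ideal.span {(m : ℤ)}) (𝓞 K) := fun P =>
      ⟨P.1.1, by
        rw [IsDedekindDomain.mem_primesOverFinset_iff hp0]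
        refine ⟨P.1.2.1, ?_⟩
        have h := Int.liesOver_span_absNorm P.1.1
        have h' : Ideal.absNorm (Ideal.under ℤ P.1.1) = m := P.2
        rwa [h'] at h⟩
    have hf : Function.Injective f := fun P Q h => Subtype.ext (Subtype.ext (congrArg (fun z => z.1) h))
    refine (ENat.card_le_card_of_injective hf).trans ?_
    rw [ENat.card_eq_coe_fintype_card, Fintype.card_coe]
    exact_mod_cast h1
  · have : IsEmpty {P : PR K // pu P = m} := ⟨fun P => hm (P.2 ▸ pu_prime P.1)⟩
    rw [ENat.card_eq_zero_iff_empty _ |>.2 this]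
    exact zero_le

lemma SP_le {σ : ℝ} (hσ : 0 ≤ σ) : ∑' P : PR K, ENNReal.ofReal (Nid P.id ^ (-σ)) ≤
    finrank ℚ K * ∑' m : ℕ, ENNReal.ofReal ((m : ℝ) ^ (-σ)) := by
  rw [← (Equiv.sigmaFiberEquiv (pu (K := K))).tsum_eq, ENNReal.tsum_sigma', ← ENNReal.tsum_mul_left]
  refine ENNReal.tsum_le_tsum fun m => ?_
  have : ∀ P : {P : PR K // pu P = m}, ENNReal.ofReal (Nid ((Equiv.sigmaFiberEquiv (pu (K := K))) ⟨m, P⟩).id ^ (-σ)) ≤ ENNReal.ofReal ((m : ℝ) ^ (-σ)) := by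
    rintro ⟨P, rfl⟩
    refine ENNReal.ofReal_le_ofReal (Real.rpow_le_rpow_of_nonpos (by exact_mod_cast (pu_prime P).pos) (pu_le P) (by linarith))
  refine (ENNReal.tsum_le_tsum this).trans ?_
  rw [ENNReal.tsum_const]
  gcongr
  exact_mod_cast (ENat.toENNReal_le.2 (card_fiber (K := K) m))

lemma exists_PR (J : ID K) (h : J.1 ≠ ⊤) : ∃ P : PR K, P.1 ∣ J.1 := by
  obtain ⟨M, hM, hle⟩ := Ideal.exists_le_maximal J.1 h
  exact ⟨⟨M, hM.isPrime, fun hb => J.2 (le_bot_iff.1 (hb ▸ hle))⟩, Ideal.dvd_iff_le.2 hle⟩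

lemma PR_prime (P : PR K) : Prime P.1 := Ideal.prime_of_isPrime P.2.2 P.2.1

lemma PR_eq {P Q : PR K} (h : P.1 ∣ Q.1) : P = Q := by
  have h1 := (PR_prime P).associated_of_dvd (PR_prime Q) h
  exact Subtype.ext (associated_iff_eq.1 h1)

lemma finite_PR (J : ID K) : {P : PR K | P.1 ∣ J.1}.Finite := by
  have := UniqueFactorizationMonoid.fintypeSubtypeDvd J.1 J.2
  have h2 : Set.Finite {I : Ideal (𝓞 K) | I ∣ J.1} := Set.finite_coe_iff.1 (@Finite.of_fintype _ this)
  exact Set.Finite.preimage (f := fun P : PR K => P.1) Subtype.val_injective.injOn h2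

lemma Nid_mul (I J : ID K) (h : I.1 * J.1 ≠ ⊥) : Nid ⟨I.1 * J.1, h⟩ = Nid I * Nid J := by
  simp [Nid]

def xs (σ : ℝ) (J : ID K) : ENNReal := ENNReal.ofReal (Nid J ^ (-σ))

abbrev AS (S : Finset (PR K)) := {J : ID K // ∀ P : PR K, P.1 ∣ J.1 → P ∈ S}

lemma pow_mul_ne (P : PR K) (k : ℕ) (J : ID K) : P.1 ^ k * J.1 ≠ ⊥ :=
  mul_ne_zero (pow_ne_zero _ P.2.2) J.2

lemma xs_pow_mul (σ : ℝ) (P : PR K) (k : ℕ) (J : ID K) :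
    xs σ ⟨P.1 ^ k * J.1, pow_mul_ne P k J⟩ = xs σ P.id ^ k * xs σ J := by
  have h1 : (0:ℝ) ≤ Nid P.id := by linarith [Nid_ge P.id]
  have h2 : (0:ℝ) ≤ Nid J := by linarith [Nid_ge J]
  have h : Nid ⟨P.1 ^ k * J.1, pow_mul_ne P k J⟩ = Nid P.id ^ k * Nid J := by
    simp [Nid, PR.id]
  rw [xs, xs, xs, h, ← ENNReal.ofReal_pow (by positivity), ← ENNReal.ofReal_mul (by positivity),
    Real.mul_rpow (by positivity) h2, ← Real.rpow_natCast, ← Real.rpow_natCast, ← Real.rpow_mul h1, ← Real.rpow_mul h1, mul_comm (k : ℝ)]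

lemma euler_fin (σ : ℝ) (S : Finset (PR K)) :
    ∑' J : AS S, xs σ J.1 ≤ ∏ P ∈ S, (1 - xs σ P.id)⁻¹ := by
  induction S using Finset.induction_on with
  | empty =>
    have : ∀ J : AS (∅ : Finset (PR K)), J.1 = ⟨⊤, top_ne_bot⟩ := by
      intro J
      by_contra h
      obtain ⟨P, hP⟩ := exists_PR J.1 (fun h2 => h (Subtype.ext h2))
      simpa using J.2 P hP
    have hs : Subsingleton (AS (∅ : Finset (PR K))) := ⟨fun a b => Subtype.ext ((this a).trans (this b).symm)⟩
    simp only [Finset.prod_empty]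
    rcases isEmpty_or_nonempty (AS (∅ : Finset (PR K))) with he | ⟨⟨J⟩⟩
    · simp
    · rw [tsum_eq_single J (fun b hb => absurd (Subsingleton.elim b J) hb), this J]
      simp [xs, Nid]
  | insert P S hP ih =>
    rw [Finset.prod_insert hP, ← ENNReal.tsum_geometric]
    have hmem : ∀ (k : ℕ) (J : AS S), ∀ Q : PR K, Q.1 ∣ P.1 ^ k * J.1.1 → Q ∈ insert P S := by
      intro k J Q hQ
      rcases (PR_prime Q).dvd_or_dvd hQ with h | h
      · rw [PR_eq ((PR_prime Q).dvd_of_dvd_pow h)]; exact Finset.mem_insert_self _ _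
      · exact Finset.mem_insert_of_mem (J.2 Q h)
    let f : ℕ × AS S → AS (insert P S) := fun q => ⟨⟨P.1 ^ q.1 * q.2.1.1, pow_mul_ne P q.1 q.2.1⟩, hmem q.1 q.2⟩
    have hf : Function.Surjective f := by
      intro I
      have hfin : FiniteMultiplicity P.1 I.1.1 := FiniteMultiplicity.of_prime_left (PR_prime P) I.1.2
      obtain ⟨c, hc, hnd⟩ := hfin.exists_eq_pow_mul_and_not_dvd
      have hc0 : c ≠ ⊥ := by rintro rfl; exact hnd (dvd_zero _)
      refine ⟨(multiplicity P.1 I.1.1, ⟨⟨c, hc0⟩, fun Q hQ => ?_⟩), Subtype.ext (Subtype.ext hc.symm)⟩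
      have h1 := I.2 Q (hc ▸ Dvd.dvd.mul_left hQ _)
      rcases Finset.mem_insert.1 h1 with h | h
      · subst h; exact absurd hQ hnd
      · exact h
    refine (ENNReal.tsum_le_tsum_comp_of_surjective hf (fun J => xs σ J.1)).trans ?_
    rw [ENNReal.tsum_prod']
    simp only [f, xs_pow_mul, ENNReal.tsum_mul_left, ENNReal.tsum_mul_right]
    gcongr

lemma xsP_le {σ : ℝ} (hσ : 1 ≤ σ) (P : PR K) : xs σ P.id ≤ 1 / 2 := by
  have h2 := NP_ge P
  have : Nid P.id ^ (-σ) ≤ 1 / 2 := by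
    calc Nid P.id ^ (-σ) ≤ Nid P.id ^ (-1 : ℝ) := Real.rpow_le_rpow_of_exponent_le (by linarith) (by linarith)
      _ = 1 / Nid P.id := by rw [Real.rpow_neg_one]; simp
      _ ≤ 1 / 2 := by gcongr
  calc xs σ P.id ≤ ENNReal.ofReal (1 / 2) := ENNReal.ofReal_le_ofReal this
    _ = 1 / 2 := by rw [ENNReal.ofReal_div_of_pos (by norm_num)]; simp

variable (K) in
/-- crude bound for the Dedekind zeta function -/
lemma zeta_le {σ : ℝ} (hσ : 1 < σ) :
    ∑' J : ID K, xs σ J ≤ ENNReal.ofReal (rexp (2 * (finrank ℚ K * ∑' m : ℕ, (m : ℝ) ^ (-σ)))) := by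
  have hsum : Summable (fun m : ℕ => (m : ℝ) ^ (-σ)) := Real.summable_nat_rpow.2 (by linarith)
  have h0 : ∀ m : ℕ, 0 ≤ (m : ℝ) ^ (-σ) := fun m => by positivity
  have hSP := SP_le (K := K) (σ := σ) (by linarith)
  rw [← ENNReal.ofReal_tsum_of_nonneg h0 hsum] at hSP
  rw [ENNReal.tsum_eq_iSup_sum]
  refine iSup_le fun F => ?_
  let S : Finset (PR K) := F.biUnion fun J => (finite_PR J).toFinset
  have h1 : ∑ J ∈ F, xs σ J ≤ ∑' J : AS S, xs σ J.1 := by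
    let g : F → AS S := fun J => ⟨J.1, fun P hP => Finset.mem_biUnion.2 ⟨J.1, J.2, by simpa using hP⟩⟩
    have hg : Function.Injective g := fun a b h => Subtype.ext (congrArg (fun z => z.1) h)
    rw [← Finset.sum_coe_sort, ← tsum_fintype (L := .unconditional _)]
    exact ENNReal.tsum_comp_le_tsum_of_injective hg (fun J => xs σ J.1)
  refine h1.trans ((euler_fin σ S).trans ?_)
  have h2 : ∀ P ∈ S, (1 - xs σ P.id)⁻¹ ≤ ENNReal.ofReal (rexp (2 * Nid P.id ^ (-σ))) := by
    intro P _
    have hx := xsP_le hσ.le P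
    have hn : 0 ≤ Nid P.id ^ (-σ) := Real.rpow_nonneg (by linarith [NP_ge P]) _
    have hr : Nid P.id ^ (-σ) ≤ 1 / 2 := by
      rw [xs] at hx
      have := ENNReal.toReal_mono (by simp) hx
      rwa [ENNReal.toReal_ofReal hn, ENNReal.toReal_div, ENNReal.toReal_one, ENNReal.toReal_ofNat] at this
    rw [xs]
    set t := Nid P.id ^ (-σ)
    rw [← ENNReal.ofReal_one, ← ENNReal.ofReal_sub _ hn, ← ENNReal.ofReal_inv_of_pos (by linarith)]
    refine ENNReal.ofReal_le_ofReal ?_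
    have h3 := Real.add_one_le_exp (2 * t)
    refine le_trans ?_ h3
    rw [inv_le_iff_one_le_mul₀ (by linarith)]
    nlinarith
  refine (Finset.prod_le_prod' h2).trans ?_
  rw [← ENNReal.ofReal_prod_of_nonneg (fun _ _ => (exp_pos _).le), ← Real.exp_sum, ← Finset.mul_sum]
  refine ENNReal.ofReal_le_ofReal (Real.exp_le_exp.2 (mul_le_mul_of_nonneg_left ?_ (by norm_num)))
  have h4 : ENNReal.ofReal (∑ P ∈ S, Nid P.id ^ (-σ)) ≤ ENNReal.ofReal (finrank ℚ K * ∑' m : ℕ, (m : ℝ) ^ (-σ)) := by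
    rw [ENNReal.ofReal_sum_of_nonneg (fun P _ => Real.rpow_nonneg (by linarith [NP_ge P]) _), ENNReal.ofReal_mul (by positivity)]
    refine (ENNReal.sum_le_tsum S).trans ?_
    simpa using hSP
  exact (ENNReal.ofReal_le_ofReal_iff (mul_nonneg (by positivity) (tsum_nonneg h0))).1 h4

end
end HZ
end
end

section
open scoped Classical
set_option linter.unusedSectionVars false
open Real MeasureTheory Filter Topology

noncomputable section
namespace HZ

lemma norm_one_add_le (w : ℂ) : ‖1 + w‖ ≤ rexp (w.re + ‖w‖ ^ 2 / 2) := by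
  have h : ‖1 + w‖ ^ 2 ≤ rexp (w.re + ‖w‖ ^ 2 / 2) ^ 2 := by
    rw [← Real.exp_nat_mul]
    have h1 : ‖1 + w‖ ^ 2 = 1 + (2 * w.re + ‖w‖ ^ 2) := by
      rw [← Complex.normSq_eq_norm_sq, ← Complex.normSq_eq_norm_sq, Complex.normSq_apply, Complex.normSq_apply]
      simp; ring
    rw [h1]
    have := Real.add_one_le_exp (2 * w.re + ‖w‖ ^ 2)
    push_cast
    rw [show 2 * (w.re + ‖w‖ ^ 2 / 2) = 2 * w.re + ‖w‖ ^ 2 by ring]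
    linarith
  exact le_of_sq_le_sq h (exp_pos _).le

lemma sum_inv_sq (n : ℕ) : ∑ j ∈ Finset.range n, (1 / ((j : ℝ) + 1) ^ 2) ≤ 2 - 1 / (n : ℝ) := by
  induction n with
  | zero => simp
  | succ n ih =>
    rw [Finset.sum_range_succ]
    rcases Nat.eq_zero_or_pos n with h | h
    · subst h; norm_num
    have hn : (0:ℝ) < n := by exact_mod_cast h
    have : (1 / ((n : ℝ) + 1) ^ 2) ≤ 1 / n - 1 / (n + 1) := by
      rw [div_sub_div _ _ hn.ne' (by positivity), div_le_div_iff₀ (by positivity) (by positivity)]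
      nlinarith
    push_cast
    linarith

lemma inv_Gamma_bound (z : ℂ) : ‖(Complex.Gamma z)⁻¹‖ ≤ ‖z‖ * rexp (‖z‖ + ‖z‖ ^ 2) := by
  by_cases hz : ∀ m : ℕ, z ≠ -m
  swap
  · push Not at hz
    obtain ⟨m, rfl⟩ := hz
    rw [Complex.Gamma_neg_nat_eq_zero]; simp; positivity
  have h1 : Tendsto (fun n => ‖(Complex.GammaSeq z n)⁻¹‖) atTop (𝓝 ‖(Complex.Gamma z)⁻¹‖) :=
    ((Complex.GammaSeq_tendsto_Gamma z).inv₀ (Complex.Gamma_ne_zero hz)).norm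
  refine le_of_tendsto h1 ?_
  filter_upwards [eventually_ge_atTop 1] with n hn
  have hn0 : (0 : ℝ) < n := by exact_mod_cast hn
  have e1 : (Complex.GammaSeq z n)⁻¹ = (n : ℂ) ^ (-z) * (z * ∏ j ∈ Finset.range n, (1 + z / (j + 1))) := by
    unfold Complex.GammaSeq
    rw [Finset.prod_range_succ', Complex.cpow_neg]
    have : (∏ j ∈ Finset.range n, (1 + z / (j + 1 : ℂ))) * (n.factorial : ℂ) = ∏ j ∈ Finset.range n, (z + (j + 1 : ℕ)) := by
      rw [← Finset.prod_range_add_one_eq_factorial]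
      push_cast
      rw [← Finset.prod_mul_distrib]
      refine Finset.prod_congr rfl fun j _ => ?_
      have : (j : ℂ) + 1 ≠ 0 := by exact_mod_cast Nat.succ_ne_zero j
      field_simp
      ring
    rw [← this]
    have hf : (n.factorial : ℂ) ≠ 0 := by exact_mod_cast n.factorial_ne_zero
    have hc : (n : ℂ) ^ z ≠ 0 := by
      rw [Complex.cpow_ne_zero_iff]; left; exact_mod_cast hn0.ne'
    simp only [Nat.cast_zero, add_zero]
    field_simp
  rw [e1, norm_mul, norm_mul, norm_prod]
  have e2 : ‖(n : ℂ) ^ (-z)‖ = rexp (-z.re * Real.log n) := by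
    rw [Complex.norm_natCast_cpow_of_pos hn, Real.rpow_def_of_pos hn0]; simp [mul_comm]
  have e3 : ∏ j ∈ Finset.range n, ‖1 + z / (j + 1 : ℂ)‖ ≤ rexp (z.re * harmonic n + ‖z‖ ^ 2) := by
    have : ∀ j ∈ Finset.range n, ‖1 + z / (j + 1 : ℂ)‖ ≤ rexp (z.re * ((j : ℝ) + 1)⁻¹ + ‖z‖ ^ 2 / 2 * (1 / ((j : ℝ) + 1) ^ 2)) := by
      intro j _
      refine (norm_one_add_le _).trans (Real.exp_le_exp.2 (le_of_eq ?_))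
      have c1 : (j + 1 : ℂ) = ((j + 1 : ℝ) : ℂ) := by push_cast; rfl
      rw [c1, Complex.div_ofReal_re, norm_div, Complex.norm_real, Real.norm_eq_abs, abs_of_pos (by positivity)]
      field_simp
    refine (Finset.prod_le_prod (fun _ _ => norm_nonneg _) this).trans ?_
    rw [← Real.exp_sum, Finset.sum_add_distrib, ← Finset.mul_sum, ← Finset.mul_sum]
    refine Real.exp_le_exp.2 ?_
    have h4 := sum_inv_sq n
    have h5 : (0:ℝ) ≤ 1 / (n : ℝ) := by positivity
    have h6 : ‖z‖ ^ 2 / 2 * ∑ j ∈ Finset.range n, (1 / ((j : ℝ) + 1) ^ 2) ≤ ‖z‖ ^ 2 / 2 * 2 := by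
      gcongr; linarith
    have h7 : ((harmonic n : ℚ) : ℝ) = ∑ j ∈ Finset.range n, ((j : ℝ) + 1)⁻¹ := by
      simp [harmonic]
    rw [h7]; linarith
  rw [e2]
  calc rexp (-z.re * Real.log n) * (‖z‖ * ∏ j ∈ Finset.range n, ‖1 + z / (j + 1 : ℂ)‖)
      ≤ rexp (-z.re * Real.log n) * (‖z‖ * rexp (z.re * harmonic n + ‖z‖ ^ 2)) := by gcongr
    _ = ‖z‖ * rexp (z.re * (harmonic n - Real.log n) + ‖z‖ ^ 2) := by
      rw [mul_left_comm, ← Real.exp_add]; congr 2; ring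
    _ ≤ ‖z‖ * rexp (‖z‖ + ‖z‖ ^ 2) := by
      gcongr
      have a1 : (harmonic n : ℝ) - Real.log n ≤ 1 := by linarith [harmonic_le_one_add_log n]
      have a2 : 0 ≤ (harmonic n : ℝ) - Real.log n := by
        have h8 := log_add_one_le_harmonic n
        have : Real.log n ≤ Real.log (n + 1 : ℕ) := Real.log_le_log hn0 (by push_cast; linarith)
        linarith
      calc z.re * (harmonic n - Real.log n) ≤ |z.re| * (harmonic n - Real.log n) := by gcongr; exact le_abs_self _
        _ ≤ ‖z‖ * 1 := by gcongr; exact Complex.abs_re_le_norm z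
        _ = ‖z‖ := mul_one _

lemma Gamma_le_exp {x : ℝ} (hx : 1 ≤ x) : Real.Gamma x ≤ rexp (x ^ 2) := by
  have h : ∀ n : ℕ, ∀ x : ℝ, 1 ≤ x → x ≤ n + 2 → Real.Gamma x ≤ rexp (x ^ 2) := by
    intro n
    induction n with
    | zero =>
      intro x h1 h2
      have hc := Real.convexOn_Gamma.2 (show (1:ℝ) ∈ Set.Ioi 0 by simp) (show (2:ℝ) ∈ Set.Ioi 0 by simp)
        (show (0:ℝ) ≤ 2 - x by push_cast at h2; linarith) (show (0:ℝ) ≤ x - 1 by linarith) (by ring)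
      simp only [smul_eq_mul, Real.Gamma_one, Real.Gamma_two] at hc
      rw [show (2 - x) * 1 + (x - 1) * 2 = x by ring] at hc
      have := Real.add_one_le_exp (x ^ 2)
      nlinarith [sq_nonneg x]
    | succ n ih =>
      intro x h1 h2
      rcases le_total x 2 with h | h
      · exact ih x h1 (by linarith [(Nat.cast_nonneg n : (0:ℝ) ≤ n)])
      · have h3 := ih (x - 1) (by linarith) (by push_cast at h2; linarith)
        have h4 := Real.Gamma_add_one (s := x - 1) (by linarith)
        rw [sub_add_cancel] at h4
        rw [h4]
        have h5 := Real.add_one_le_exp (x - 1)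
        calc (x - 1) * Real.Gamma (x - 1) ≤ rexp (x - 1) * rexp ((x - 1) ^ 2) := 
              mul_le_mul (by linarith) h3 (Real.Gamma_pos_of_pos (by linarith)).le (Real.exp_pos _).le
          _ = rexp ((x - 1) + (x - 1) ^ 2) := by rw [Real.exp_add]
          _ ≤ _ := Real.exp_le_exp.2 (by nlinarith)
  obtain ⟨n, hn⟩ := exists_nat_ge x
  exact h n x hx (by linarith)

lemma entire_laplace (g : ℝ → ℝ) (hg0 : ∀ v, 0 ≤ g v)
    (hg : ∀ a : ℝ, IntegrableOn (fun v => g v * rexp (a * v)) (Set.Ioi 0)) :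
    Differentiable ℂ (fun z : ℂ => ∫ v in Set.Ioi (0:ℝ), (g v : ℂ) * Complex.exp (z * v)) := by
  intro z0
  have hgm : AEStronglyMeasurable g (volume.restrict (Set.Ioi 0)) := by
    have := (hg 0).aestronglyMeasurable
    simpa using this
  have hgc : AEStronglyMeasurable (fun v => (g v : ℂ)) (volume.restrict (Set.Ioi 0)) :=
    Complex.continuous_ofReal.comp_aestronglyMeasurable hgm
  have hn : ∀ (z : ℂ) (v : ℝ), ‖(g v : ℂ) * Complex.exp (z * v)‖ = g v * rexp (z.re * v) := by
    intro z v
    rw [norm_mul, Complex.norm_real, Real.norm_eq_abs, abs_of_nonneg (hg0 v), Complex.norm_exp]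
    simp
  refine (hasDerivAt_integral_of_dominated_loc_of_deriv_le (F' := fun z v => (g v : ℂ) * (Complex.exp (z * v) * v))
    (bound := fun v => g v * rexp ((z0.re + 2) * v)) (Metric.ball_mem_nhds z0 one_pos) ?_ ?_ ?_ ?_ (hg _) ?_).2.differentiableAt
  · exact Eventually.of_forall fun z => hgc.mul (Continuous.aestronglyMeasurable (by fun_prop))
  · refine (integrable_norm_iff (hgc.mul (Continuous.aestronglyMeasurable (by fun_prop)))).1 ?_
    exact (hg z0.re).congr (Eventually.of_forall fun v => (hn z0 v).symm)
  · exact hgc.mul (Continuous.aestronglyMeasurable (by fun_prop))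
  · refine (ae_restrict_iff' measurableSet_Ioi).2 (Eventually.of_forall fun v hv z hz => ?_)
    have hv0 : (0:ℝ) < v := hv
    rw [← mul_assoc, norm_mul, hn, Complex.norm_real, Real.norm_eq_abs, abs_of_pos hv0, mul_assoc]
    refine mul_le_mul_of_nonneg_left ?_ (hg0 v)
    have h1 : v ≤ rexp v := by linarith [Real.add_one_le_exp v]
    have h2 : z.re ≤ z0.re + 1 := by
      have := Complex.abs_re_le_norm (z - z0)
      rw [Metric.mem_ball, dist_eq_norm] at hz
      have := le_abs_self (z - z0).re
      rw [Complex.sub_re] at *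
      linarith
    calc rexp (z.re * v) * v ≤ rexp ((z0.re + 1) * v) * rexp v := by gcongr
      _ = _ := by rw [← Real.exp_add]; congr 1; ring
  · refine Eventually.of_forall fun v z _ => ?_
    have h1 : HasDerivAt (fun z : ℂ => z * v) (v : ℂ) z := by simpa using (hasDerivAt_id z).mul_const (v : ℂ)
    exact (h1.cexp).const_mul _

end HZ
end
end

section
open scoped Classical
set_option linter.unusedSectionVars false
open Real MeasureTheory Filter Topology

noncomputable section
namespace HZ

lemma hecke_abs (gE : ℝ → ENNReal) (hanti : Antitone gE) (A : ENNReal) (hA : A ≠ ⊤) (k : ℝ) (hk : 0 < k)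
    (fe : ∀ v, A + gE v = ENNReal.ofReal (rexp (-k * v)) * (A + gE (-v)))
    (hM : ∀ a, k < a → ∫⁻ v, gE v * ENNReal.ofReal (rexp (a * v)) ≠ ⊤) :
    ∃ G : ℂ → ℂ, Differentiable ℂ G ∧
      (∀ z : ℂ, ∀ a, k < a → z.re ≤ a → ‖G z‖ ≤ (∫⁻ v, gE v * ENNReal.ofReal (rexp (a * v))).toReal) ∧
      ∀ a, k < a → (∫⁻ v, gE v * ENNReal.ofReal (rexp (a * v))).toReal =
        (G a).re + (G (k - a)).re + A.toReal / (a - k) - A.toReal / a ∧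
        A.toReal / (a - k) - A.toReal / a ≤ (∫⁻ v, gE v * ENNReal.ofReal (rexp (a * v))).toReal ∧
        (G a).im = 0 ∧ (G (k - a)).im = 0 := by
  have hfin : ∀ v, gE v ≠ ⊤ := by
    intro v hv
    apply hM (k + 1) (by linarith)
    rw [eq_top_iff]
    calc (⊤ : ENNReal) = ∫⁻ u in Set.Ioo (v - 1) v, ⊤ := by simp
      _ ≤ ∫⁻ u in Set.Ioo (v - 1) v, gE u * ENNReal.ofReal (rexp ((k + 1) * u)) := by
        refine setLIntegral_mono' measurableSet_Ioo fun u hu => ?_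
        have : gE u = ⊤ := top_le_iff.1 (hv ▸ hanti hu.2.le)
        rw [this, ENNReal.top_mul]
        simp [Real.exp_pos]
      _ ≤ _ := setLIntegral_le_lintegral _ _
  have hmeas : Measurable gE := hanti.measurable
  set g : ℝ → ℝ := fun v => (gE v).toReal with hg
  have hg0 : ∀ v, 0 ≤ g v := fun v => ENNReal.toReal_nonneg
  have hgm : Measurable g := hmeas.ennreal_toReal
  have hfe : ∀ v, g (-v) = rexp (k * v) * (A.toReal + g v) - A.toReal := by
    intro v
    have h := congrArg ENNReal.toReal (fe v)
    rw [ENNReal.toReal_mul, ENNReal.toReal_add hA (hfin _), ENNReal.toReal_add hA (hfin _),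
      ENNReal.toReal_ofReal (Real.exp_pos _).le] at h
    change A.toReal + g v = rexp (-k * v) * (A.toReal + g (-v)) at h
    rw [h, ← mul_assoc, ← Real.exp_add, show k * v + -k * v = 0 by ring]
    simp
  have hMr : ∀ a, ∫⁻ v, gE v * ENNReal.ofReal (rexp (a * v)) = ∫⁻ v, ENNReal.ofReal (g v * rexp (a * v)) := by
    intro a
    refine lintegral_congr fun v => ?_
    rw [ENNReal.ofReal_mul (hg0 v), hg, ENNReal.ofReal_toReal (hfin v)]
  have hmm : ∀ a : ℝ, Measurable (fun v => g v * rexp (a * v)) := fun a => by fun_prop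
  have hint : ∀ a, k < a → Integrable (fun v => g v * rexp (a * v)) := by
    intro a ha
    refine (lintegral_ofReal_ne_top_iff_integrable (hmm a).aestronglyMeasurable
      (Eventually.of_forall fun v => mul_nonneg (hg0 v) (Real.exp_pos _).le)).1 ?_
    rw [← hMr]; exact hM a ha
  have hMi : ∀ a, k < a → (∫⁻ v, gE v * ENNReal.ofReal (rexp (a * v))).toReal = ∫ v, g v * rexp (a * v) := by
    intro a ha
    rw [hMr, integral_eq_lintegral_of_nonneg_ae (Eventually.of_forall fun v => mul_nonneg (hg0 v) (Real.exp_pos _).le) (hmm a).aestronglyMeasurable]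
  have hion : ∀ a, IntegrableOn (fun v => g v * rexp (a * v)) (Set.Ioi 0) := by
    intro a
    refine Integrable.mono' (hint (max a (k + 1)) (lt_of_lt_of_le (by linarith) (le_max_right _ _))).integrableOn
      (hmm a).aestronglyMeasurable ((ae_restrict_iff' measurableSet_Ioi).2 (Eventually.of_forall fun v hv => ?_))
    rw [Real.norm_of_nonneg (mul_nonneg (hg0 v) (Real.exp_pos _).le)]
    have hv' : (0:ℝ) < v := hv
    exact mul_le_mul_of_nonneg_left (Real.exp_le_exp.2 (mul_le_mul_of_nonneg_right (le_max_left _ _) hv'.le)) (hg0 v)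
  have hGr : ∀ a : ℝ, (∫ v in Set.Ioi (0:ℝ), (g v : ℂ) * Complex.exp (a * v)) = ((∫ v in Set.Ioi (0:ℝ), g v * rexp (a * v) : ℝ) : ℂ) := by
    intro a
    rw [← integral_complex_ofReal]
    refine integral_congr_ae (Eventually.of_forall fun v => ?_)
    push_cast; rfl
  have hsplit : ∀ a, k < a → ∫ v, g v * rexp (a * v) =
      (∫ v in Set.Ioi (0:ℝ), g v * rexp (a * v)) + (∫ v in Set.Ioi (0:ℝ), g v * rexp ((k - a) * v)) + A.toReal / (a - k) - A.toReal / a := by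
    intro a ha
    have e1 : ∀ c : ℝ, 0 < c → IntegrableOn (fun v => A.toReal * rexp (-c * v)) (Set.Ioi 0) := fun c hc =>
      (integrableOn_exp_mul_Ioi (by linarith) 0).const_mul _
    have e2 : ∀ c : ℝ, 0 < c → ∫ v in Set.Ioi (0:ℝ), A.toReal * rexp (-c * v) = A.toReal / c := fun c hc => by
      rw [integral_const_mul, integral_exp_mul_Ioi (by linarith) 0]; simp; field_simp
    have h1 := intervalIntegral.integral_Iic_add_Ioi (b := 0) (hint a ha).integrableOn (hint a ha).integrableOn
    have h2 := integral_comp_neg_Ioi (0:ℝ) (fun v => g v * rexp (a * v))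
    rw [neg_zero] at h2
    rw [← h1, ← h2]
    have h3 : ∀ v, g (-v) * rexp (a * -v) = g v * rexp ((k - a) * v) + A.toReal * rexp (-(a - k) * v) - A.toReal * rexp (-a * v) := by
      intro v
      rw [hfe, show (k - a) * v = k * v + a * -v by ring, show -(a - k) * v = k * v + a * -v by ring, Real.exp_add,
        show -a * v = a * -v by ring]
      ring
    simp_rw [h3]
    have f1 := e1 (a - k) (by linarith)
    have f2 := e1 a (by linarith)
    have f3 : IntegrableOn (fun x => g x * rexp ((k - a) * x) + A.toReal * rexp (-(a - k) * x)) (Set.Ioi 0) := (hion (k - a)).add f1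
    rw [integral_sub f3 f2, integral_add (hion (k - a)) f1, e2 _ (by linarith), e2 _ (by linarith)]
    ring
  have hI0 : ∀ a, 0 ≤ ∫ v in Set.Ioi (0:ℝ), g v * rexp (a * v) := fun a =>
    integral_nonneg fun v => mul_nonneg (hg0 v) (Real.exp_pos _).le
  refine ⟨fun z => ∫ v in Set.Ioi (0:ℝ), (g v : ℂ) * Complex.exp (z * v), entire_laplace g hg0 hion, ?_, ?_⟩
  · intro z a ha hza
    rw [hMi a ha]
    calc _ ≤ ∫ v in Set.Ioi (0:ℝ), ‖(g v : ℂ) * Complex.exp (z * v)‖ := norm_integral_le_integral_norm _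
      _ = ∫ v in Set.Ioi (0:ℝ), g v * rexp (z.re * v) := by
        refine integral_congr_ae (Eventually.of_forall fun v => ?_)
        simp only [norm_mul, Complex.norm_exp, Complex.norm_real, Real.norm_of_nonneg (hg0 v)]
        simp
      _ ≤ ∫ v in Set.Ioi (0:ℝ), g v * rexp (a * v) := by
        refine setIntegral_mono_on (hion _) (hion _) measurableSet_Ioi fun v hv => ?_
        have hv' : (0:ℝ) < v := hv
        exact mul_le_mul_of_nonneg_left (Real.exp_le_exp.2 (mul_le_mul_of_nonneg_right hza hv'.le)) (hg0 v)
      _ ≤ _ := setIntegral_le_integral (hint a ha) (Eventually.of_forall fun v => mul_nonneg (hg0 v) (Real.exp_pos _).le)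
  · intro a ha
    have e := hGr (k - a)
    push_cast at e
    refine ⟨?_, ?_, ?_, ?_⟩
    · rw [hMi a ha, hsplit a ha]; simp only [hGr, e, Complex.ofReal_re]
    · rw [hMi a ha, hsplit a ha]; linarith [hI0 a, hI0 (k - a)]
    · simp only [hGr, Complex.ofReal_im]
    · simp only [e, Complex.ofReal_im]

open NumberField NumberField.InfinitePlace NumberField.mixedEmbedding Module nonZeroDivisors
open NumberField.Units NumberField.Units.dirichletUnitTheorem
section
variable (K : Type*) [Field K] [NumberField K]

lemma Phi_anti : Antitone (Phi K) := by
  intro a b hab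
  refine lintegral_mono fun u => ENNReal.ofReal_le_ofReal (Real.exp_le_exp.2 ?_)
  have : 0 ≤ qf (tt u) (1:K) := Finset.sum_nonneg fun w _ => by have := (tt_pos u w).le; positivity
  have h2 := mul_le_mul_of_nonneg_right hab this
  nlinarith [Real.pi_pos]

def gE (v : ℝ) : ENNReal := Pf K (rexp v * Dab K ^ (-(1 / finrank ℚ K) : ℝ))

lemma gE_anti : Antitone (gE K) := by
  intro a b hab
  have := Dab_pos (K := K)
  refine ENNReal.tsum_le_tsum fun J => mul_le_mul_right (Phi_anti K ?_) _
  have := Nid_ge J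
  gcongr

lemma zeta_fin {σ : ℝ} (hσ : 1 < σ) : ∑' J : ID K, xs σ J ≠ ⊤ :=
  ne_top_of_le_ne_top ENNReal.ofReal_ne_top (zeta_le K hσ)

instance ID_countable : Countable (ID K) := by
  have h := Summable.countable_support_ennreal (zeta_fin K one_lt_two)
  have : (Function.support fun J : ID K => xs 2 J) = Set.univ := by
    ext J
    have := Nid_ge J
    have h0 : 0 < Nid J := by linarith
    simp only [Function.mem_support, Set.mem_univ, iff_true, xs]
    simp [h0.ne']
  rw [this] at h
  exact Set.countable_univ_iff.1 h

lemma mellin_Pf : ∃ κ : ENNReal, κ ≠ 0 ∧ κ ≠ ⊤ ∧ ∀ p : ℝ, 0 < p →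
    ∫⁻ v, gE K v * ENNReal.ofReal (rexp (finrank ℚ K * p * v)) =
      κ * ENNReal.ofReal (Gp K p) * ENNReal.ofReal (Dab K ^ p) * ∑' J : ID K, xs (2 * p) J := by
  obtain ⟨c, c0, c1, hc⟩ := mellin_Phi K
  have hw0 : wK K ≠ 0 := by rw [wK]; exact_mod_cast Nat.card_pos.ne'
  have hn := npos (K := K)
  have hD := Dab_pos (K := K)
  refine ⟨wK K * c, mul_ne_zero hw0 c0, ENNReal.mul_ne_top (ENNReal.natCast_ne_top _) c1, fun p hp => ?_⟩
  set n : ℝ := ((finrank ℚ K : ℕ) : ℝ)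
  simp_rw [gE, Pf, ← ENNReal.tsum_mul_right]
  rw [lintegral_tsum, ← ENNReal.tsum_mul_left]
  · refine tsum_congr fun J => ?_
    have hJ : 0 < Nid J := lt_of_lt_of_le one_pos (Nid_ge J)
    set b : ℝ := -Real.log (Dab K) / n + 2 / n * Real.log (Nid J) with hb
    have e1 : ∀ v : ℝ, rexp v * Dab K ^ (-(1 / n) : ℝ) * Nid J ^ (2 / n : ℝ) = rexp (v + b) := by
      intro v
      rw [Real.rpow_def_of_pos hD, Real.rpow_def_of_pos hJ, ← Real.exp_add, ← Real.exp_add]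
      congr 1; rw [hb]; ring
    have e2 : ∀ v : ℝ, rexp (n * p * v) = rexp (n * p * (v + b)) * (Dab K ^ p * Nid J ^ (-(2 * p))) := by
      intro v
      rw [Real.rpow_def_of_pos hD, Real.rpow_def_of_pos hJ, ← Real.exp_add, ← Real.exp_add]
      congr 1; rw [hb]; field_simp; ring
    calc ∫⁻ v, wK K * Phi K (rexp v * Dab K ^ (-(1 / n) : ℝ) * Nid J ^ (2 / n : ℝ)) * ENNReal.ofReal (rexp (n * p * v))
        = ∫⁻ v, (wK K * ENNReal.ofReal (Dab K ^ p * Nid J ^ (-(2 * p)))) * (Phi K (rexp (v + b)) * ENNReal.ofReal (rexp (n * p * (v + b)))) := by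
          refine lintegral_congr fun v => ?_
          rw [e1, e2, ENNReal.ofReal_mul (Real.exp_pos _).le]; ring
      _ = (wK K * ENNReal.ofReal (Dab K ^ p * Nid J ^ (-(2 * p)))) * (c * ENNReal.ofReal (Gp K p)) := by
          rw [lintegral_const_mul' _ _ (ENNReal.mul_ne_top (show wK K ≠ ⊤ from ENNReal.natCast_ne_top _) ENNReal.ofReal_ne_top),
            lintegral_add_right_eq_self (fun v => Phi K (rexp v) * ENNReal.ofReal (rexp (n * p * v))), hc p hp]
      _ = _ := by rw [ENNReal.ofReal_mul (by positivity), xs]; ring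
  · intro J
    have : Measurable (Phi K) := (Phi_anti K).measurable
    refine Measurable.aemeasurable ?_
    fun_prop

end
end HZ
end
end

section
open scoped Classical
set_option linter.unusedSectionVars false
open Real MeasureTheory Filter Topology

noncomputable section
namespace HZ
open NumberField NumberField.InfinitePlace NumberField.mixedEmbedding Module nonZeroDivisors
open NumberField.Units NumberField.Units.dirichletUnitTheorem
section
variable (K : Type*) [Field K] [NumberField K]

def zR (σ : ℝ) : ℝ := (∑' J : ID K, xs σ J).toReal

lemma zR_pos {σ : ℝ} (hσ : 1 < σ) : 0 < zR K σ := by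
  refine ENNReal.toReal_pos (fun h => ?_) (zeta_fin K hσ)
  have := ENNReal.tsum_eq_zero.1 h ⟨⊤, by simp⟩
  simp [xs, Nid] at this

lemma zR_le {σ : ℝ} (hσ : 2 ≤ σ) : zR K σ ≤ rexp (2 * (finrank ℚ K * ∑' m : ℕ, (m : ℝ) ^ (-2 : ℝ))) := by
  refine ENNReal.toReal_le_of_le_ofReal (Real.exp_pos _).le (le_trans ?_ (zeta_le K one_lt_two))
  refine ENNReal.tsum_le_tsum fun J => ENNReal.ofReal_le_ofReal ?_
  exact Real.rpow_le_rpow_of_exponent_le (Nid_ge J) (by linarith)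

variable {K} in
lemma mult_cases (w : InfinitePlace K) : (1:ℝ) ≤ mult w ∧ (mult w : ℝ) ≤ 2 := by
  unfold mult; split_ifs <;> norm_num

lemma Gp_pos {p : ℝ} (hp : 0 < p) : 0 < Gp K p := by
  refine Finset.prod_pos fun w _ => ?_
  have := (mult_cases w).1
  have h2 : (0:ℝ) < mult w * p := by positivity
  have := Real.Gamma_pos_of_pos h2
  have := Real.pi_pos
  positivity

lemma card_pl : ((Finset.univ : Finset (InfinitePlace K)).card : ℝ) ≤ finrank ℚ K := by
  rw [← sum_mult_eq (K := K)]
  push_cast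
  calc _ = ∑ w : InfinitePlace K, (1:ℝ) := by simp
    _ ≤ _ := Finset.sum_le_sum fun w _ => (mult_cases w).1

lemma prod_le_exp (f : InfinitePlace K → ℝ) (B : ℝ) (hB : 0 ≤ B) (h0 : ∀ w, 0 ≤ f w) (h : ∀ w, f w ≤ rexp B) :
    ∏ w, f w ≤ rexp (finrank ℚ K * B) := by
  calc ∏ w, f w ≤ ∏ w : InfinitePlace K, rexp B := Finset.prod_le_prod (fun w _ => h0 w) fun w _ => h w
    _ = rexp ((Finset.univ : Finset (InfinitePlace K)).card * B) := by rw [Finset.prod_const, ← Real.exp_nat_mul]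
    _ ≤ _ := by gcongr; exact_mod_cast card_pl K

lemma Gp_le {t : ℝ} (ht : 1 ≤ t) : Gp K t ≤ rexp (finrank ℚ K * (4 * t ^ 2)) := by
  have hm := fun w : InfinitePlace K => mult_cases w
  have hG : ∀ w : InfinitePlace K, 0 ≤ Gamma (mult w * t) := fun w =>
    (Real.Gamma_pos_of_pos (by have := (hm w).1; positivity)).le
  refine prod_le_exp K _ _ (by positivity) (fun w => mul_nonneg (by positivity) (hG w)) fun w => ?_
  obtain ⟨h1, h2⟩ := hm w
  calc _ ≤ 1 * Gamma (mult w * t) := by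
        refine mul_le_mul_of_nonneg_right (Real.rpow_le_one (by positivity) ?_ (by positivity)) (hG w)
        rw [div_le_one (by positivity)]
        nlinarith [Real.pi_gt_three]
    _ ≤ rexp ((mult w * t) ^ 2) := by rw [one_mul]; exact Gamma_le_exp (by nlinarith)
    _ ≤ _ := Real.exp_le_exp.2 (by nlinarith [mul_nonneg (mul_nonneg (by positivity : (0:ℝ) ≤ 2 + mult w) (by linarith : (0:ℝ) ≤ 2 - mult w)) (sq_nonneg t)])

variable {K} in
def ew (w : InfinitePlace K) (s : ℂ) : ℂ := Complex.exp (Real.log (π * mult w) * (mult w * s / 2)) *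
  if w = w₀ then (Complex.Gamma (mult w * s / 2 + 1))⁻¹ else (Complex.Gamma (mult w * s / 2))⁻¹

lemma ew_diff (w : InfinitePlace K) : Differentiable ℂ (ew w) := by
  unfold ew
  refine Differentiable.mul (by fun_prop) ?_
  split_ifs
  · exact Complex.differentiable_one_div_Gamma.comp (by fun_prop : Differentiable ℂ fun s : ℂ => mult w * s / 2 + 1)
  · exact Complex.differentiable_one_div_Gamma.comp (by fun_prop : Differentiable ℂ fun s : ℂ => mult w * s / 2)

lemma invG_le {z : ℂ} {t : ℝ} (h : ‖z‖ ≤ t) : ‖(Complex.Gamma z)⁻¹‖ ≤ rexp (2 * t + t ^ 2) := by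
  have := Real.add_one_le_exp t
  calc _ ≤ ‖z‖ * rexp (‖z‖ + ‖z‖ ^ 2) := inv_Gamma_bound z
    _ ≤ rexp t * rexp (t + t ^ 2) := by
      gcongr
      linarith
    _ = _ := by rw [← Real.exp_add]; congr 1; ring

lemma ew_le (w : InfinitePlace K) (s : ℂ) : ‖ew w s‖ ≤ rexp (12 * (1 + ‖s‖) ^ 2) := by
  obtain ⟨h1, h2⟩ := mult_cases w
  set t := 1 + ‖s‖ with htd
  have ht : 1 ≤ t := by have := norm_nonneg s; linarith
  have hz : ‖(mult w * s / 2 : ℂ)‖ ≤ t := by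
    simp only [norm_div, norm_mul, Complex.norm_natCast, Complex.norm_ofNat]
    have := norm_nonneg s
    nlinarith
  have e1 : ‖Complex.exp (Real.log (π * mult w) * (mult w * s / 2))‖ ≤ rexp (3 * t) := by
    rw [Complex.norm_exp]
    refine Real.exp_le_exp.2 (le_trans (Complex.re_le_norm _) ?_)
    rw [norm_mul, Complex.norm_real, Real.norm_eq_abs]
    have h3 : 0 ≤ Real.log (π * mult w) := Real.log_nonneg (by nlinarith [Real.pi_gt_three])
    rw [abs_of_nonneg h3]
    have h4 : Real.log (π * mult w) ≤ 3 := by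
      rw [Real.log_le_iff_le_exp (by positivity)]
      have : (8:ℝ) ≤ rexp 3 := by
        have := Real.quadratic_le_exp_of_nonneg (show (0:ℝ) ≤ 3 by norm_num)
        linarith
      nlinarith [Real.pi_lt_four]
    gcongr
  have e2 : ‖(if w = w₀ then (Complex.Gamma (mult w * s / 2 + 1))⁻¹ else (Complex.Gamma (mult w * s / 2))⁻¹ : ℂ)‖ ≤ rexp (2 * (2 * t) + (2 * t) ^ 2) := by
    split_ifs
    · refine invG_le ?_
      calc _ ≤ ‖(mult w * s / 2 : ℂ)‖ + ‖(1:ℂ)‖ := norm_add_le _ _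
        _ ≤ 2 * t := by rw [norm_one]; linarith
    · exact invG_le (by linarith)
  rw [ew, norm_mul]
  calc _ ≤ rexp (3 * t) * rexp (2 * (2 * t) + (2 * t) ^ 2) := by gcongr
    _ = rexp (3 * t + (2 * (2 * t) + (2 * t) ^ 2)) := (Real.exp_add _ _).symm
    _ ≤ _ := Real.exp_le_exp.2 (by nlinarith)

lemma Gp_ew {s : ℝ} (hs : 0 < s) : (Gp K (s / 2) : ℂ) * (mult (w₀ : InfinitePlace K) * s / 2 * ∏ w : InfinitePlace K, ew w s) = 1 := by
  have e1 : (mult (w₀ : InfinitePlace K) * s / 2 : ℂ) = ∏ w : InfinitePlace K, if w = w₀ then (mult w * s / 2 : ℂ) else 1 := by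
    rw [Finset.prod_ite_eq' Finset.univ w₀ (fun w => (mult w * s / 2 : ℂ))]; simp
  rw [e1, ← Finset.prod_mul_distrib, Gp, Complex.ofReal_prod, ← Finset.prod_mul_distrib]
  refine Finset.prod_eq_one fun w _ => ?_
  have h1 := (mult_cases w).1
  have hp : (0:ℝ) < mult w * (s / 2) := by positivity
  have hG := (Real.Gamma_pos_of_pos hp).ne'
  have e2 : (if w = w₀ then (mult w * s / 2 : ℂ) else 1) * ew w s =
      Complex.exp (Real.log (π * mult w) * (mult w * s / 2)) * (Complex.Gamma (mult w * s / 2))⁻¹ := by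
    rw [ew]
    split_ifs
    · rw [Complex.one_div_Gamma_eq_self_mul_one_div_Gamma_add_one (mult w * s / 2)]; ring
    · ring
  rw [e2]
  have e3 : Complex.exp (Real.log (π * mult w) * (mult w * s / 2)) * (Complex.Gamma (mult w * s / 2))⁻¹ =
      ((rexp (Real.log (π * mult w) * (mult w * (s / 2))) * (Gamma (mult w * (s / 2)))⁻¹ : ℝ) : ℂ) := by
    push_cast
    rw [← Complex.Gamma_ofReal]
    push_cast
    simp only [mul_div_assoc]
  rw [e3, ← Complex.ofReal_mul, ← Complex.ofReal_one]
  congr 1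
  rw [Real.rpow_def_of_pos (by positivity), one_div, Real.log_inv]
  calc _ = (rexp (-Real.log (π * mult w) * (mult w * (s / 2))) * rexp (Real.log (π * mult w) * (mult w * (s / 2)))) * (Gamma (mult w * (s / 2)) * (Gamma (mult w * (s / 2)))⁻¹) := by ring
    _ = 1 := by rw [← Real.exp_add, mul_inv_cancel₀ hG]; simp

def Bz : ℝ := 40 + 2 * ∑' m : ℕ, (m : ℝ) ^ (-2 : ℝ)

set_option maxHeartbeats 1000000 in
theorem hecke0 : ∃ F : ℂ → ℂ, Differentiable ℂ F ∧ (∀ s : ℝ, 1 < s → F s = (((s - 1) * zR K s : ℝ) : ℂ)) ∧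
    F 1 ≠ 0 ∧ ∀ s, ‖F s‖ ≤ rexp (Bz * (finrank ℚ K + Real.log (Dab K)) * (1 + ‖s‖) ^ 2) := by
  obtain ⟨κ, k0, k1, hκ⟩ := mellin_Pf K
  have hn := npos (K := K)
  have hD := Dab_pos (K := K)
  have hD1 : (1:ℝ) ≤ Dab K := by exact_mod_cast Dab_ge_one K
  set n : ℝ := ((finrank ℚ K : ℕ) : ℝ) with hnd
  set A : ENNReal := classNumber K * volume (FD K) with hAd
  have hA : A ≠ ⊤ := ENNReal.mul_ne_top (ENNReal.natCast_ne_top _)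
    (ZSpan.fundamentalDomain_isBounded ((basisUnitLattice K).ofZLatticeBasis ℝ)).measure_lt_top.ne
  have hM : ∀ p, 1 / 2 < p → (∫⁻ v, gE K v * ENNReal.ofReal (rexp (n * p * v))).toReal = κ.toReal * Gp K p * Dab K ^ p * zR K (2 * p) := by
    intro p hp
    rw [hκ p (by linarith)]
    simp only [ENNReal.toReal_mul]
    rw [ENNReal.toReal_ofReal (Gp_pos K (by linarith)).le, ENNReal.toReal_ofReal (by positivity), zR]
  obtain ⟨G, hGd, hGb, hGe⟩ := hecke_abs (gE K) (gE_anti K) A hA (n / 2) (by linarith)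
    (fun v => by
      have h := Pf_fe K (rexp v) (Real.exp_pos v)
      rw [← Real.exp_neg, ← Real.exp_mul] at h
      rw [show -(n / 2) * v = v * -(n / 2) by ring]
      exact h)
    (fun a ha => by
      have h := hκ (a / n) (by apply div_pos; linarith; exact hn)
      rw [mul_div_cancel₀ _ hn.ne'] at h
      rw [h]
      refine ENNReal.mul_ne_top (ENNReal.mul_ne_top (ENNReal.mul_ne_top k1 ENNReal.ofReal_ne_top) ENNReal.ofReal_ne_top) (zeta_fin K ?_)
      rw [← mul_div_assoc, lt_div_iff₀ hn]; linarith)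
  have hκ0 : 0 < κ.toReal := ENNReal.toReal_pos k0 k1
  set m0 : ℝ := ((mult (w₀ : InfinitePlace K) : ℕ) : ℝ) with hm0
  refine ⟨fun s => (κ.toReal : ℂ)⁻¹ * Complex.exp (-(Real.log (Dab K) * s / 2)) * (m0 / 2) * (∏ w : InfinitePlace K, ew w s) *
    (s * (s - 1) * (G (n * s / 2) + G (n / 2 - n * s / 2)) + 2 * A.toReal / n), ?_, ?_, ?_, ?_⟩
  · have h1 : Differentiable ℂ fun s : ℂ => ∏ w : InfinitePlace K, ew w s :=
      Differentiable.fun_finsetProd fun w _ => ew_diff K w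
    have h2 : Differentiable ℂ fun s : ℂ => G (n * s / 2) := hGd.comp (by fun_prop)
    have h3 : Differentiable ℂ fun s : ℂ => G (n / 2 - n * s / 2) := hGd.comp (by fun_prop)
    fun_prop
  · intro s hs
    have ha : n / 2 < n * (s / 2) := by nlinarith
    obtain ⟨q1, -, q2, q3⟩ := hGe (n * (s / 2)) ha
    rw [hM _ (by linarith)] at q1
    have c1 : G (n * s / 2) = ((G ((n * (s / 2) : ℝ) : ℂ)).re : ℂ) := by
      rw [show (n * s / 2 : ℂ) = ((n * (s / 2) : ℝ) : ℂ) by push_cast; ring]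
      exact Complex.ext (by simp) (by simpa using q2)
    have c2 : G (n / 2 - n * s / 2) = ((G (((n / 2 : ℝ) : ℂ) - ((n * (s / 2) : ℝ) : ℂ))).re : ℂ) := by
      rw [show (n / 2 - n * s / 2 : ℂ) = (((n / 2 : ℝ) : ℂ) - ((n * (s / 2) : ℝ) : ℂ)) by push_cast; ring]
      exact Complex.ext (by simp) (by simpa using q3)
    simp only [c1, c2]
    set g1 := (G ((n * (s / 2) : ℝ) : ℂ)).re
    set g2 := (G (((n / 2 : ℝ) : ℂ) - ((n * (s / 2) : ℝ) : ℂ))).re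
    have q4 : s * (s - 1) * (g1 + g2) + 2 * A.toReal / n = s * (s - 1) * (κ.toReal * Gp K (s / 2) * Dab K ^ (s / 2) * zR K s) := by
      rw [show (2 * (s / 2)) = s by ring] at q1
      rw [q1]
      have : s - 1 ≠ 0 := by linarith
      have e4 : n * (s / 2) - n / 2 = n * (s - 1) / 2 := by ring
      rw [e4]
      field_simp
      ring
    have q5 : (s * (s - 1) * (g1 + g2) + 2 * A.toReal / n : ℂ) = ((s * (s - 1) * (κ.toReal * Gp K (s / 2) * Dab K ^ (s / 2) * zR K s) : ℝ) : ℂ) := by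
      rw [← q4]; push_cast; ring
    rw [q5]
    have q6 := Gp_ew K (s := s) (by linarith)
    have q7 : Complex.exp (-(Real.log (Dab K) * s / 2)) * ((Dab K ^ (s / 2) : ℝ) : ℂ) = 1 := by
      rw [Real.rpow_def_of_pos hD, Complex.ofReal_exp, ← Complex.exp_add]
      rw [show (-(Real.log (Dab K) * s / 2 : ℂ) + ((Real.log (Dab K) * (s / 2) : ℝ) : ℂ)) = 0 by push_cast; ring, Complex.exp_zero]
    have q8 : (κ.toReal : ℂ)⁻¹ * κ.toReal = 1 := inv_mul_cancel₀ (by exact_mod_cast hκ0.ne')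
    have hm1 : (m0 : ℂ) = ((mult (w₀ : InfinitePlace K) : ℕ) : ℂ) := by simp [hm0]
    push_cast at q7 ⊢
    rw [hm1]
    calc _ = ((κ.toReal : ℂ)⁻¹ * κ.toReal) * (Complex.exp (-(Real.log (Dab K) * s / 2)) * ((Dab K ^ (s / 2) : ℝ) : ℂ)) * ((Gp K (s / 2) : ℂ) * (mult (w₀ : InfinitePlace K) * s / 2 * ∏ w : InfinitePlace K, ew w s)) * ((s - 1) * zR K s) := by
          push_cast; ring
      _ = _ := by
          push_cast
          rw [q6, q7, q8]; ring
  · have hA0 : 0 < A.toReal := by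
      refine ENNReal.toReal_pos (mul_ne_zero ?_ ?_) hA
      · simp [classNumber]
      · exact ZSpan.measure_fundamentalDomain_ne_zero _
    have q6 := Gp_ew K (s := 1) one_pos
    have q9 : (∏ w : InfinitePlace K, ew w (1:ℂ)) ≠ 0 := by
      intro h0
      rw [Complex.ofReal_one, h0] at q6
      simp at q6
    have hm : (m0 : ℂ) ≠ 0 := by
      rw [hm0]; exact_mod_cast (mult_pos (w := (w₀ : InfinitePlace K))).ne'
    have hn' : (n : ℂ) ≠ 0 := by exact_mod_cast hn.ne'
    have hA' : (A.toReal : ℂ) ≠ 0 := by exact_mod_cast hA0.ne'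
    have hk' : (κ.toReal : ℂ) ≠ 0 := by exact_mod_cast hκ0.ne'
    simp only [sub_self, mul_zero, zero_mul, zero_add]
    refine mul_ne_zero (mul_ne_zero (mul_ne_zero (mul_ne_zero (inv_ne_zero hk') (Complex.exp_ne_zero _)) ?_) q9) ?_
    · exact div_ne_zero hm two_ne_zero
    · exact div_ne_zero (mul_ne_zero two_ne_zero hA') hn'
  · intro s
    set t := 1 + ‖s‖ with htd
    have hs0 := norm_nonneg s
    have ht : 1 ≤ t := by linarith
    set M := κ.toReal * Gp K t * Dab K ^ t * zR K (2 * t) with hMd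
    have hM' := hM t (by linarith)
    have hat : n / 2 < n * t := by nlinarith
    have hre := Complex.abs_re_le_norm s
    have hre' := abs_le.1 hre
    have b1 : ‖G (n * s / 2)‖ ≤ M := by
      rw [hMd, ← hM']
      refine hGb _ _ hat ?_
      have : (n * s / 2 : ℂ).re = n * (s.re / 2) := by
        rw [show (n * s / 2 : ℂ) = ((n / 2 : ℝ) : ℂ) * s by push_cast; ring, Complex.re_ofReal_mul]; ring
      rw [this]
      gcongr
      linarith
    have b2 : ‖G (n / 2 - n * s / 2)‖ ≤ M := by
      rw [hMd, ← hM']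
      refine hGb _ _ hat ?_
      have : (n / 2 - n * s / 2 : ℂ).re = n * ((1 - s.re) / 2) := by
        rw [show (n / 2 - n * s / 2 : ℂ) = ((n / 2 : ℝ) : ℂ) * (1 - s) by push_cast; ring, Complex.re_ofReal_mul]; simp; ring
      rw [this]
      gcongr
      linarith
    have hA0 : 0 ≤ A.toReal := ENNReal.toReal_nonneg
    have hM0 : 0 ≤ M := le_trans (norm_nonneg _) b1
    have b3 : 2 * A.toReal / n ≤ 4 * t ^ 2 * M := by
      have h := (hGe _ hat).2.1
      rw [hM', ← hMd] at h
      have e : A.toReal / (n * t - n / 2) - A.toReal / (n * t) = 2 * A.toReal / n * (1 / (2 * t * (2 * t - 1))) := by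
        have : 2 * t - 1 ≠ 0 := by linarith
        have e4 : n * t - n / 2 = n * (2 * t - 1) / 2 := by ring
        rw [e4]
        field_simp
        ring
      rw [e, mul_one_div, div_le_iff₀ (by nlinarith)] at h
      nlinarith [mul_nonneg hM0 (by linarith : (0:ℝ) ≤ t)]
    have b4 : ‖(s * (s - 1) * (G (n * s / 2) + G (n / 2 - n * s / 2)) + 2 * A.toReal / n : ℂ)‖ ≤ 6 * t ^ 2 * M := by
      have e1 : ‖s - 1‖ ≤ t := by
        calc _ ≤ ‖s‖ + ‖(1:ℂ)‖ := norm_sub_le _ _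
          _ = t := by rw [norm_one]; ring
      have e2 : ‖(2 * A.toReal / n : ℂ)‖ = 2 * A.toReal / n := by
        rw [show (2 * A.toReal / n : ℂ) = ((2 * A.toReal / n : ℝ) : ℂ) by push_cast; rfl, Complex.norm_real, Real.norm_of_nonneg (by positivity)]
      calc _ ≤ ‖(s * (s - 1) * (G (n * s / 2) + G (n / 2 - n * s / 2)))‖ + ‖(2 * A.toReal / n : ℂ)‖ := norm_add_le _ _
        _ ≤ t * t * (M + M) + 4 * t ^ 2 * M := by
          rw [e2, norm_mul, norm_mul]
          refine add_le_add (mul_le_mul (mul_le_mul (by linarith) e1 (norm_nonneg _) (by linarith)) ((norm_add_le _ _).trans (add_le_add b1 b2)) (norm_nonneg _) (by positivity)) b3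
        _ = _ := by ring
    have b5 : ‖∏ w : InfinitePlace K, ew w s‖ ≤ rexp (n * (12 * t ^ 2)) := by
      rw [norm_prod]
      exact prod_le_exp K _ _ (by positivity) (fun w => norm_nonneg _) fun w => ew_le K w s
    have hlD : 0 ≤ Real.log (Dab K) := Real.log_nonneg hD1
    have b6 : ‖Complex.exp (-(Real.log (Dab K) * s / 2))‖ ≤ rexp (Real.log (Dab K) * t) := by
      rw [Complex.norm_exp]
      refine Real.exp_le_exp.2 (le_trans (Complex.re_le_norm _) ?_)
      rw [norm_neg, norm_div, norm_mul, Complex.norm_real, Real.norm_of_nonneg hlD]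
      simp
      nlinarith
    have b7 : ‖(m0 / 2 : ℂ)‖ ≤ 1 := by
      rw [show (m0 / 2 : ℂ) = ((m0 / 2 : ℝ) : ℂ) by push_cast; rfl, Complex.norm_real, Real.norm_of_nonneg (by positivity)]
      linarith [(mult_cases (w₀ : InfinitePlace K)).2]
    set Z := ∑' m : ℕ, (m : ℝ) ^ (-2 : ℝ) with hZ
    have hZ0 : 0 ≤ Z := tsum_nonneg fun m => by positivity
    have b8 : M ≤ κ.toReal * rexp (n * (4 * t ^ 2)) * rexp (Real.log (Dab K) * t) * rexp (2 * (n * Z)) := by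
      rw [hMd, Real.rpow_def_of_pos hD]
      have := Gp_le K ht
      have := zR_le K (σ := 2 * t) (by linarith)
      have : 0 ≤ zR K (2 * t) := ENNReal.toReal_nonneg
      gcongr
    have b9 : 6 * t ^ 2 ≤ rexp (n * (6 * t ^ 2)) := by
      have h1 : (1:ℝ) ≤ n := by rw [hnd]; exact_mod_cast finrank_pos (R := ℚ) (M := K)
      have := Real.add_one_le_exp (n * (6 * t ^ 2))
      nlinarith [sq_nonneg t]
    calc _ = κ.toReal⁻¹ * ‖Complex.exp (-(Real.log (Dab K) * s / 2))‖ * ‖(m0 / 2 : ℂ)‖ * ‖∏ w : InfinitePlace K, ew w s‖ * ‖(s * (s - 1) * (G (n * s / 2) + G (n / 2 - n * s / 2)) + 2 * A.toReal / n : ℂ)‖ := by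
          simp only [norm_mul, norm_inv, Complex.norm_real, Real.norm_of_nonneg hκ0.le]
      _ ≤ κ.toReal⁻¹ * rexp (Real.log (Dab K) * t) * 1 * rexp (n * (12 * t ^ 2)) * (rexp (n * (6 * t ^ 2)) * (κ.toReal * rexp (n * (4 * t ^ 2)) * rexp (Real.log (Dab K) * t) * rexp (2 * (n * Z)))) := by
          have : ‖(s * (s - 1) * (G (n * s / 2) + G (n / 2 - n * s / 2)) + 2 * A.toReal / n : ℂ)‖ ≤ rexp (n * (6 * t ^ 2)) * (κ.toReal * rexp (n * (4 * t ^ 2)) * rexp (Real.log (Dab K) * t) * rexp (2 * (n * Z))) :=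
            b4.trans (mul_le_mul b9 b8 hM0 (Real.exp_pos _).le)
          gcongr
      _ = rexp (Real.log (Dab K) * t + n * (12 * t ^ 2) + n * (6 * t ^ 2) + n * (4 * t ^ 2) + Real.log (Dab K) * t + 2 * (n * Z)) := by
          simp only [Real.exp_add]; field_simp
      _ ≤ _ := by
          refine Real.exp_le_exp.2 ?_
          rw [Bz, ← hZ]
          have i1 : 1 ≤ t ^ 2 := one_le_pow₀ ht
          have i2 : t ≤ t ^ 2 := le_self_pow₀ ht two_ne_zero
          have i3 := mul_le_mul_of_nonneg_left i2 hlD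
          have i4 := mul_le_mul_of_nonneg_left i1 (mul_nonneg hn.le hZ0)
          have i5 : 0 ≤ Z * Real.log (Dab K) * t ^ 2 := by positivity
          have i6 : 0 ≤ n * t ^ 2 := by positivity
          have i7 : 0 ≤ Real.log (Dab K) * t ^ 2 := by positivity
          have i8 : (40 + 2 * Z) * (n + Real.log (Dab K)) * t ^ 2 = 40 * (n * t ^ 2) + 40 * (Real.log (Dab K) * t ^ 2) + 2 * (n * Z * t ^ 2) + 2 * (Z * Real.log (Dab K) * t ^ 2) := by ring
          rw [i8]
          linarith

end
end HZ
end
end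

section
open scoped Classical
set_option linter.unusedSectionVars false
open Real MeasureTheory Filter Topology

noncomputable section
namespace HZ

def HP : Set ℂ := {s : ℂ | 1 < s.re}

lemma HP_open : IsOpen HP := isOpen_lt continuous_const Complex.continuous_re

lemma ident {f g : ℂ → ℂ} (hf : DifferentiableOn ℂ f HP) (hg : DifferentiableOn ℂ g HP)
    (h : ∀ s : ℝ, 1 < s → f s = g s) : Set.EqOn f g HP := by
  refine AnalyticOnNhd.eqOn_of_preconnected_of_frequently_eq (hf.analyticOnNhd HP_open) (hg.analyticOnNhd HP_open)
    ((convex_halfSpace_re_gt 1).isPreconnected) (show ((2:ℝ) : ℂ) ∈ HP by simp [HP]) ?_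
  have ht : Tendsto (fun x : ℝ => (x : ℂ)) (𝓝[≠] 2) (𝓝[≠] ((2:ℝ) : ℂ)) := by
    refine tendsto_nhdsWithin_of_tendsto_nhds_of_eventually_within _ ?_ ?_
    · exact (Complex.continuous_ofReal.tendsto 2).mono_left nhdsWithin_le_nhds
    · filter_upwards [self_mem_nhdsWithin] with x hx
      exact fun h => hx (Complex.ofReal_injective h)
  refine ht.frequently (Eventually.frequently ?_)
  filter_upwards [nhdsWithin_le_nhds (Ioi_mem_nhds (show (1:ℝ) < 2 by norm_num))] with x hx
  exact h x hx

lemma hs_congr {ι E : Type*} [AddCommMonoid E] [TopologicalSpace E] {f g : ι → E} {x : E} (h : HasSum f x)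
    (e : ∀ i, f i = g i) : HasSum g x := (funext e : f = g) ▸ h

section DS
variable {ι : Type*} (a l : ι → ℝ)

def DS (s : ℂ) : ℂ := ∑' i, (a i : ℂ) * Complex.exp (-(l i) * s)

variable {a l}

lemma ds_norm (ha : ∀ i, 0 ≤ a i) (i : ι) (s : ℂ) :
    ‖(a i : ℂ) * Complex.exp (-(l i) * s)‖ = a i * rexp (-(l i) * s.re) := by
  rw [norm_mul, Complex.norm_real, Real.norm_of_nonneg (ha i), Complex.norm_exp]
  simp

lemma ds_loc (ha : ∀ i, 0 ≤ a i) (hl : ∀ i, 0 ≤ l i) (σ : ℝ) (i : ι) (s : ℂ) (hs : s ∈ {s : ℂ | σ < s.re}) :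
    ‖(a i : ℂ) * Complex.exp (-(l i) * s)‖ ≤ a i * rexp (-(l i) * σ) := by
  rw [ds_norm ha]
  refine mul_le_mul_of_nonneg_left (Real.exp_le_exp.2 ?_) (ha i)
  have hs' : σ < s.re := hs
  nlinarith [hl i]

lemma ds_hasDeriv (ha : ∀ i, 0 ≤ a i) (hl : ∀ i, 0 ≤ l i) (hs : ∀ σ, 1 < σ → Summable fun i => a i * rexp (-(l i) * σ))
    {s : ℂ} (h : s ∈ HP) : DifferentiableAt ℂ (DS a l) s ∧
    HasSum (fun i => -((a i * l i : ℝ) : ℂ) * Complex.exp (-(l i) * s)) (deriv (DS a l) s) := by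
  have h1 : 1 < s.re := h
  obtain ⟨σ, hσ1, hσ2⟩ := exists_between h1
  have ho : IsOpen {s : ℂ | σ < s.re} := isOpen_lt continuous_const Complex.continuous_re
  have hd : ∀ i, DifferentiableOn ℂ (fun s : ℂ => (a i : ℂ) * Complex.exp (-(l i) * s)) {s : ℂ | σ < s.re} := fun i =>
    Differentiable.differentiableOn (by fun_prop)
  refine ⟨(Complex.differentiableOn_tsum_of_summable_norm (hs σ hσ1) hd ho (ds_loc ha hl σ)).differentiableAt (ho.mem_nhds hσ2), ?_⟩
  refine hs_congr (Complex.hasSum_deriv_of_summable_norm (hs σ hσ1) hd ho (ds_loc ha hl σ) hσ2) fun i => ?_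
  have : HasDerivAt (fun s : ℂ => (a i : ℂ) * Complex.exp (-(l i) * s)) ((a i : ℂ) * (Complex.exp (-(l i) * s) * (-(l i) * 1))) s :=
    (((hasDerivAt_id s).const_mul _).cexp).const_mul _
  rw [this.deriv]; push_cast; ring

lemma ds_diff (ha : ∀ i, 0 ≤ a i) (hl : ∀ i, 0 ≤ l i) (hs : ∀ σ, 1 < σ → Summable fun i => a i * rexp (-(l i) * σ)) :
    DifferentiableOn ℂ (DS a l) HP := fun _ h => (ds_hasDeriv ha hl hs h).1.differentiableWithinAt

lemma ds_real (σ : ℝ) : DS a l σ = ((∑' i, a i * rexp (-(l i) * σ) : ℝ) : ℂ) := by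
  rw [DS, Complex.ofReal_tsum]
  exact tsum_congr fun i => by push_cast; rfl

lemma ds_deriv_real (ha : ∀ i, 0 ≤ a i) (hl : ∀ i, 0 ≤ l i) (hs : ∀ σ, 1 < σ → Summable fun i => a i * rexp (-(l i) * σ))
    {σ : ℝ} (h : 1 < σ) : Summable (fun i => a i * l i * rexp (-(l i) * σ)) ∧
    deriv (DS a l) σ = -((∑' i, a i * l i * rexp (-(l i) * σ) : ℝ) : ℂ) := by
  have h1 := (ds_hasDeriv ha hl hs (show (σ : ℂ) ∈ HP by simpa [HP] using h)).2
  have e : ∀ i, -((a i * l i : ℝ) : ℂ) * Complex.exp (-(l i) * σ) = ((-(a i * l i * rexp (-(l i) * σ)) : ℝ) : ℂ) := fun i => by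
    push_cast; ring
  simp only [e] at h1
  refine ⟨by simpa using (Complex.summable_ofReal.1 h1.summable).neg, ?_⟩
  rw [← h1.tsum_eq, ← Complex.ofReal_tsum, tsum_neg]; push_cast; rfl

/-- Taylor coefficients at a real point -/
def SS (a l : ι → ℝ) (lam : ℝ) (k : ℕ) : ℝ := ∑' i, a i * rexp (-(l i) * lam) * (l i ^ k / k.factorial)

lemma ds_pow (ha : ∀ i, 0 ≤ a i) (hl : ∀ i, 0 ≤ l i) (hs : ∀ σ, 1 < σ → Summable fun i => a i * rexp (-(l i) * σ))
    {lam : ℝ} (hlam : 1 < lam) :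
    (∀ k, Summable fun i => a i * rexp (-(l i) * lam) * (l i ^ k / k.factorial)) ∧
    ∀ w : ℂ, ‖w‖ < lam - 1 → HasSum (fun k : ℕ => (SS a l lam k : ℂ) * w ^ k) (DS a l (lam - w)) := by
  have key : ∀ w : ℂ, ‖w‖ < lam - 1 → Summable (fun q : ι × ℕ => a q.1 * rexp (-(l q.1) * lam) * (l q.1 ^ q.2 / q.2.factorial) * ‖w‖ ^ q.2) := by
    intro w hw
    rw [summable_prod_of_nonneg]
    · have e : ∀ i, HasSum (fun k : ℕ => a i * rexp (-(l i) * lam) * (l i ^ k / k.factorial) * ‖w‖ ^ k) (a i * rexp (-(l i) * (lam - ‖w‖))) := by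
        intro i
        have := (NormedSpace.expSeries_div_hasSum_exp (𝔸 := ℝ) (l i * ‖w‖)).mul_left (a i * rexp (-(l i) * lam))
        rw [← Real.exp_eq_exp_ℝ, mul_assoc, ← Real.exp_add, show -(l i) * lam + l i * ‖w‖ = -(l i) * (lam - ‖w‖) by ring] at this
        refine hs_congr this fun k => ?_
        rw [mul_pow]; ring
      refine ⟨fun i => (e i).summable, ?_⟩
      refine (hs (lam - ‖w‖) (by linarith)).congr fun i => ?_
      exact (e i).tsum_eq.symm
    · intro q
      have := ha q.1
      have := hl q.1
      change 0 ≤ _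
      positivity
  have hS : ∀ k, Summable fun i => a i * rexp (-(l i) * lam) * (l i ^ k / k.factorial) := by
    intro k
    obtain ⟨ε, h0, h1⟩ := exists_between (show (0:ℝ) < lam - 1 by linarith)
    have h2 := (key (ε : ℂ) (by rw [Complex.norm_real, Real.norm_of_nonneg h0.le]; exact h1)).comp_injective
      (i := fun i : ι => (i, k)) (fun i j h => by simpa using h)
    rw [Complex.norm_real, Real.norm_of_nonneg h0.le] at h2
    have h3 := h2.mul_right (ε ^ k)⁻¹
    refine h3.congr fun i => ?_
    simp only [Function.comp]
    field_simp
  refine ⟨hS, fun w hw => ?_⟩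
  have hC : Summable (fun q : ℕ × ι => ((a q.2 * rexp (-(l q.2) * lam) * (l q.2 ^ q.1 / q.1.factorial) : ℝ) : ℂ) * w ^ q.1) := by
    refine Summable.of_norm ?_
    refine ((Equiv.prodComm ℕ ι).summable_iff.2 (key w hw)).congr fun q => ?_
    have := ha q.2
    have := hl q.2
    simp only [Function.comp, Equiv.prodComm_apply, Prod.fst_swap, Prod.snd_swap]
    rw [norm_mul, norm_pow, Complex.norm_real, Real.norm_of_nonneg (by positivity)]
  have h1 : ∀ k : ℕ, HasSum (fun i => ((a i * rexp (-(l i) * lam) * (l i ^ k / k.factorial) : ℝ) : ℂ) * w ^ k) ((SS a l lam k : ℂ) * w ^ k) := fun k =>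
    ((Complex.hasSum_ofReal.2 (hS k).hasSum).mul_right _)
  have h2 := hC.hasSum.prod_fiberwise h1
  suffices h3 : DS a l (lam - w) = ∑' q : ℕ × ι, ((a q.2 * rexp (-(l q.2) * lam) * (l q.2 ^ q.1 / q.1.factorial) : ℝ) : ℂ) * w ^ q.1 by
    rw [h3]; exact h2
  have h4 := ((Equiv.prodComm ι ℕ).summable_iff.2 hC).tsum_prod
  rw [((Equiv.prodComm ι ℕ).tsum_eq (fun q : ℕ × ι => ((a q.2 * rexp (-(l q.2) * lam) * (l q.2 ^ q.1 / q.1.factorial) : ℝ) : ℂ) * w ^ q.1)).symm.trans h4, DS]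
  refine tsum_congr fun i => ?_
  have := (NormedSpace.expSeries_div_hasSum_exp (𝔸 := ℂ) (l i * w)).mul_left (a i * Complex.exp (-(l i) * lam))
  rw [← Complex.exp_eq_exp_ℂ, mul_assoc, ← Complex.exp_add, show -(l i : ℂ) * lam + l i * w = -(l i) * (lam - w) by ring] at this
  rw [← this.tsum_eq]
  refine tsum_congr fun k => ?_
  simp only [Function.comp, Equiv.prodComm_apply, Prod.swap]
  push_cast
  rw [mul_pow]; ring

end DS
end HZ
end
end

section
open scoped Classical
set_option linter.unusedSectionVars false
open Real MeasureTheory Filter Topology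

noncomputable section
namespace HZ
open NumberField Module nonZeroDivisors
variable (K : Type*) [Field K] [NumberField K]

def aQ (q : PR K × ℕ) : ℝ := Real.log (Nid q.1.id)
def lQ (q : PR K × ℕ) : ℝ := (q.2 + 1) * Real.log (Nid q.1.id)
def lI (J : ID K) : ℝ := Real.log (Nid J)

variable {K}

lemma aQ_pos (q : PR K × ℕ) : 0 < aQ K q := Real.log_pos (by linarith [NP_ge q.1])
lemma aQ_nn (q : PR K × ℕ) : 0 ≤ aQ K q := (aQ_pos q).le
lemma lQ_nn (q : PR K × ℕ) : 0 ≤ lQ K q := mul_nonneg (by positivity) (aQ_nn q)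
lemma lI_nn (J : ID K) : 0 ≤ lI K J := Real.log_nonneg (Nid_ge J)

lemma log_id (I : Ideal (𝓞 K)) (hI : I ≠ 0) : ENNReal.ofReal (Real.log (Ideal.absNorm I)) =
    ∑' (P : PR K) (k : ℕ), if P.1 ^ (k + 1) ∣ I then ENNReal.ofReal (Real.log (Nid P.id)) else 0 := by
  induction I using UniqueFactorizationMonoid.induction_on_prime with
  | h₁ => exact absurd rfl hI
  | h₂ x hx =>
    have : ∀ (P : PR K) (k : ℕ), ¬ P.1 ^ (k + 1) ∣ x := fun P k h =>
      (PR_prime P).not_isUnit (isUnit_of_dvd_unit ((dvd_pow_self _ (Nat.succ_ne_zero k)).trans h) hx)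
    have h1 : x = ⊤ := by simpa using hx
    simp only [this, if_false, tsum_zero]
    simp [h1]
  | h₃ a p ha hp ih =>
    let P0 : PR K := ⟨p, Ideal.isPrime_of_prime hp, hp.ne_zero⟩
    have e : ∀ P : PR K, (∑' k : ℕ, if P.1 ^ (k + 1) ∣ p * a then ENNReal.ofReal (Real.log (Nid P.id)) else 0) =
        (if P = P0 then ENNReal.ofReal (Real.log (Nid P.id)) else 0) +
          ∑' k : ℕ, if P.1 ^ (k + 1) ∣ a then ENNReal.ofReal (Real.log (Nid P.id)) else 0 := by
      intro P
      by_cases h : P = P0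
      · subst h
        rw [tsum_eq_zero_add' ENNReal.summable, if_pos rfl, if_pos (by simp [P0])]
        congr 1
        refine tsum_congr fun k => ?_
        have : P0.1 ^ (k + 1 + 1) ∣ p * a ↔ P0.1 ^ (k + 1) ∣ a := by
          rw [pow_succ' _ (k + 1)]
          exact mul_dvd_mul_iff_left hp.ne_zero
        simp only [this]
      · rw [if_neg h, zero_add]
        refine tsum_congr fun k => ?_
        have : P.1 ^ (k + 1) ∣ p * a ↔ P.1 ^ (k + 1) ∣ a := by
          refine ⟨fun h1 => (PR_prime P).pow_dvd_of_dvd_mul_left _ (fun h2 => h (PR_eq (Q := P0) h2)) h1, fun h1 => h1.mul_left _⟩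
        simp only [this]
    simp only [e]
    rw [ENNReal.tsum_add, ← ih ha, tsum_eq_single P0 (fun P h => if_neg h), if_pos rfl, ← ENNReal.ofReal_add, map_mul]
    · congr 1
      have h1 : Ideal.absNorm p ≠ 0 := by rw [Ne, Ideal.absNorm_eq_zero_iff]; exact hp.ne_zero
      have h2 : Ideal.absNorm a ≠ 0 := by rw [Ne, Ideal.absNorm_eq_zero_iff]; exact ha
      push_cast
      rw [Real.log_mul (by exact_mod_cast h1) (by exact_mod_cast h2)]
      rfl
    · exact Real.log_natCast_nonneg _
    · exact Real.log_natCast_nonneg _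

lemma exp_lI (J : ID K) (σ : ℝ) : rexp (-(lI K J) * σ) = Nid J ^ (-σ) := by
  rw [Real.rpow_def_of_pos (by linarith [Nid_ge J]), lI]; congr 1; ring

lemma xs_pow_eq (σ : ℝ) (q : PR K × ℕ) : xs σ q.1.id ^ (q.2 + 1) = ENNReal.ofReal (rexp (-(lQ K q) * σ)) := by
  have h := exp_lI q.1.id σ
  rw [xs, ← h, ← ENNReal.ofReal_pow (Real.exp_pos _).le, ← Real.exp_nat_mul, lQ, lI]
  congr 2; push_cast; ring

lemma tonelli (σ : ℝ) : ∑' J : ID K, ENNReal.ofReal (lI K J) * xs σ J =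
    (∑' q : PR K × ℕ, ENNReal.ofReal (aQ K q) * ENNReal.ofReal (rexp (-(lQ K q) * σ))) * ∑' J : ID K, xs σ J := by
  have e : ∀ J : ID K, ENNReal.ofReal (lI K J) * xs σ J = ∑' q : PR K × ℕ,
      if q.1.1 ^ (q.2 + 1) ∣ J.1 then ENNReal.ofReal (aQ K q) * xs σ J else 0 := by
    intro J
    have := log_id J.1 J.2
    rw [ENNReal.tsum_prod' (f := fun q : PR K × ℕ => if q.1.1 ^ (q.2 + 1) ∣ J.1 then ENNReal.ofReal (aQ K q) * xs σ J else 0)]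
    rw [lI, Nid, this, ← ENNReal.tsum_mul_right]
    refine tsum_congr fun P => ?_
    rw [← ENNReal.tsum_mul_right]
    refine tsum_congr fun k => ?_
    split_ifs <;> simp [aQ]
  simp only [e]
  rw [ENNReal.tsum_comm, ← ENNReal.tsum_mul_right]
  refine tsum_congr fun q => ?_
  rw [← xs_pow_eq, mul_assoc, ← ENNReal.tsum_mul_left, ← ENNReal.tsum_mul_left]
  have hinj : Function.Injective fun I : ID K => (⟨q.1.1 ^ (q.2 + 1) * I.1, pow_mul_ne q.1 _ I⟩ : ID K) := by
    intro I J h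
    have h1 : q.1.1 ^ (q.2 + 1) * I.1 = q.1.1 ^ (q.2 + 1) * J.1 := congrArg Subtype.val h
    exact Subtype.ext (mul_left_cancel₀ (pow_ne_zero _ q.1.2.2) h1)
  rw [← hinj.tsum_eq]
  · refine tsum_congr fun I => ?_
    rw [if_pos (dvd_mul_right _ _), xs_pow_mul]
  · intro J hJ
    have : q.1.1 ^ (q.2 + 1) ∣ J.1 := by
      by_contra h
      simp [h] at hJ
    obtain ⟨I, hI⟩ := this
    refine ⟨⟨I, fun h => J.2 ?_⟩, Subtype.ext hI.symm⟩
    rw [hI, h]; simp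

lemma tsum_bridge {ι : Type*} {f : ι → ℝ} (h0 : ∀ i, 0 ≤ f i) (h : ∑' i, ENNReal.ofReal (f i) ≠ ⊤) :
    Summable f ∧ (∑' i, ENNReal.ofReal (f i)).toReal = ∑' i, f i := by
  have hs : Summable f := by
    have := ENNReal.summable_toReal h
    exact this.congr fun i => ENNReal.toReal_ofReal (h0 i)
  refine ⟨hs, ?_⟩
  rw [← ENNReal.ofReal_tsum_of_nonneg h0 hs, ENNReal.toReal_ofReal (tsum_nonneg h0)]

lemma sumI (σ : ℝ) (hσ : 1 < σ) : Summable (fun J : ID K => (1:ℝ) * rexp (-(lI K J) * σ)) ∧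
    ∑' J : ID K, (1:ℝ) * rexp (-(lI K J) * σ) = zR K σ := by
  have h := zeta_fin K hσ
  have e : ∀ J : ID K, xs σ J = ENNReal.ofReal (1 * rexp (-(lI K J) * σ)) := fun J => by rw [exp_lI, xs, one_mul]
  rw [zR]
  simp only [e] at h ⊢
  obtain ⟨h1, h2⟩ := tsum_bridge (fun J => by positivity) h
  exact ⟨h1, h2.symm⟩

lemma sumQ (σ : ℝ) (hσ : 1 < σ) : Summable (fun q => aQ K q * rexp (-(lQ K q) * σ)) ∧
    ∑' J : ID K, (1:ℝ) * lI K J * rexp (-(lI K J) * σ) = (∑' q, aQ K q * rexp (-(lQ K q) * σ)) * zR K σ := by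
  have h1 := (ds_deriv_real (a := fun _ : ID K => (1:ℝ)) (l := lI K) (fun _ => zero_le_one) lI_nn (fun σ h => (sumI σ h).1) hσ).1
  have hT := tonelli (K := K) σ
  have e1 : ∀ J : ID K, ENNReal.ofReal (lI K J) * xs σ J = ENNReal.ofReal (1 * lI K J * rexp (-(lI K J) * σ)) := fun J => by
    rw [exp_lI, xs, one_mul, ENNReal.ofReal_mul (lI_nn J)]
  have e2 : ∀ q, ENNReal.ofReal (aQ K q) * ENNReal.ofReal (rexp (-(lQ K q) * σ)) = ENNReal.ofReal (aQ K q * rexp (-(lQ K q) * σ)) := fun q => by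
    rw [ENNReal.ofReal_mul (aQ_nn q)]
  simp only [e1, e2] at hT
  have hn : ∀ J : ID K, 0 ≤ 1 * lI K J * rexp (-(lI K J) * σ) := fun J => by have := lI_nn J; positivity
  have hz : ∑' J : ID K, xs σ J ≠ 0 := by
    intro h
    have := zR_pos K hσ
    rw [zR, h] at this
    simp at this
  have hfin : ∑' J : ID K, ENNReal.ofReal (1 * lI K J * rexp (-(lI K J) * σ)) ≠ ⊤ := by
    rw [← ENNReal.ofReal_tsum_of_nonneg hn h1]; exact ENNReal.ofReal_ne_top
  have hq : ∑' q, ENNReal.ofReal (aQ K q * rexp (-(lQ K q) * σ)) ≠ ⊤ := by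
    intro h
    rw [hT, h, ENNReal.top_mul hz] at hfin
    exact hfin rfl
  obtain ⟨q1, q2⟩ := tsum_bridge (fun q => mul_nonneg (aQ_nn q) (Real.exp_pos _).le) hq
  refine ⟨q1, ?_⟩
  rw [← q2, zR, ← ENNReal.toReal_mul, ← hT, (tsum_bridge hn hfin).2]

end HZ
end
end

section
open scoped Classical
set_option linter.unusedSectionVars false
open Real MeasureTheory Filter Topology

noncomputable section
namespace HZ
open NumberField Module nonZeroDivisors
variable (K : Type*) [Field K] [NumberField K]

lemma logD (hK : 1 < finrank ℚ K) : 1 ≤ Real.log (Dab K) ∧ (finrank ℚ K : ℝ) ≤ 3 * Real.log (Dab K) := by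
  have e : ((|discr K| : ℤ) : ℝ) = Dab K := by
    rw [Dab, Nat.cast_natAbs]
  have h1 := abs_discr_gt_two hK
  have h2 := abs_discr_ge hK
  rw [e] at h2
  have h3 : (3:ℝ) ≤ Dab K := by rw [← e]; exact_mod_cast h1
  have h4 : 1 ≤ Real.log (Dab K) := by
    rw [Real.le_log_iff_exp_le (by linarith)]
    linarith [Real.exp_one_lt_d9]
  refine ⟨h4, ?_⟩
  have h5 : (4 / 9 : ℝ) * (9 / 4) ^ finrank ℚ K ≤ Dab K := by
    refine le_trans ?_ h2
    gcongr
    linarith [Real.pi_gt_three]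
  have h6 := Real.log_le_log (by positivity) h5
  rw [Real.log_mul (by norm_num) (by positivity), Real.log_pow, show (4/9:ℝ) = (9/4)⁻¹ by norm_num, Real.log_inv] at h6
  have h7 : 5 / 9 ≤ Real.log (9/4) := by
    have := Real.one_sub_inv_le_log_of_pos (show (0:ℝ) < 9/4 by norm_num)
    norm_num at this ⊢; linarith
  have h8 : (1:ℝ) ≤ finrank ℚ K := by exact_mod_cast hK.le
  nlinarith

lemma zR_ge {σ : ℝ} (hσ : 1 < σ) : 1 ≤ zR K σ := by
  rw [← (sumI σ hσ).2]
  refine le_trans ?_ ((sumI (K := K) σ hσ).1.le_tsum ⟨⊤, by simp⟩ fun J _ => by positivity)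
  simp [lI, Nid]

lemma ident_ent {f g : ℂ → ℂ} (hf : Differentiable ℂ f) (hg : Differentiable ℂ g)
    (h : ∀ s : ℝ, 1 < s → f s = g s) : f = g := by
  have h1 := ident hf.differentiableOn hg.differentiableOn h
  refine AnalyticOnNhd.eq_of_eventuallyEq (z₀ := 2) (fun z _ => hf.analyticAt z) (fun z _ => hg.analyticAt z) ?_
  filter_upwards [HP_open.mem_nhds (show (2:ℂ) ∈ HP by simp [HP])] with z hz using h1 hz

open ComplexConjugate in
theorem package (hK : 1 < finrank ℚ K) : ∃ F : ℂ → ℂ, Differentiable ℂ F ∧ F 1 ≠ 0 ∧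
    (∀ s, F (conj s) = conj (F s)) ∧ (∀ t : ℝ, 1 < t → t - 1 ≤ ‖F t‖) ∧
    (∀ s, ‖F s‖ ≤ rexp (4 * Bz * Real.log (Dab K) * (1 + ‖s‖) ^ 2)) ∧
    ∀ s ∈ HP, F s = (s - 1) * ∑' I : ID K, (Ideal.absNorm I.1 : ℂ) ^ (-s) ∧ F s ≠ 0 ∧
      DS (aQ K) (lQ K) s = 1 / (s - 1) - deriv F s / F s := by
  obtain ⟨F, hF, hFr, hF1, hFb⟩ := hecke0 K
  obtain ⟨hD1, hD2⟩ := logD K hK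
  refine ⟨F, hF, hF1, ?_, ?_, ?_, ?_⟩
  · have hg : Differentiable ℂ (conj ∘ F ∘ conj) := fun s => by
      have := (hF (conj s)).conj_conj
      rwa [Complex.conj_conj] at this
    have := ident_ent hF hg fun s hs => by
      simp only [Function.comp, Complex.conj_ofReal]
      rw [hFr s hs, Complex.conj_ofReal]
    intro s
    conv_lhs => rw [this]
    simp
  · intro t ht
    have := zR_ge K ht
    rw [hFr t ht, Complex.norm_real, Real.norm_of_nonneg (mul_nonneg (by linarith) (by linarith))]
    nlinarith
  · intro s
    refine (hFb s).trans (Real.exp_le_exp.2 ?_)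
    have hB : 0 ≤ Bz := by
      have : 0 ≤ ∑' m : ℕ, (m : ℝ) ^ (-2 : ℝ) := tsum_nonneg fun m => by positivity
      rw [Bz]; linarith
    refine mul_le_mul_of_nonneg_right ?_ (by positivity)
    nlinarith
  · have hI := fun σ h => (sumI (K := K) σ h).1
    have hQ := fun σ h => (sumQ (K := K) σ h).1
    have hW : ∀ σ, 1 < σ → Summable fun q => aQ K q / lQ K q * rexp (-(lQ K q) * σ) := by
      intro σ h
      refine ((hQ σ h).mul_left (Real.log 2)⁻¹).of_nonneg_of_le (fun q => mul_nonneg (div_nonneg (aQ_nn q) (lQ_nn q)) (Real.exp_pos _).le) fun q => ?_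
      rw [← mul_assoc]
      refine mul_le_mul_of_nonneg_right ?_ (Real.exp_pos _).le
      have h2 : Real.log 2 ≤ aQ K q := Real.log_le_log (by norm_num) (NP_ge q.1)
      have h3 : 0 < Real.log 2 := Real.log_pos (by norm_num)
      have h4 : 0 < aQ K q := aQ_pos q
      have h5 : aQ K q ≤ lQ K q := by
        change aQ K q ≤ (q.2 + 1) * aQ K q
        nlinarith [(Nat.cast_nonneg q.2 : (0:ℝ) ≤ q.2)]
      calc _ ≤ (1:ℝ) := (div_le_one (by linarith)).2 h5
        _ ≤ _ := by rw [inv_mul_eq_div, one_le_div h3]; exact h2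
    have h1nn : ∀ J : ID K, (0:ℝ) ≤ (fun _ => 1) J := fun _ => zero_le_one
    have hWn : ∀ q, 0 ≤ aQ K q / lQ K q := fun q => div_nonneg (aQ_nn q) (lQ_nn q)
    have dZ := ds_diff (a := fun _ : ID K => (1:ℝ)) h1nn lI_nn hI
    have dD := ds_diff (aQ_nn (K := K)) lQ_nn hQ
    set Z := DS (fun _ : ID K => (1:ℝ)) (lI K) with hZ
    set D := DS (aQ K) (lQ K) with hD
    set W := DS (fun q => aQ K q / lQ K q) (lQ K) with hWd
    have hZr : ∀ σ : ℝ, 1 < σ → Z σ = (zR K σ : ℂ) := fun σ h => by rw [hZ, ds_real, (sumI σ h).2]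
    have hW' : ∀ s ∈ HP, DifferentiableAt ℂ W s ∧ deriv W s = -D s := by
      intro s hs
      obtain ⟨q1, q2⟩ := ds_hasDeriv (a := fun q => aQ K q / lQ K q) hWn lQ_nn hW hs
      refine ⟨q1, ?_⟩
      rw [← q2.tsum_eq, hD, DS, ← tsum_neg]
      refine tsum_congr fun q => ?_
      have : lQ K q ≠ 0 := (mul_pos (by positivity) (aQ_pos q)).ne'
      rw [div_mul_cancel₀ _ this]; ring
    have hZ' : Set.EqOn (deriv Z) (fun s => -D s * Z s) HP := by
      refine ident (dZ.deriv HP_open) (dD.neg.mul dZ) fun σ h => ?_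
      rw [(ds_deriv_real (a := fun _ : ID K => (1:ℝ)) h1nn lI_nn hI h).2, (sumQ σ h).2, hZr σ h, hD, ds_real]
      push_cast; ring
    have hFZ : Set.EqOn F (fun s => (s - 1) * Z s) HP := by
      refine ident hF.differentiableOn (DifferentiableOn.mul (by fun_prop) dZ) fun σ h => ?_
      rw [hFr σ h]; simp only [hZr σ h]; push_cast; ring
    have hZ0 : ∀ s ∈ HP, Z s ≠ 0 := by
      have hd : ∀ s ∈ HP, HasDerivAt (fun s => Z s * Complex.exp (-W s)) 0 s := by
        intro s hs
        have a1 := (dZ.differentiableAt (HP_open.mem_nhds hs)).hasDerivAt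
        have a2 := ((hW' s hs).1.hasDerivAt.neg.cexp)
        refine (a1.mul a2).congr_deriv ?_
        rw [hZ' hs, (hW' s hs).2]; simp only [Pi.neg_apply]; ring
      obtain ⟨a, ha⟩ := HP_open.exists_is_const_of_deriv_eq_zero ((convex_halfSpace_re_gt 1).isPreconnected)
        (fun s hs => (hd s hs).differentiableAt.differentiableWithinAt) (fun s hs => (hd s hs).deriv)
      intro s hs h0
      have e1 := ha s hs
      have e2 := ha ((2:ℝ):ℂ) (by simp [HP])
      rw [h0, zero_mul] at e1
      rw [← e1, hZr 2 (by norm_num)] at e2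
      have := zR_pos K (σ := 2) (by norm_num)
      exact mul_ne_zero (by exact_mod_cast this.ne') (Complex.exp_ne_zero _) e2
    intro s hs
    have hs1 : s - 1 ≠ 0 := by
      intro h
      have : (1:ℝ) < s.re := hs
      have h2 : s = 1 := sub_eq_zero.1 h
      rw [h2] at this; simp at this
    refine ⟨?_, ?_, ?_⟩
    · rw [hFZ hs]
      simp only [hZ, DS]
      congr 1
      refine tsum_congr fun J => ?_
      have hJ : (Ideal.absNorm J.1 : ℂ) ≠ 0 := by
        have : Ideal.absNorm J.1 ≠ 0 := by rw [Ne, Ideal.absNorm_eq_zero_iff]; exact J.2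
        exact_mod_cast this
      rw [Complex.cpow_def_of_ne_zero hJ, Complex.ofReal_one, one_mul, lI, Nid, Complex.ofReal_log (by positivity)]
      congr 1
      push_cast; ring
    · rw [hFZ hs]; exact mul_ne_zero hs1 (hZ0 s hs)
    · have e : deriv F s = 1 * Z s + (s - 1) * (-D s * Z s) := by
        rw [(hFZ.eventuallyEq_of_mem (HP_open.mem_nhds hs)).deriv_eq]
        have a1 := (dZ.differentiableAt (HP_open.mem_nhds hs)).hasDerivAt
        rw [(((hasDerivAt_id' s).sub_const 1).fun_mul a1).deriv, hZ' hs]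
      rw [e, hFZ hs]
      have := hZ0 s hs
      simp only
      field_simp
      ring

end HZ
end
end

section
open scoped Classical
set_option linter.unusedSectionVars false
open Real MeasureTheory Filter Topology

noncomputable section
namespace HZ

def mp (U : Multiset ℂ) (z : ℂ) : ℂ := (U.map fun u => u - z).prod

lemma mp_deriv (U : Multiset ℂ) (z : ℂ) (hz : mp U z ≠ 0) :
    HasDerivAt (mp U) (-mp U z * (U.map fun u => 1 / (u - z)).sum) z := by
  induction U using Multiset.induction with
  | empty =>
    have : mp 0 = fun _ => (1:ℂ) := by ext; simp [mp]
    rw [this]; simpa using hasDerivAt_const z (1:ℂ)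
  | cons a U ih =>
    have e : mp (a ::ₘ U) = fun z => (a - z) * mp U z := by ext; simp [mp]
    rw [e] at hz ⊢
    have h1 : a - z ≠ 0 := left_ne_zero_of_mul hz
    have h2 := ih (right_ne_zero_of_mul hz)
    refine (((hasDerivAt_id' z).const_sub a).fun_mul h2).congr_deriv ?_
    simp only [Multiset.map_cons, Multiset.sum_cons]
    field_simp
    ring

lemma mp_le (U : Multiset ℂ) (r : ℝ) (h : ∀ u ∈ U, ‖u‖ ≤ r) : ‖mp U 0‖ ≤ r ^ Multiset.card U := by
  induction U using Multiset.induction with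
  | empty => simp [mp]
  | cons a U ih =>
    have e : mp (a ::ₘ U) 0 = a * mp U 0 := by simp [mp]
    rw [e, norm_mul, Multiset.card_cons, pow_succ']
    exact mul_le_mul (h a (by simp)) (ih fun u hu => h u (by simp [hu])) (norm_nonneg _) ((norm_nonneg a).trans (h a (by simp)))

lemma mp_ge (U : Multiset ℂ) (r : ℝ) (hr : 0 ≤ r) (z : ℂ) (h : ∀ u ∈ U, r ≤ ‖u - z‖) : r ^ Multiset.card U ≤ ‖mp U z‖ := by
  induction U using Multiset.induction with
  | empty => simp [mp]
  | cons a U ih =>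
    have e : mp (a ::ₘ U) z = (a - z) * mp U z := by simp [mp]
    rw [e, norm_mul, Multiset.card_cons, pow_succ']
    exact mul_le_mul (h a (by simp)) (ih fun u hu => h u (by simp [hu])) (by positivity) (norm_nonneg _)

lemma mp_diff (U : Multiset ℂ) : Differentiable ℂ (mp U) := by
  induction U using Multiset.induction with
  | empty =>
    have : mp 0 = fun _ => (1:ℂ) := by ext; simp [mp]
    rw [this]; fun_prop
  | cons a U ih =>
    have e : mp (a ::ₘ U) = fun z => (a - z) * mp U z := by ext; simp [mp]
    rw [e]; fun_prop

/-- growth of the quotient -/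
lemma quot_bd {G H : ℂ → ℂ} {U : Multiset ℂ} {r M : ℝ} (hr : 0 < r) (hH : Differentiable ℂ H) (hG0 : G 0 ≠ 0)
    (hb : ∀ z, ‖z‖ ≤ 3 * r → ‖G z‖ ≤ rexp M * ‖G 0‖) (hU : ∀ u ∈ U, ‖u‖ ≤ r) (hf : ∀ z, G z = mp U z * H z) :
    ∀ z, ‖z‖ ≤ 3 * r → ‖H z‖ * 2 ^ Multiset.card U ≤ rexp M * ‖H 0‖ := by
  have hp : (0:ℝ) < (2 * r) ^ Multiset.card U := by positivity
  have key : ∀ z ∈ frontier (Metric.ball (0:ℂ) (3 * r)), ‖H z‖ ≤ rexp M * ‖G 0‖ / (2 * r) ^ Multiset.card U := by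
    intro z hz
    have hz' : ‖z‖ = 3 * r := by
      rw [frontier_ball _ (by positivity)] at hz; simpa using hz
    have h1 := mp_ge U (2 * r) (by positivity) z fun u hu => by
      have h3 := norm_sub_norm_le z u
      rw [norm_sub_rev]
      linarith [hU u hu]
    have h2 := hb z hz'.le
    rw [hf z, norm_mul] at h2
    rw [le_div_iff₀ hp]
    nlinarith [norm_nonneg (H z)]
  intro z hz
  have h1 := Complex.norm_le_of_forall_mem_frontier_norm_le Metric.isBounded_ball (hH.diffContOnCl) key
    (z := z) (by rw [closure_ball _ (by positivity)]; simpa using hz)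
  have h2 := mp_le U r hU
  rw [le_div_iff₀ hp, mul_pow, hf 0, norm_mul] at h1
  have hp2 : (0:ℝ) < r ^ Multiset.card U := by positivity
  refine le_of_mul_le_mul_right (?_ : _ * r ^ Multiset.card U ≤ _ * r ^ Multiset.card U) hp2
  calc _ = ‖H z‖ * (2 ^ Multiset.card U * r ^ Multiset.card U) := by ring
    _ ≤ rexp M * (‖mp U 0‖ * ‖H 0‖) := h1
    _ ≤ rexp M * (r ^ Multiset.card U * ‖H 0‖) := by gcongr
    _ = _ := by ring

theorem loc {G : ℂ → ℂ} {r M : ℝ} (hr : 0 < r) (hM : 0 < M) (hG : Differentiable ℂ G) (hG0 : G 0 ≠ 0)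
    (hb : ∀ z, ‖z‖ ≤ 3 * r → ‖G z‖ ≤ rexp M * ‖G 0‖) :
    ∃ (U : Multiset ℂ) (h : ℂ → ℂ) (e : ℕ → ℂ), (∀ u ∈ U, G u = 0 ∧ ‖u‖ ≤ r) ∧ (∀ u, G u = 0 → ‖u‖ ≤ r → u ∈ U) ∧
      Multiset.card U * Real.log 2 ≤ M ∧
      (∀ w, ‖w‖ ≤ r / 4 → G w ≠ 0 → deriv G w / G w = h w - (U.map fun u => 1 / (u - w)).sum) ∧
      (∀ w, ‖w‖ ≤ r / 4 → ‖h w‖ ≤ 8 * M / r) ∧ (∀ k, ‖e k‖ ≤ 8 * M / r / (r / 4) ^ k) ∧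
      ∀ w, ‖w‖ < r / 4 → HasSum (fun k => e k * w ^ k) (h w) := by
  let Q : ℕ → Prop := fun n => ∃ U : Multiset ℂ, Multiset.card U = n ∧ (∀ u ∈ U, ‖u‖ ≤ r) ∧
    ∃ H : ℂ → ℂ, Differentiable ℂ H ∧ ∀ z, G z = mp U z * H z
  have hQ : ∀ n, Q n → (n:ℝ) * Real.log 2 ≤ M := by
    rintro n ⟨U, rfl, hU, H, hH, hf⟩
    have h1 := quot_bd hr hH hG0 hb hU hf 0 (by simp; positivity)
    have h0 : 0 < ‖H 0‖ := by
      rw [norm_pos_iff]; intro h; apply hG0; rw [hf, h, mul_zero]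
    rw [mul_comm] at h1
    have h2 := le_of_mul_le_mul_right h1 h0
    have h3 := Real.log_le_log (by positivity) h2
    rwa [Real.log_exp, Real.log_pow] at h3
  have hl2 : 0 < Real.log 2 := Real.log_pos (by norm_num)
  obtain ⟨n, hn, hmax⟩ : ∃ n, Q n ∧ ∀ m, Q m → m ≤ n := by
    obtain ⟨N, hN⟩ := exists_nat_ge (M / Real.log 2)
    have hle : ∀ m, Q m → m ≤ N := fun m hm => by
      have := hQ m hm
      rw [← le_div_iff₀ hl2] at this
      exact_mod_cast this.trans hN
    have h0 : Q 0 := ⟨0, rfl, by simp, G, hG, fun z => by simp [mp]⟩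
    exact ⟨Nat.findGreatest Q N, Nat.findGreatest_spec (Nat.zero_le N) h0, fun m hm => Nat.le_findGreatest (hle m hm) hm⟩
  obtain ⟨U, hUc, hU, H, hH, hf⟩ := id hn
  have hHnz : ∀ z, ‖z‖ ≤ r → H z ≠ 0 := by
    intro z hz h0
    have : Q (n + 1) := by
      refine ⟨z ::ₘ U, by simp [hUc], ?_, fun w => -dslope H z w, ?_, ?_⟩
      · intro u hu
        rcases Multiset.mem_cons.1 hu with h | h
        · exact h ▸ hz
        · exact hU u h
      · have : Differentiable ℂ (dslope H z) := by
          rw [← differentiableOn_univ] at hH ⊢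
          exact (Complex.differentiableOn_dslope univ_mem).2 hH
        exact this.neg
      · intro w
        have h1 := sub_smul_dslope H z w
        rw [h0, sub_zero, smul_eq_mul] at h1
        rw [hf w, ← h1]
        simp [mp]; ring
    have := hmax _ this
    omega
  have hUz : ∀ u ∈ U, G u = 0 := by
    intro u hu
    rw [hf, mp, Multiset.prod_eq_zero (Multiset.mem_map.2 ⟨u, hu, by simp⟩ : (0:ℂ) ∈ U.map fun v => v - u), zero_mul]
  have hUa : ∀ u, G u = 0 → ‖u‖ ≤ r → u ∈ U := by
    intro u h1 h2
    rw [hf] at h1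
    rcases mul_eq_zero.1 h1 with h | h
    · rw [mp, Multiset.prod_eq_zero_iff] at h
      obtain ⟨v, hv, e⟩ := Multiset.mem_map.1 h
      rwa [← sub_eq_zero.1 e]
    · exact absurd h (hHnz u h2)
  -- logarithm
  have hHb : ∀ z, ‖z‖ ≤ 3 * r → ‖H z‖ ≤ rexp M * ‖H 0‖ := fun z hz => by
    have h1 := quot_bd hr hH hG0 hb hU hf z hz
    have h2 : (1:ℝ) ≤ 2 ^ Multiset.card U := one_le_pow₀ (by norm_num)
    nlinarith [norm_nonneg (H z)]
  have hH' : Differentiable ℂ (deriv H) := fun z => ((hH.analyticAt z).deriv).differentiableAt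
  have hld : DifferentiableOn ℂ (fun z => deriv H z / H z) (Metric.ball 0 r) := by
    intro z hz
    exact ((hH' z).div (hH z) (hHnz z (by simpa using (mem_ball_zero_iff.1 hz).le))).differentiableWithinAt
  obtain ⟨g, hg0, hg⟩ := hld.isExactOn_ball.with_val_at 0 0
  have hgd : DifferentiableOn ℂ g (Metric.ball 0 r) := fun z hz => (hg z hz).differentiableAt.differentiableWithinAt
  have hexp : ∀ z ∈ Metric.ball (0:ℂ) r, H z = H 0 * Complex.exp (g z) := by
    have hd : ∀ s ∈ Metric.ball (0:ℂ) r, HasDerivAt (fun s => H s * Complex.exp (-g s)) 0 s := by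
      intro s hs
      refine ((hH s).hasDerivAt.fun_mul (hg s hs).neg.cexp).congr_deriv ?_
      have := hHnz s (by simpa using (mem_ball_zero_iff.1 hs).le)
      simp only [Pi.neg_apply]
      field_simp
      ring
    obtain ⟨a, ha⟩ := Metric.isOpen_ball.exists_is_const_of_deriv_eq_zero (convex_ball (0:ℂ) r).isPreconnected
      (fun s hs => (hd s hs).differentiableAt.differentiableWithinAt) (fun s hs => (hd s hs).deriv)
    intro z hz
    have e1 := ha z hz
    have e2 := ha 0 (Metric.mem_ball_self hr)
    simp only [hg0, neg_zero, Complex.exp_zero, mul_one] at e2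
    rw [e2, ← e1, mul_assoc, ← Complex.exp_add]; simp
  have hre : Set.MapsTo g (Metric.ball 0 r) {z | z.re ≤ M} := by
    intro z hz
    have h1 := hHb z (by have := mem_ball_zero_iff.1 hz; linarith)
    rw [hexp z hz, norm_mul, Complex.norm_exp, mul_comm] at h1
    have h0 : 0 < ‖H 0‖ := norm_pos_iff.2 (hHnz 0 (by simpa using hr.le))
    exact Real.exp_le_exp.1 (le_of_mul_le_mul_right h1 h0)
  have hgb : ∀ z, ‖z‖ ≤ r / 2 → ‖g z‖ ≤ 2 * M := by
    intro z hz
    have h1 := Complex.borelCaratheodory_zero hM hgd hre hr (z := z) (mem_ball_zero_iff.2 (by linarith)) hg0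
    refine h1.trans ?_
    rw [div_le_iff₀ (by linarith)]
    nlinarith [norm_nonneg z]
  have hhb : ∀ w, ‖w‖ ≤ r / 4 → ‖deriv H w / H w‖ ≤ 8 * M / r := by
    intro w hw
    have hsub : Metric.closedBall w (r / 4) ⊆ Metric.ball 0 r := by
      intro z hz
      have h1 : ‖z - w‖ ≤ r / 4 := by simpa [dist_eq_norm] using hz
      have h2 := norm_sub_norm_le z w
      exact mem_ball_zero_iff.2 (by linarith)
    have h1 := Complex.norm_deriv_le_of_forall_mem_sphere_norm_le (R := r / 4) (C := 2 * M) (by positivity)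
      ((hgd.mono hsub).diffContOnCl_ball (le_refl _)) (fun z hz => hgb z (by
        have h1 : ‖z - w‖ = r / 4 := by simpa [dist_eq_norm] using hz
        have h2 := norm_sub_norm_le z w
        linarith))
    rw [(hg w (mem_ball_zero_iff.2 (by linarith))).deriv] at h1
    refine h1.trans (le_of_eq ?_)
    field_simp; norm_num
  have hsub : Metric.closedBall (0:ℂ) (r / 4) ⊆ Metric.ball 0 r := fun z hz => by
    rw [mem_closedBall_zero_iff] at hz
    exact mem_ball_zero_iff.2 (by linarith)
  set h := fun z => deriv H z / H z with hh
  refine ⟨U, h, fun k => (k.factorial : ℂ)⁻¹ * iteratedDeriv k h 0, fun u hu => ⟨hUz u hu, hU u hu⟩, hUa, ?_, ?_, hhb, ?_, ?_⟩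
  · have := hQ n hn; rwa [← hUc] at this
  · intro w hw hGw
    have hm : mp U w ≠ 0 := fun h0 => hGw (by rw [hf, h0, zero_mul])
    have hHw : H w ≠ 0 := hHnz w (by linarith)
    have : G = fun z => mp U z * H z := funext hf
    rw [this, ((mp_deriv U w hm).fun_mul (hH w).hasDerivAt).deriv]
    simp only [hh]
    field_simp
    ring
  · intro k
    have h1 := Complex.norm_iteratedDeriv_le_of_forall_mem_sphere_norm_le k (R := r / 4) (C := 8 * M / r) (c := 0) (f := h) (by positivity)
      ((hld.mono hsub).diffContOnCl_ball (le_refl _)) (fun z hz => hhb z (by simpa using (mem_sphere_zero_iff_norm.1 hz).le))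
    rw [norm_mul, norm_inv, Complex.norm_natCast, inv_mul_le_iff₀ (by positivity)]
    refine h1.trans (le_of_eq ?_)
    ring
  · intro w hw
    have := Complex.hasSum_taylorSeries_on_ball (f := h) (c := 0) (r := r / 4) (hld.mono (Metric.ball_subset_closedBall.trans hsub)) (z := w) (mem_ball_zero_iff.2 hw)
    refine hs_congr this fun k => ?_
    simp only [smul_eq_mul, sub_zero]; ring

end HZ
end
end

section
open scoped Classical
set_option linter.unusedSectionVars false
open Real MeasureTheory Filter Topology

noncomputable section
namespace HZ

open ComplexConjugate in
structure Pk {ι : Type*} (a l : ι → ℝ) (F : ℂ → ℂ) (T : ℝ) : Prop where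
  ha : ∀ i, 0 ≤ a i
  hl : ∀ i, 0 ≤ l i
  hs : ∀ σ, 1 < σ → Summable fun i => a i * rexp (-(l i) * σ)
  hT : 1 ≤ T
  hF : Differentiable ℂ F
  h1 : F 1 ≠ 0
  hc : ∀ s, F (conj s) = conj (F s)
  hge : ∀ t : ℝ, 1 < t → t - 1 ≤ ‖F t‖
  hle : ∀ s, ‖F s‖ ≤ rexp (T * (1 + ‖s‖) ^ 2)
  hnz : ∀ s ∈ HP, F s ≠ 0
  hD : ∀ s ∈ HP, DS a l s = 1 / (s - 1) - deriv F s / F s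

variable {ι : Type*} {a l : ι → ℝ} {F : ℂ → ℂ} {T : ℝ}

lemma geo_hasSum {u w : ℂ} (h : ‖w‖ < ‖u‖) : HasSum (fun k : ℕ => 1 / u ^ (k + 1) * w ^ k) (1 / (u - w)) := by
  have hu : u ≠ 0 := by rw [← norm_pos_iff]; linarith [norm_nonneg w]
  have h1 : ‖w / u‖ < 1 := by rw [norm_div, div_lt_one (norm_pos_iff.2 hu)]; exact h
  have h2 := (hasSum_geometric_of_norm_lt_one h1).mul_left (1 / u)
  have huw : u - w ≠ 0 := fun h0 => by rw [sub_eq_zero.1 h0] at h; exact lt_irrefl _ h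
  have e : 1 / u * (1 - w / u)⁻¹ = 1 / (u - w) := by
    rw [show 1 - w / u = (u - w) / u by field_simp]; field_simp
  rw [e] at h2
  refine hs_congr h2 fun k => ?_
  rw [div_pow, pow_succ]; field_simp

lemma mgeo {w : ℂ} (U : Multiset ℂ) (h : ∀ u ∈ U, ‖w‖ < ‖u‖) :
    HasSum (fun k : ℕ => (U.map fun u => 1 / u ^ (k + 1)).sum * w ^ k) (U.map fun u => 1 / (u - w)).sum := by
  induction U using Multiset.induction with
  | empty => simpa using hasSum_zero
  | cons b U ih =>
    simp only [Multiset.map_cons, Multiset.sum_cons, add_mul]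
    exact (geo_hasSum (h b (by simp))).add (ih fun u hu => h u (by simp [hu]))

lemma pow_uniq {p q : ℕ → ℂ} {f : ℂ → ℂ} {ε : ℝ} (hε : 0 < ε) (hp : ∀ w, ‖w‖ < ε → HasSum (fun k => p k * w ^ k) (f w))
    (hq : ∀ w, ‖w‖ < ε → HasSum (fun k => q k * w ^ k) (f w)) : p = q := by
  have key : ∀ p : ℕ → ℂ, (∀ w, ‖w‖ < ε → HasSum (fun k => p k * w ^ k) (f w)) →
      HasFPowerSeriesAt f (FormalMultilinearSeries.ofScalars ℂ p) 0 := by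
    intro p hp
    rw [hasFPowerSeriesAt_iff]
    filter_upwards [Metric.ball_mem_nhds (0:ℂ) hε] with z hz
    rw [zero_add]
    refine hs_congr (hp z (mem_ball_zero_iff.1 hz)) fun k => ?_
    simp [mul_comm]
  have := (key p hp).eq_formalMultilinearSeries (key q hq)
  ext k
  have h2 := congrArg (fun s => FormalMultilinearSeries.coeff s k) this
  simpa using h2

lemma expn (P : Pk a l F T) {lam : ℝ} (hlam : 2 ≤ lam) : ∃ (U : Multiset ℂ) (h : ℂ → ℂ) (e : ℕ → ℂ),
    (∀ u ∈ U, F (lam - u) = 0 ∧ lam - 1 ≤ u.re ∧ ‖u‖ ≤ 8 * lam) ∧ (∀ ρ : ℂ, F ρ = 0 → ‖lam - ρ‖ ≤ 8 * lam → (lam - ρ : ℂ) ∈ U) ∧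
    Multiset.card U * Real.log 2 ≤ T * (1 + 25 * lam) ^ 2 ∧
    (∀ s ∈ HP, ‖lam - s‖ ≤ 2 * lam → DS a l s = 1 / (s - 1) + h (lam - s) - (U.map fun u => 1 / (u - (lam - s))).sum) ∧
    (∀ w, ‖w‖ ≤ 2 * lam → ‖h w‖ ≤ T * (1 + 25 * lam) ^ 2 / lam) ∧
    (∀ k, ‖e k‖ ≤ T * (1 + 25 * lam) ^ 2 / lam / (2 * lam) ^ k) ∧
    ∀ k, (SS a l lam k : ℂ) = 1 / ((lam : ℂ) - 1) ^ (k + 1) - (U.map fun u => 1 / u ^ (k + 1)).sum + e k := by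
  have hT := P.hT
  set M := T * (1 + 25 * lam) ^ 2 with hMd
  have hG : Differentiable ℂ fun w : ℂ => F (lam - w) := P.hF.comp (by fun_prop)
  have hlamHP : (lam : ℂ) ∈ HP := by simp [HP]; linarith
  have hd : ∀ w, deriv (fun w : ℂ => F (lam - w)) w = -deriv F (lam - w) := fun w => by
    rw [deriv_comp_const_sub]
  obtain ⟨U, h, e, h1, h2, h3, h4, h5, h6, h7⟩ := loc (r := 8 * lam) (M := M) (by linarith) (by positivity) hG (by simpa using P.hnz _ hlamHP)
    (fun z hz => by
      have q1 := P.hge lam (by linarith)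
      rw [sub_zero]
      calc _ ≤ rexp (T * (1 + ‖lam - z‖) ^ 2) := P.hle _
        _ ≤ rexp M := by
          refine Real.exp_le_exp.2 ?_
          have : ‖(lam - z : ℂ)‖ ≤ 25 * lam := by
            refine (norm_sub_le _ _).trans ?_
            rw [Complex.norm_real, Real.norm_of_nonneg (by linarith)]
            linarith
          rw [hMd]; gcongr
        _ ≤ rexp M * ‖F lam‖ := le_mul_of_one_le_right (Real.exp_pos _).le (by linarith))
  have c1 : 8 * M / (8 * lam) = M / lam := by field_simp
  have c2 : 8 * lam / 4 = 2 * lam := by ring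
  rw [c1, c2] at h6
  simp only [c1, c2] at h4 h5 h7
  have hUre : ∀ u ∈ U, lam - 1 ≤ u.re := by
    intro u hu
    by_contra hc
    refine P.hnz (lam - u) ?_ (h1 u hu).1
    simp [HP]; linarith
  have hDS : ∀ s ∈ HP, ‖lam - s‖ ≤ 2 * lam → DS a l s = 1 / (s - 1) + h (lam - s) - (U.map fun u => 1 / (u - (lam - s))).sum := by
    intro s hs hn
    have := h4 (lam - s) hn (by simpa using P.hnz s hs)
    rw [hd, sub_sub_cancel] at this
    rw [P.hD s hs, sub_eq_add_neg, ← neg_div, this]; ring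
  refine ⟨U, h, e, fun u hu => ⟨(h1 u hu).1, hUre u hu, (h1 u hu).2⟩, fun ρ hρ hn => h2 _ (by simpa using hρ) hn, h3, hDS, h5, h6, ?_⟩
  refine congrFun (pow_uniq (f := fun w => DS a l (lam - w)) (ε := lam - 1) (by linarith) (ds_pow P.ha P.hl P.hs (by linarith)).2 fun w hw => ?_)
  have hw2 : ‖w‖ < 2 * lam := by linarith
  have hws : (lam - w : ℂ) ∈ HP := by
    have := (abs_le.1 (Complex.abs_re_le_norm w)).2
    simp [HP]; linarith
  have b := hDS (lam - w) hws (by rw [sub_sub_cancel]; exact hw2.le)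
  rw [sub_sub_cancel] at b
  rw [b]
  have g1 := geo_hasSum (u := (lam : ℂ) - 1) (w := w) (by
    rw [show ((lam : ℂ) - 1) = ((lam - 1 : ℝ) : ℂ) by push_cast; rfl, Complex.norm_real, Real.norm_of_nonneg (by linarith)]; exact hw)
  have g2 := mgeo (w := w) U (fun u hu => by
    have := (abs_le.1 (Complex.abs_re_le_norm u)).2
    linarith [hUre u hu])
  have g3 := h7 w hw2
  rw [show (lam - w - 1 : ℂ) = lam - 1 - w by ring]
  refine hs_congr ((g1.add g3).sub g2) fun k => ?_
  ring

lemma ms_re_nonneg (U : Multiset ℂ) (f : ℂ → ℂ) (h : ∀ u ∈ U, 0 ≤ (f u).re) : 0 ≤ (U.map f).sum.re := by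
  induction U using Multiset.induction with
  | empty => simp
  | cons b U ih =>
    simp only [Multiset.map_cons, Multiset.sum_cons, Complex.add_re]
    exact add_nonneg (h b (by simp)) (ih fun u hu => h u (by simp [hu]))

lemma ms_re_ge (U : Multiset ℂ) (f : ℂ → ℂ) (h : ∀ u ∈ U, 0 ≤ (f u).re) {v : ℂ} (hv : v ∈ U) : (f v).re ≤ (U.map f).sum.re := by
  obtain ⟨V, rfl⟩ := Multiset.exists_cons_of_mem hv
  simp only [Multiset.map_cons, Multiset.sum_cons, Complex.add_re]
  linarith [ms_re_nonneg V f fun u hu => h u (by simp [hu])]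

lemma re_inv (z : ℂ) : (1 / z).re = z.re / (z.re ^ 2 + z.im ^ 2) := by
  rw [one_div, Complex.inv_re, Complex.normSq_apply]; congr 1; ring

lemma ds_re (P : Pk a l F T) {s : ℂ} (hs : s ∈ HP) :
    HasSum (fun i => a i * rexp (-(l i) * s.re) * Real.cos (l i * s.im)) (DS a l s).re := by
  have : Summable fun i => (a i : ℂ) * Complex.exp (-(l i) * s) := by
    refine Summable.of_norm ?_
    simp only [ds_norm P.ha]
    exact P.hs _ hs
  refine hs_congr (Complex.hasSum_re this.hasSum) fun i => ?_
  rw [Complex.re_ofReal_mul, Complex.exp_re]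
  simp [mul_assoc]

lemma f341 (P : Pk a l F T) {lam : ℝ} (hlam : 2 ≤ lam) {β γ A : ℝ} (h0 : F (β + γ * Complex.I) = 0) (hγ : γ ≠ 0)
    (hb0 : 0 ≤ β) (hb1 : β ≤ 1) (hA0 : 0 < A) (hA1 : A ≤ 1) (hl : 2 * |γ| ≤ lam) :
    4 / (A + (1 - β)) ≤ 3 / A + 5 * A / γ ^ 2 + 8 * (T * (1 + 25 * lam) ^ 2 / lam) := by
  obtain ⟨U, h, e, h1, h2, -, h4, h5, -, -⟩ := expn P hlam
  set H := T * (1 + 25 * lam) ^ 2 / lam with hH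
  let S : ℝ → ℂ := fun t => ((1 + A : ℝ) : ℂ) + t * Complex.I
  have Sre : ∀ t, (S t).re = 1 + A := fun t => by simp [S]
  have Sim : ∀ t, (S t).im = t := fun t => by simp [S]
  have SHP : ∀ t, S t ∈ HP := fun t => by change 1 < (S t).re; rw [Sre]; linarith
  have Sn : ∀ t, |t| ≤ lam → ‖lam - S t‖ ≤ 2 * lam := fun t ht => by
    refine (Complex.norm_le_abs_re_add_abs_im _).trans ?_
    simp only [Complex.sub_re, Complex.sub_im, Sre, Sim, Complex.ofReal_re, Complex.ofReal_im, zero_sub, abs_neg]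
    rw [abs_of_nonneg (by linarith)]; linarith
  have trig : 0 ≤ 3 * (DS a l (S 0)).re + 4 * (DS a l (S γ)).re + (DS a l (S (2 * γ))).re := by
    have q := (((ds_re P (SHP 0)).mul_left 3).add ((ds_re P (SHP γ)).mul_left 4)).add (ds_re P (SHP (2 * γ)))
    refine q.nonneg fun i => ?_
    simp only [Sre, Sim, mul_zero, Real.cos_zero]
    have e1 : l i * (2 * γ) = 2 * (l i * γ) := by ring
    rw [e1, Real.cos_two_mul]
    have : 0 ≤ a i * rexp (-(l i) * (1 + A)) := mul_nonneg (P.ha i) (Real.exp_pos _).le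
    have := mul_nonneg this (sq_nonneg (1 + Real.cos (l i * γ)))
    nlinarith
  have hup : ∀ t, |t| ≤ lam → (DS a l (S t)).re ≤ A / (A ^ 2 + t ^ 2) + H - ((U.map fun u => 1 / (u - (lam - S t))).sum).re := by
    intro t ht
    rw [h4 _ (SHP t) (Sn t ht)]
    have q := (Complex.re_le_norm _).trans (h5 _ (Sn t ht))
    simp only [Complex.sub_re, Complex.add_re]
    rw [re_inv]
    have r1 : (S t - 1).re = A := by simp [Sre]
    have r2 : (S t - 1).im = t := by simp [Sim]
    rw [r1, r2]; linarith
  have hpos : ∀ t, ∀ u ∈ U, 0 ≤ (1 / (u - (lam - S t))).re := by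
    intro t u hu
    rw [re_inv]
    have := (h1 u hu).2.1
    have : 0 ≤ (u - (lam - S t)).re := by simp only [Complex.sub_re, Sre, Complex.ofReal_re]; linarith
    positivity
  have hγl : |γ| ≤ lam := by linarith [abs_nonneg γ]
  have h2γl : |2 * γ| ≤ lam := by rw [abs_mul]; simpa using hl
  have k0 := hup 0 (by simp; linarith)
  have k1 := hup γ hγl
  have k2 := hup (2 * γ) h2γl
  have p0 := ms_re_nonneg U _ (hpos 0)
  have p2 := ms_re_nonneg U _ (hpos (2 * γ))
  have hmem : (lam - (β + γ * Complex.I) : ℂ) ∈ U := by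
    refine h2 _ h0 ((Complex.norm_le_abs_re_add_abs_im _).trans ?_)
    simp
    rw [abs_of_nonneg (by linarith)]; linarith
  have p1 := ms_re_ge U _ (hpos γ) hmem
  have ev : (1 / ((lam - (β + γ * Complex.I)) - (lam - S γ)) : ℂ).re = 1 / (A + (1 - β)) := by
    have : ((lam - (β + γ * Complex.I)) - (lam - S γ) : ℂ) = ((A + (1 - β) : ℝ) : ℂ) := by
      simp only [S]; push_cast; ring
    rw [this, ← Complex.ofReal_one, ← Complex.ofReal_div, Complex.ofReal_re]
  rw [ev] at p1
  have hg2 : 0 < γ ^ 2 := by positivity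
  have m0 : A / (A ^ 2 + 0 ^ 2) = 1 / A := by field_simp; ring
  have m1 : A / (A ^ 2 + γ ^ 2) ≤ A / γ ^ 2 := by gcongr; nlinarith
  have m2 : A / (A ^ 2 + (2 * γ) ^ 2) ≤ A / γ ^ 2 := by gcongr; nlinarith
  rw [m0] at k0
  have t1 : 4 / (A + (1 - β)) = 4 * (1 / (A + (1 - β))) := by ring
  have t2 : 3 / A = 3 * (1 / A) := by ring
  have t3 : 5 * A / γ ^ 2 = 5 * (A / γ ^ 2) := by ring
  rw [t1, t2, t3]
  linarith

end HZ
end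
end

section
open scoped Classical
set_option linter.unusedSectionVars false
open Real MeasureTheory Filter Topology

noncomputable section
namespace HZ

variable {ι : Type*} {a l : ι → ℝ} {F : ℂ → ℂ} {T : ℝ}

lemma pow_sub_one_le (z : ℂ) (n : ℕ) : ‖(1 + z) ^ n - 1‖ ≤ (1 + ‖z‖) ^ n - 1 := by
  induction n with
  | zero => simp
  | succ n ih =>
    have e : (1 + z) ^ (n + 1) - 1 = ((1 + z) ^ n - 1) * (1 + z) + z := by ring
    have h1 : ‖1 + z‖ ≤ 1 + ‖z‖ := (norm_add_le _ _).trans (by simp)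
    have h0 : 0 ≤ (1 + ‖z‖) ^ n - 1 := (norm_nonneg _).trans ih
    rw [e]
    calc _ ≤ ‖(1 + z) ^ n - 1‖ * ‖1 + z‖ + ‖z‖ := (norm_add_le _ _).trans (by rw [norm_mul])
      _ ≤ ((1 + ‖z‖) ^ n - 1) * (1 + ‖z‖) + ‖z‖ := by gcongr
      _ = _ := by ring

lemma exp_le_inv {x : ℝ} (hx : x < 1) : rexp x ≤ 1 / (1 - x) := by
  rw [le_div_iff₀ (by linarith)]
  have h := Real.add_one_le_exp (-x)
  have h2 : rexp x * rexp (-x) = 1 := by rw [← Real.exp_add]; simp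
  nlinarith [Real.exp_pos x]

lemma pw_re {u : ℂ} {n : ℕ} (hx : 0 < u.re) (h : |u.im| * n ≤ 0.1 * u.re) : 0.71 / u.re ^ n ≤ (1 / u ^ n).re := by
  set z : ℂ := ((u.im / u.re : ℝ) : ℂ) * Complex.I with hz
  have hu : u = (u.re : ℂ) * (1 + z) := by
    have : (u.re : ℂ) ≠ 0 := by exact_mod_cast hx.ne'
    rw [hz]; push_cast; field_simp
    exact (Complex.re_add_im u).symm
  have hzn : ‖z‖ * n ≤ 0.1 := by
    rw [hz, norm_mul, Complex.norm_real, Complex.norm_I, mul_one, Real.norm_eq_abs, abs_div, abs_of_pos hx, div_mul_eq_mul_div, div_le_iff₀ hx]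
    exact h
  set v := (1 + z) ^ n with hv
  have h1 : ‖v - 1‖ ≤ 1 / 9 := by
    have q := pow_sub_one_le z n
    have q2 : (1 + ‖z‖) ^ n ≤ rexp (n * ‖z‖) := by
      rw [Real.exp_nat_mul]
      have := Real.add_one_le_exp ‖z‖
      gcongr; linarith
    have q3 := exp_le_inv (x := n * ‖z‖) (by linarith)
    have q4 : 1 / (1 - n * ‖z‖) ≤ 10 / 9 := by
      rw [div_le_div_iff₀ (by linarith) (by norm_num)]; linarith
    linarith
  have h2 := (abs_le.1 ((Complex.abs_re_le_norm _).trans h1)).1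
  have h3 : ‖v‖ ≤ 10 / 9 := by
    have := norm_le_norm_add_norm_sub' v 1
    rw [norm_one] at this; linarith
  have h4 : v.re ^ 2 + v.im ^ 2 ≤ (10 / 9) ^ 2 := by
    have : v.re ^ 2 + v.im ^ 2 = ‖v‖ ^ 2 := by rw [← Complex.normSq_eq_norm_sq, Complex.normSq_apply]; ring
    rw [this]; gcongr
  simp only [Complex.sub_re, Complex.one_re] at h2
  have h5 : 0 < v.re ^ 2 + v.im ^ 2 := by nlinarith [sq_nonneg v.im]
  have h6 : 0.71 ≤ (1 / v).re := by
    rw [re_inv, le_div_iff₀ h5]; nlinarith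
  have e : 1 / u ^ n = (((u.re ^ n)⁻¹ : ℝ) : ℂ) * (1 / v) := by
    rw [hu, mul_pow, ← hu, ← hv]; push_cast; rw [one_div, one_div, mul_inv]
  rw [e, Complex.re_ofReal_mul, div_eq_inv_mul]
  gcongr

lemma z1 (P : Pk a l F T) {ρ : ℂ} (h : F ρ = 0) : ρ.re < 1 := by
  by_contra hc
  have h1 : ρ.re = 1 := by
    refine le_antisymm ?_ (not_lt.1 hc)
    by_contra h2
    exact P.hnz ρ (not_le.1 h2) h
  have hρ : ρ = (1:ℝ) + ρ.im * Complex.I := by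
    rw [← h1]; exact (Complex.re_add_im ρ).symm
  by_cases hg : ρ.im = 0
  · rw [hρ, hg] at h; exact P.h1 (by simpa using h)
  · rw [hρ] at h
    set γ := ρ.im
    set lam := 2 + 2 * |γ| with hlam
    have hγ := abs_nonneg γ
    set H := T * (1 + 25 * lam) ^ 2 / lam
    have hH : 0 ≤ H := by have := P.hT; positivity
    have hg2 : 0 < γ ^ 2 := by positivity
    set X := 1 + 5 / γ ^ 2 + 8 * H with hX
    have hX1 : 1 ≤ X := by have : 0 ≤ 5 / γ ^ 2 := by positivity
                           linarith
    have q := f341 P (lam := lam) (by linarith) (A := 1 / X) h hg zero_le_one le_rfl (by positivity) (by rw [div_le_one (by linarith)]; exact hX1) (by linarith)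
    rw [sub_self, add_zero, div_div_eq_mul_div, div_div_eq_mul_div, div_one, div_one] at q
    have q2 : 5 * (1 / X) / γ ^ 2 ≤ 5 / γ ^ 2 := by
      gcongr
      have : 1 / X ≤ 1 := by rw [div_le_one (by linarith)]; exact hX1
      linarith
    change 4 * X ≤ 3 * X + 5 * (1 / X) / γ ^ 2 + 8 * H at q
    linarith

lemma ms_re_ge2 (U : Multiset ℂ) (f : ℂ → ℂ) (h : ∀ u ∈ U, 0 ≤ (f u).re) {v w : ℂ} (hv : v ∈ U) (hw : w ∈ U) (hne : v ≠ w) :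
    (f v).re + (f w).re ≤ (U.map f).sum.re := by
  obtain ⟨V, rfl⟩ := Multiset.exists_cons_of_mem hv
  have hw' : w ∈ V := (Multiset.mem_cons.1 hw).resolve_left (Ne.symm hne)
  simp only [Multiset.map_cons, Multiset.sum_cons, Complex.add_re]
  linarith [ms_re_ge V f (fun u hu => h u (by simp [hu])) hw']

open ComplexConjugate in
/-- classical zero-free region for nonreal zeros of small height -/
lemma z2 (P : Pk a l F T) {ρ : ℂ} (h : F ρ = 0) (hi : ρ.im ≠ 0) (hi1 : |ρ.im| ≤ 1) : 1 / (400000 * T) ≤ 1 - ρ.re := by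
  by_contra hc
  push Not at hc
  have hT := P.hT
  have hk := z1 P h
  set κ := 1 - ρ.re with hκ
  set γ := ρ.im with hγd
  have hρ : ρ = ((1 - κ : ℝ) : ℂ) + γ * Complex.I := by
    rw [hκ, sub_sub_cancel]; exact (Complex.re_add_im ρ).symm
  have hk0 : 0 < κ := by linarith
  set H := T * (1 + 25 * 2) ^ 2 / 2 with hH
  have hHT : H = 1300.5 * T := by rw [hH]; ring
  have hkH : κ * H < 1 / 300 := by
    rw [lt_div_iff₀ (by positivity)] at hc
    rw [hHT]; nlinarith
  have hH1 : 1300 ≤ H := by rw [hHT]; linarith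
  by_cases hs : |γ| * H ≤ 0.15
  · obtain ⟨U, hh, e, h1, h2, -, h4, h5, -, -⟩ := expn P (lam := 2) le_rfl
    set A := 0.3 / H with hA
    have hA0 : 0 < A := by positivity
    have hAH : A * H = 0.3 := by rw [hA]; field_simp
    have hA1 : A ≤ 1 := by nlinarith
    set s : ℂ := ((1 + A : ℝ) : ℂ) with hsd
    have hsre : s.re = 1 + A := by simp [hsd]
    have hsim : s.im = 0 := by simp [hsd]
    have hsHP : s ∈ HP := by change 1 < s.re; rw [hsre]; linarith
    have hsn : ‖((2:ℝ):ℂ) - s‖ ≤ 2 * 2 := by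
      rw [hsd, ← Complex.ofReal_sub, Complex.norm_real, Real.norm_eq_abs, abs_le]; constructor <;> linarith
    have q0 : 0 ≤ (DS a l s).re := (ds_re P hsHP).nonneg fun i => by
      rw [hsim, mul_zero, Real.cos_zero, mul_one]; exact mul_nonneg (P.ha i) (Real.exp_pos _).le
    rw [h4 s hsHP hsn] at q0
    have q1 := (Complex.re_le_norm _).trans (h5 _ hsn)
    simp only [Complex.sub_re, Complex.add_re] at q0
    have q2 : (1 / (s - 1)).re = 1 / A := by
      rw [hsd, show (((1 + A : ℝ) : ℂ) - 1) = (A : ℂ) by push_cast; ring, ← Complex.ofReal_one, ← Complex.ofReal_div, Complex.ofReal_re]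
    have hpos : ∀ u ∈ U, 0 ≤ (1 / (u - (((2:ℝ):ℂ) - s))).re := by
      intro u hu
      rw [re_inv]
      have := (h1 u hu).2.1
      have : 0 ≤ (u - (((2:ℝ):ℂ) - s)).re := by simp only [Complex.sub_re, hsre, Complex.ofReal_re]; linarith
      positivity
    have hmem : ∀ ρ' : ℂ, F ρ' = 0 → ρ'.re = 1 - κ → |ρ'.im| ≤ 1 → (((2:ℝ):ℂ) - ρ') ∈ U := by
      intro ρ' h0 hr him
      refine h2 _ h0 ((Complex.norm_le_abs_re_add_abs_im _).trans ?_)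
      simp only [Complex.sub_re, Complex.sub_im, Complex.ofReal_re, Complex.ofReal_im, zero_sub, abs_neg, hr]
      rw [abs_of_nonneg (by linarith)]
      nlinarith
    have m1 := hmem ρ h (by rw [hκ]; ring) hi1
    have m2 := hmem (conj ρ) (by rw [P.hc, h, map_zero]) (by rw [Complex.conj_re, hκ]; ring) (by rw [Complex.conj_im, abs_neg]; exact hi1)
    have hne : ((2:ℝ):ℂ) - ρ ≠ ((2:ℝ):ℂ) - conj ρ := by
      intro he
      have := congrArg Complex.im he
      simp only [Complex.sub_im, Complex.conj_im, Complex.ofReal_im] at this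
      apply hi; linarith
    have q3 := ms_re_ge2 U _ hpos m1 m2 hne
    rw [re_inv, re_inv] at q3
    simp only [Complex.sub_re, Complex.sub_im, hsre, hsim, Complex.ofReal_re, Complex.ofReal_im, Complex.conj_re, Complex.conj_im] at q3
    have hr : ρ.re = 1 - κ := by rw [hκ]; ring
    rw [hr, ← hγd] at q3
    have e1 : 2 - (1 - κ) - (2 - (1 + A)) = A + κ := by ring
    have e2 : (0 - γ - (0 - 0)) ^ 2 = γ ^ 2 := by ring
    have e3 : (0 - -γ - (0 - 0)) ^ 2 = γ ^ 2 := by ring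
    rw [e1, e2, e3] at q3
    have hk10 : κ ≤ A / 10 := by
      by_contra hcc
      have := mul_lt_mul_of_pos_right (not_le.1 hcc) (show 0 < H by linarith)
      linarith
    have hgA : |γ| ≤ A / 2 := by
      by_contra hcc
      have := mul_lt_mul_of_pos_right (not_le.1 hcc) (show 0 < H by linarith)
      linarith
    have hgA2 : γ ^ 2 ≤ A ^ 2 / 4 := by
      rw [← sq_abs]; nlinarith [abs_nonneg γ]
    have q4 : 0.75 / A ≤ (A + κ) / ((A + κ) ^ 2 + γ ^ 2) := by
      rw [div_le_div_iff₀ hA0 (by positivity)]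
      nlinarith
    have q5 : H = 0.3 / A := by rw [← hAH]; field_simp
    have q6 : 1 / A + 0.3 / A - 2 * (0.75 / A) = -(0.2 / A) := by ring
    have q7 : 0 < 0.2 / A := by positivity
    rw [q2] at q0
    change _ ≤ H at q1
    rw [q5] at q1
    linarith
  · have hs' : 0.15 < |γ| * H := not_le.1 hs
    rw [hρ] at h
    have q := f341 P (lam := 2) le_rfl (A := 6 * κ) (β := 1 - κ) (by exact_mod_cast h) hi (by nlinarith) (by linarith) (by linarith) (by nlinarith) (by linarith)
    change _ ≤ _ + 8 * H at q
    have e1 : 4 / (6 * κ + (1 - (1 - κ))) = 4 / 7 / κ := by rw [div_div, div_eq_div_iff (by linarith) (by positivity)]; ring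
    have e2 : 3 / (6 * κ) = 1 / 2 / κ := by rw [div_div, div_eq_div_iff (by positivity) (by positivity)]; ring
    have hg0 : 0 < γ ^ 2 := by positivity
    rw [e1, e2] at q
    have q2 : 4 / 7 ≤ 1 / 2 + 30 * (κ ^ 2 / γ ^ 2) + 8 * (κ * H) := by
      have := mul_le_mul_of_nonneg_right q hk0.le
      rw [div_mul_cancel₀ _ hk0.ne'] at this
      calc _ ≤ _ := this
        _ = _ := by field_simp; ring
    have q3 : κ ^ 2 / γ ^ 2 ≤ 1 / 2025 := by
      rw [div_le_div_iff₀ hg0 (by norm_num), ← sq_abs γ]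
      have : 45 * κ ≤ |γ| := by
        by_contra hcc
        have := mul_lt_mul_of_pos_right (not_le.1 hcc) (show 0 < H by linarith)
        linarith
      have := pow_le_pow_left₀ (by positivity) this 2
      linarith
    linarith

end HZ
end
end

section
open scoped Classical
set_option linter.unusedSectionVars false
open Real MeasureTheory Filter Topology

noncomputable section
namespace HZ

variable {ι : Type*} {a l : ι → ℝ} {F : ℂ → ℂ} {T : ℝ}

lemma ms_re_ge3 (U : Multiset ℂ) (f : ℂ → ℂ) (E : ℝ) (h : ∀ u ∈ U, -E ≤ (f u).re) {v w : ℂ} (hv : v ∈ U) (hw : w ∈ U) (hne : v ≠ w) :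
    (f v).re + (f w).re + 2 * E - Multiset.card U * E ≤ (U.map f).sum.re := by
  have := ms_re_ge2 U (fun u => f u + (E : ℂ)) (fun u hu => by simp only [Complex.add_re, Complex.ofReal_re]; linarith [h u hu]) hv hw hne
  rw [Multiset.sum_map_add, Multiset.map_const', Multiset.sum_replicate] at this
  simp only [Complex.add_re, Complex.ofReal_re, nsmul_eq_mul, Complex.re_mul_ofReal, Complex.natCast_re] at this
  linarith

lemma log18 : Real.log 18 ≤ 3 := by
  rw [Real.log_le_iff_le_exp (by norm_num), show (3:ℝ) = (3:ℕ) * 1 by norm_num, Real.exp_nat_mul]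
  have := Real.exp_one_gt_d9
  calc (18:ℝ) ≤ 2.7 ^ 3 := by norm_num
    _ ≤ _ := by gcongr; linarith

def A1 (b : ℝ) : ℝ := 12 * (1 + Real.log (2000000 * b))

lemma A1_ge {b : ℝ} (hb : 1 ≤ b) : 12 ≤ A1 b := by
  have := Real.log_nonneg (show 1 ≤ 2000000 * b by linarith)
  unfold A1; linarith

lemma z3a (P : Pk a l F T) {b lD L C : ℝ} (hb : 1 ≤ b) (hT : T = b * lD) (hD : 1 ≤ lD) (hDL : lD ≤ rexp L) (hL : 1 ≤ L) (hC : 0 < C)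
    (hz1 : ∀ ρ, F ρ = 0 → 0 < ρ.re → (1 + 4 * lD)⁻¹ ≤ |ρ.im| → ρ.re < 1 - (L ^ C * Real.log (|ρ.im| + 2))⁻¹)
    {y1 : ℝ} (hy : y1 = A1 b * L ^ (C + 1)) (hA : 10 * y1 ≤ 1 + 4 * lD)
    {ρ : ℂ} (h : F ρ = 0) (hi : ρ.im ≠ 0) (hg : |ρ.im| < (1 + 4 * lD)⁻¹) : 1 / (4 * y1) ≤ 1 - ρ.re := by
  by_contra hc
  push Not at hc
  have hk := z1 P h
  set κ := 1 - ρ.re with hκ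
  have hLC : 1 ≤ L ^ C := Real.one_le_rpow hL hC.le
  have hy12 : 12 ≤ y1 := by
    have h1 : 1 ≤ L ^ (C + 1) := Real.one_le_rpow hL (by linarith)
    rw [hy]; nlinarith [A1_ge hb]
  obtain ⟨m, hm⟩ : ∃ m, ⌊y1⌋₊ = m + 1 := Nat.exists_eq_succ_of_ne_zero (Nat.floor_pos.2 (by linarith)).ne'
  set n := m + 1 with hn
  have hn1 : (n:ℝ) ≤ y1 := by rw [← hm]; exact Nat.floor_le (by linarith)
  have hn2 : y1 / 2 ≤ n := by rw [← hm]; linarith [Nat.lt_floor_add_one y1]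
  set ε := 1 / (3 * L ^ C) with hε
  have hε0 : 0 < ε := by positivity
  have hε1 : ε ≤ 1 / 3 := by rw [hε]; apply one_div_le_one_div_of_le <;> linarith
  set E := 1 / (1 + ε) ^ n with hE
  have hE0 : 0 < E := by positivity
  have hTE : T * E ≤ 1 / 2000000 := by
    have k1 : rexp (ε / 2) ≤ 1 + ε := by
      refine (exp_le_inv (by linarith)).trans ?_
      rw [div_le_iff₀ (by linarith)]; nlinarith
    have k2 : rexp (n * (ε / 2)) ≤ (1 + ε) ^ n := by
      rw [Real.exp_nat_mul]; gcongr
    have k3 : L + Real.log (2000000 * b) ≤ n * (ε / 2) := by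
      have : A1 b * L / 12 = y1 / 2 * (ε / 2) := by
        rw [hy, hε, Real.rpow_add (by linarith), Real.rpow_one]; field_simp; ring
      have h2 : y1 / 2 * (ε / 2) ≤ n * (ε / 2) := by gcongr
      rw [← this] at h2
      refine le_trans ?_ h2
      have := Real.log_nonneg (show 1 ≤ 2000000 * b by linarith)
      unfold A1; nlinarith
    have k4 : rexp L * (2000000 * b) ≤ (1 + ε) ^ n := by
      refine le_trans ?_ k2
      refine le_trans ?_ (Real.exp_le_exp.2 k3)
      rw [Real.exp_add, Real.exp_log (by linarith)]
    rw [hE, mul_one_div, div_le_div_iff₀ (by positivity) (by norm_num), hT, one_mul]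
    refine le_trans ?_ k4
    have := mul_le_mul_of_nonneg_right hDL (show 0 ≤ 2000000 * b by linarith)
    linarith
  obtain ⟨U, hh, e, h1, h2, h3, -, -, h6, h7⟩ := expn P (lam := 2) le_rfl
  have hg0 : (1 + 4 * lD)⁻¹ ≤ 1 / 5 := by rw [inv_eq_one_div]; apply one_div_le_one_div_of_le <;> linarith
  have hgn : (1 + 4 * lD)⁻¹ * n ≤ 0.1 := by
    rw [inv_mul_le_iff₀ (by linarith)]; linarith
  have hpos : ∀ u ∈ U, -E ≤ (1 / u ^ n).re := by
    intro u hu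
    obtain ⟨u1, u2, u3⟩ := h1 u hu
    by_cases hc : (1 + 4 * lD)⁻¹ ≤ |u.im|
    · have hre : 1 + ε ≤ u.re := by
        by_cases hr : 2 ≤ u.re
        · linarith
        · have q := hz1 _ u1 (by simp; linarith) (by simpa using hc)
          simp only [Complex.sub_re, Complex.sub_im, Complex.ofReal_re, Complex.ofReal_im, zero_sub, abs_neg] at q
          have l1 : Real.log (|u.im| + 2) ≤ 3 := by
            refine le_trans (Real.log_le_log (by positivity) ?_) log18
            linarith [Complex.abs_im_le_norm u]
          have l0 : 0 < Real.log (|u.im| + 2) := Real.log_pos (by linarith [abs_nonneg u.im])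
          have l2 : ε ≤ (L ^ C * Real.log (|u.im| + 2))⁻¹ := by
            rw [hε, inv_eq_one_div]
            apply one_div_le_one_div_of_le (by positivity)
            rw [mul_comm]; gcongr
          linarith
      have : ‖1 / u ^ n‖ ≤ E := by
        rw [norm_div, norm_one, norm_pow, hE]
        gcongr
        exact hre.trans (Complex.re_le_norm u)
      linarith [(abs_le.1 ((Complex.abs_re_le_norm _).trans this)).1]
    · have q := pw_re (u := u) (n := n) (by linarith) (by
        have : |u.im| * n ≤ (1 + 4 * lD)⁻¹ * n := by gcongr; exact (not_le.1 hc).le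
        linarith)
      have : 0 ≤ 0.71 / u.re ^ n := by have : 0 ≤ u.re := by linarith
                                       positivity
      linarith
  have hkn : κ * n ≤ 1 / 4 := by
    rw [lt_div_iff₀ (by linarith)] at hc
    have : κ * n ≤ κ * y1 := by gcongr
    linarith
  have hk1 : κ ≤ 1 := by
    refine hc.le.trans ?_
    rw [div_le_one (by linarith)]; linarith
  have hU : ∀ ρ' : ℂ, F ρ' = 0 → ρ'.re = ρ.re → |ρ'.im| = |ρ.im| → (((2:ℝ):ℂ) - ρ') ∈ U ∧ 0.5325 ≤ (1 / (((2:ℝ):ℂ) - ρ') ^ n).re := by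
    intro ρ' f1 f2 f3
    constructor
    · refine h2 _ f1 ((Complex.norm_le_abs_re_add_abs_im _).trans ?_)
      simp only [Complex.sub_re, Complex.sub_im, Complex.ofReal_re, Complex.ofReal_im, zero_sub, abs_neg, f2, f3]
      rw [abs_of_nonneg (by linarith)]
      linarith
    · have er : (((2:ℝ):ℂ) - ρ').re = 1 + κ := by simp [f2, hκ]; ring
      have ei : |(((2:ℝ):ℂ) - ρ').im| = |ρ.im| := by simp [f3]
      have q := pw_re (u := ((2:ℝ):ℂ) - ρ') (n := n) (by rw [er]; linarith) (by
        rw [er, ei]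
        have : |ρ.im| * n ≤ (1 + 4 * lD)⁻¹ * n := by gcongr
        linarith)
      refine le_trans ?_ q
      rw [er]
      have p1 : (1 + κ) ^ n ≤ 4 / 3 := by
        calc (1 + κ) ^ n ≤ rexp κ ^ n := by
              have := Real.add_one_le_exp κ
              gcongr; linarith
          _ = rexp (κ * n) := by rw [mul_comm, Real.exp_nat_mul]
          _ ≤ rexp (1 / 4) := Real.exp_le_exp.2 hkn
          _ ≤ 4 / 3 := (exp_le_inv (by norm_num)).trans (by norm_num)
      rw [le_div_iff₀ (by have : 0 < 1 + κ := by linarith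
                          positivity)]
      linarith
  obtain ⟨m1, r1⟩ := hU ρ h rfl rfl
  obtain ⟨m2, r2⟩ := hU (starRingEnd ℂ ρ) (by rw [P.hc, h, map_zero]) (by simp) (by simp)
  have hne : ((2:ℝ):ℂ) - ρ ≠ ((2:ℝ):ℂ) - starRingEnd ℂ ρ := by
    intro he
    have := congrArg Complex.im he
    simp only [Complex.sub_im, Complex.conj_im, Complex.ofReal_im] at this
    apply hi; linarith
  have S := ms_re_ge3 U _ E hpos m1 m2 hne
  have h7m := congrArg Complex.re (h7 m)
  have ss : 0 ≤ SS a l 2 m := by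
    unfold SS
    refine tsum_nonneg fun i => ?_
    have := P.ha i; have := P.hl i; positivity
  have e1 : (((2:ℝ):ℂ) - 1) = 1 := by push_cast; norm_num
  simp only [Complex.ofReal_re, Complex.add_re, Complex.sub_re, e1, one_pow, div_one, Complex.one_re] at h7m
  have he : (e m).re ≤ 5202 * (T * E) := by
    refine (Complex.re_le_norm _).trans ((h6 m).trans ?_)
    have hT1 := P.hT
    have : 1 / ((2:ℝ) * 2) ^ m ≤ 4 * E := by
      rw [hE, mul_one_div, div_le_div_iff₀ (by positivity) (by positivity), hn, ]
      have : (1 + ε) ^ (m + 1) ≤ (2 * 2) ^ (m + 1) := by gcongr; linarith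
      rw [one_mul]; refine this.trans (le_of_eq ?_); ring
    have q := mul_le_mul_of_nonneg_left this (show 0 ≤ T * 1300.5 by positivity)
    calc _ = T * 1300.5 * (1 / (2 * 2) ^ m) := by ring
      _ ≤ _ := q
      _ = _ := by ring
  have hcard : Multiset.card U * E ≤ 3902 * (T * E) := by
    have l2 := Real.log_two_gt_d9
    have hc0 : (0:ℝ) ≤ Multiset.card U := by positivity
    have : (Multiset.card U : ℝ) ≤ 3902 * T := by
      have k := mul_le_mul_of_nonneg_left l2.le hc0
      have hT1 := P.hT
      linarith
    rw [← mul_assoc]; gcongr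
  linarith

lemma z3 (P : Pk a l F T) {b lD L C : ℝ} (hb : 1 ≤ b) (hT : T = b * lD) (hD : 1 ≤ lD) (hDL : lD ≤ rexp L) (hL : 1 ≤ L) (hC : 0 < C)
    (hz1 : ∀ ρ, F ρ = 0 → 0 < ρ.re → (1 + 4 * lD)⁻¹ ≤ |ρ.im| → ρ.re < 1 - (L ^ C * Real.log (|ρ.im| + 2))⁻¹)
    (hz2 : ∀ β : ℝ, F β = 0 → 0 < β → β ≤ 1 - L ^ (-C))
    {ρ : ℂ} (h : F ρ = 0) : 1 / (1000000 * b * A1 b * L ^ (C + 1) * Real.log (|ρ.im| + 3)) ≤ 1 - ρ.re := by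
  have hA := A1_ge hb
  have hLC : 1 ≤ L ^ C := Real.one_le_rpow hL hC.le
  have hLC1 : L ^ (C + 1) = L ^ C * L := by rw [Real.rpow_add (by linarith), Real.rpow_one]
  have hLL : L ^ C ≤ L ^ (C + 1) := by rw [hLC1]; nlinarith
  have hγ := abs_nonneg ρ.im
  have hlog : 1 ≤ Real.log (|ρ.im| + 3) := by
    rw [Real.le_log_iff_exp_le (by linarith)]
    linarith [Real.exp_one_lt_d9]
  have hbA : 12000000 ≤ 1000000 * b * A1 b := by nlinarith
  have hX : L ^ C ≤ 1000000 * b * A1 b * L ^ (C + 1) := by nlinarith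
  have hX2 : L ^ C ≤ 1000000 * b * A1 b * L ^ (C + 1) * Real.log (|ρ.im| + 3) := by nlinarith
  by_cases hr : ρ.re ≤ 0
  · have : 1 / (1000000 * b * A1 b * L ^ (C + 1) * Real.log (|ρ.im| + 3)) ≤ 1 := by
      rw [div_le_one (by linarith)]; linarith
    linarith
  push Not at hr
  by_cases hg : (1 + 4 * lD)⁻¹ ≤ |ρ.im|
  · have q := hz1 ρ h hr hg
    have l0 : 0 < Real.log (|ρ.im| + 2) := Real.log_pos (by linarith)
    have : 1 / (1000000 * b * A1 b * L ^ (C + 1) * Real.log (|ρ.im| + 3)) ≤ (L ^ C * Real.log (|ρ.im| + 2))⁻¹ := by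
      rw [inv_eq_one_div]
      apply one_div_le_one_div_of_le (by positivity)
      refine mul_le_mul hX (Real.log_le_log (by linarith) (by linarith)) l0.le (by linarith)
    linarith
  push Not at hg
  by_cases hi : ρ.im = 0
  · have e : ρ = (ρ.re : ℂ) := by apply Complex.ext <;> simp [hi]
    have q := hz2 ρ.re (by rw [← e]; exact h) hr
    rw [Real.rpow_neg (by linarith)] at q
    have : 1 / (1000000 * b * A1 b * L ^ (C + 1) * Real.log (|ρ.im| + 3)) ≤ (L ^ C)⁻¹ := by
      rw [inv_eq_one_div]
      exact one_div_le_one_div_of_le (by positivity) hX2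
    linarith
  have hy0 : 0 < A1 b * L ^ (C + 1) := by positivity
  have key : 1 / (1000000 * b * (A1 b * L ^ (C + 1))) ≤ 1 - ρ.re := by
    by_cases hA : 10 * (A1 b * L ^ (C + 1)) ≤ 1 + 4 * lD
    · refine le_trans ?_ (z3a P hb hT hD hDL hL hC hz1 rfl hA h hi hg)
      apply one_div_le_one_div_of_le (by positivity)
      nlinarith
    · refine le_trans ?_ (z2 P h hi ?_)
      · apply one_div_le_one_div_of_le (by rw [hT]; positivity)
        rw [hT]; push Not at hA; nlinarith
      · refine hg.le.trans ?_
        rw [inv_le_one₀ (by linarith)]; linarith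
  refine le_trans ?_ key
  apply one_div_le_one_div_of_le (by positivity)
  have : 0 < 1000000 * b * (A1 b * L ^ (C + 1)) := by positivity
  nlinarith

end HZ
end
end

section
open scoped Classical
set_option linter.unusedSectionVars false
open Real MeasureTheory Filter Topology

noncomputable section
namespace HZ

variable {ι : Type*} {a l : ι → ℝ} {F : ℂ → ℂ} {T : ℝ}

lemma ms_norm (U : Multiset ℂ) (f : ℂ → ℂ) (E : ℝ) (h : ∀ u ∈ U, ‖f u‖ ≤ E) : ‖(U.map f).sum‖ ≤ Multiset.card U * E := by
  induction U using Multiset.induction with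
  | empty => simp
  | cons b U ih =>
    simp only [Multiset.map_cons, Multiset.sum_cons, Multiset.card_cons]
    push_cast
    have := ih fun u hu => h u (by simp [hu])
    have := h b (by simp)
    linarith [norm_add_le (f b) (U.map f).sum]

lemma s_low (P : Pk a l F T) {lam κ : ℝ} (hlam : 2 ≤ lam) (hk0 : 0 ≤ κ) (hk1 : κ ≤ 1)
    (hz : ∀ ρ : ℂ, F ρ = 0 → ‖lam - ρ‖ ≤ 8 * lam → κ ≤ 1 - ρ.re) (N : ℕ) :
    (lam / (lam - 1)) ^ (N + 1) - 1 - (N + 1) * (T * (1 + 25 * lam) ^ 2 / Real.log 2 * (lam / (lam - 1 + κ)) ^ N)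
      - 2 * (T * (1 + 25 * lam) ^ 2 / lam) ≤ ∑ k ∈ Finset.range (N + 1), lam ^ k * SS a l lam k := by
  obtain ⟨U, hh, e, h1, h2, h3, -, -, h6, h7⟩ := expn P hlam
  set M := T * (1 + 25 * lam) ^ 2 with hM
  have hT := P.hT
  set r := lam / (lam - 1 + κ) with hr
  have hr1 : 1 ≤ r := by rw [hr, one_le_div (by linarith)]; linarith
  have hl2 : 0 < Real.log 2 := Real.log_pos (by norm_num)
  have g1 : ∀ n : ℕ, ∑ k ∈ Finset.range n, lam ^ k / (lam - 1) ^ (k + 1) = (lam / (lam - 1)) ^ n - 1 := by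
    intro n
    induction n with
    | zero => simp
    | succ n ih =>
      have : lam - 1 ≠ 0 := by linarith
      rw [Finset.sum_range_succ, ih, div_pow, div_pow]; field_simp; ring
  have t : ∀ k ∈ Finset.range (N + 1), lam ^ k / (lam - 1) ^ (k + 1) - M / Real.log 2 * r ^ N - M / lam * (1 / 2) ^ k ≤ lam ^ k * SS a l lam k := by
    intro k hk
    have hkN : k ≤ N := by simpa [Nat.lt_succ_iff] using hk
    have q : lam ^ k * SS a l lam k = (((lam ^ k : ℝ) : ℂ) * (1 / ((lam : ℂ) - 1) ^ (k + 1) - (U.map fun u => 1 / u ^ (k + 1)).sum + e k)).re := by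
      rw [← h7 k, ← Complex.ofReal_mul, Complex.ofReal_re]
    have e1 : ((lam ^ k : ℝ) : ℂ) * (1 / ((lam : ℂ) - 1) ^ (k + 1) - (U.map fun u => 1 / u ^ (k + 1)).sum + e k) =
        ((lam ^ k / (lam - 1) ^ (k + 1) : ℝ) : ℂ) - (U.map fun u => ((lam ^ k : ℝ) : ℂ) * (1 / u ^ (k + 1))).sum + ((lam ^ k : ℝ) : ℂ) * e k := by
      rw [Multiset.sum_map_mul_left]; push_cast; ring
    rw [e1, Complex.add_re, Complex.sub_re, Complex.ofReal_re] at q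
    rw [q]
    have b1 := (Complex.re_le_norm _).trans (ms_norm U (fun u => ((lam ^ k : ℝ) : ℂ) * (1 / u ^ (k + 1))) (r ^ N) fun u hu => by
      obtain ⟨u1, u2, u3⟩ := h1 u hu
      have w := hz _ u1 (by simpa using u3)
      simp only [Complex.sub_re, Complex.ofReal_re] at w
      have w2 : lam - 1 + κ ≤ ‖u‖ := le_trans (by linarith) (Complex.re_le_norm u)
      rw [norm_mul, norm_div, norm_one, norm_pow, Complex.norm_real, Real.norm_of_nonneg (by positivity)]
      calc lam ^ k * (1 / ‖u‖ ^ (k + 1)) ≤ lam ^ k * (1 / (lam - 1 + κ) ^ (k + 1)) := by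
            have : 0 < lam - 1 + κ := by linarith
            gcongr
        _ = r ^ k * (1 / (lam - 1 + κ)) := by
            have : lam - 1 + κ ≠ 0 := by linarith
            rw [hr, div_pow, pow_succ]; field_simp
        _ ≤ r ^ k * 1 := by
            gcongr
            rw [div_le_one (by linarith)]; linarith
        _ ≤ r ^ N := by rw [mul_one]; exact pow_le_pow_right₀ hr1 hkN)
    have b2 : Multiset.card U * r ^ N ≤ M / Real.log 2 * r ^ N := by
      gcongr
      rw [le_div_iff₀ hl2]; exact h3
    have b3 : ‖((lam ^ k : ℝ) : ℂ) * e k‖ ≤ M / lam * (1 / 2) ^ k := by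
      rw [norm_mul, Complex.norm_real, Real.norm_of_nonneg (by positivity)]
      calc _ ≤ lam ^ k * (M / lam / (2 * lam) ^ k) := by gcongr; exact h6 k
        _ = _ := by rw [mul_pow, div_pow, one_pow]; field_simp
    have b4 := (abs_le.1 ((Complex.abs_re_le_norm _).trans b3)).1
    linarith
  refine le_trans ?_ (Finset.sum_le_sum t)
  rw [Finset.sum_sub_distrib, Finset.sum_sub_distrib, g1, Finset.sum_const, Finset.card_range, nsmul_eq_mul, ← Finset.mul_sum]
  have : M / lam * ∑ k ∈ Finset.range (N + 1), (1 / 2 : ℝ) ^ k ≤ M / lam * 2 := by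
    gcongr
    exact sum_geometric_two_le _
  push_cast
  linarith

lemma D15 (P : Pk a l F T) : ∑' i, a i * rexp (-(l i) * 1.5) ≤ 2 + 1301 * T := by
  obtain ⟨U, hh, e, h1, h2, h3, h4, h5, -, -⟩ := expn P (lam := 2) le_rfl
  set s : ℂ := ((1.5 : ℝ) : ℂ) with hs
  have hsre : s.re = 1.5 := by rw [hs, Complex.ofReal_re]
  have hsim : s.im = 0 := by rw [hs, Complex.ofReal_im]
  have hsHP : s ∈ HP := by change 1 < s.re; rw [hsre]; norm_num
  have hsn : ‖((2:ℝ):ℂ) - s‖ ≤ 2 * 2 := by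
    rw [hs, ← Complex.ofReal_sub, Complex.norm_real, Real.norm_eq_abs, abs_le]; constructor <;> norm_num
  have q0 := (ds_re P hsHP).tsum_eq
  rw [hsim, hsre] at q0
  simp only [mul_zero, Real.cos_zero, mul_one] at q0
  rw [q0, h4 s hsHP hsn]
  have hpos := ms_re_nonneg U (fun u => 1 / (u - (((2:ℝ):ℂ) - s))) fun u hu => by
    rw [re_inv]
    have := (h1 u hu).2.1
    have : 0 ≤ (u - (((2:ℝ):ℂ) - s)).re := by simp only [Complex.sub_re, hsre, Complex.ofReal_re]; linarith
    positivity
  have q1 := (Complex.re_le_norm _).trans (h5 _ hsn)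
  have q2 : (1 / (s - 1)).re = 2 := by
    rw [re_inv]; simp only [Complex.sub_re, Complex.sub_im, Complex.one_re, Complex.one_im, hsre, hsim]; norm_num
  simp only [Complex.sub_re, Complex.add_re, q2]
  have hT := P.hT
  linarith

def psi (a l : ι → ℝ) (Y : ℝ) : ℝ := ∑' i, if l i ≤ Y then a i else 0

lemma psi_term (P : Pk a l F T) (Y : ℝ) (i : ι) : (if l i ≤ Y then a i else 0) ≤ rexp (1.5 * Y) * (a i * rexp (-(l i) * 1.5)) := by
  have := P.ha i
  split_ifs with h
  · rw [mul_left_comm, ← Real.exp_add]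
    refine le_mul_of_one_le_right this (Real.one_le_exp ?_); linarith
  · positivity

lemma psi_summable (P : Pk a l F T) (Y : ℝ) : Summable fun i => if l i ≤ Y then a i else 0 := by
  refine Summable.of_nonneg_of_le (fun i => ?_) (psi_term P Y) ((P.hs 1.5 (by norm_num)).mul_left _)
  have := P.ha i
  split_ifs <;> positivity

lemma psi_le (P : Pk a l F T) (Y : ℝ) : psi a l Y ≤ rexp (1.5 * Y) * (2 + 1301 * T) := by
  calc psi a l Y ≤ ∑' i, rexp (1.5 * Y) * (a i * rexp (-(l i) * 1.5)) :=
        (psi_summable P Y).tsum_le_tsum (psi_term P Y) ((P.hs 1.5 (by norm_num)).mul_left _)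
    _ = rexp (1.5 * Y) * ∑' i, a i * rexp (-(l i) * 1.5) := tsum_mul_left
    _ ≤ _ := by gcongr; exact D15 P

lemma s_up (P : Pk a l F T) {lam z Y : ℝ} (hlam : 2 ≤ lam) (hz0 : 0 < z) (hz1 : z ≤ 1) (hz2 : 2 ≤ (1 - z) * lam) (N : ℕ) :
    ∑ k ∈ Finset.range (N + 1), lam ^ k * SS a l lam k ≤
      psi a l Y + rexp (1.5 * Y) * (z⁻¹ ^ N * rexp (-((1 - z) * lam * Y))) * (2 + 1301 * T) := by
  have hs := (ds_pow P.ha P.hl P.hs (lam := lam) (by linarith)).1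
  have h1 := hasSum_sum (s := Finset.range (N + 1)) fun k _ => (hs k).hasSum.mul_left (lam ^ k)
  set W := rexp (1.5 * Y) * (z⁻¹ ^ N * rexp (-((1 - z) * lam * Y))) with hW
  have h2 := (psi_summable P Y).hasSum.add ((P.hs 1.5 (by norm_num)).hasSum.mul_left W)
  have h3 := hasSum_le (fun i => ?_) h1 h2
  · refine h3.trans ?_
    have := D15 P
    unfold psi
    gcongr
  · have hli := P.hl i
    have hai := P.ha i
    have e : ∑ k ∈ Finset.range (N + 1), lam ^ k * (a i * rexp (-(l i) * lam) * (l i ^ k / k.factorial)) =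
        a i * (rexp (-(l i) * lam) * ∑ k ∈ Finset.range (N + 1), (lam * l i) ^ k / k.factorial) := by
      rw [Finset.mul_sum, Finset.mul_sum]
      refine Finset.sum_congr rfl fun k _ => ?_
      rw [mul_pow]; ring
    rw [e]
    have hle : ∀ t : ℝ, 0 ≤ t → ∑ k ∈ Finset.range (N + 1), t ^ k / k.factorial ≤ rexp t := fun t ht => Real.sum_le_exp_of_nonneg ht _
    by_cases hY : l i ≤ Y
    · rw [if_pos hY]
      have h0 : rexp (-(l i) * lam) * ∑ k ∈ Finset.range (N + 1), (lam * l i) ^ k / k.factorial ≤ 1 := by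
        calc _ ≤ rexp (-(l i) * lam) * rexp (lam * l i) := by gcongr; exact hle _ (by positivity)
          _ = 1 := by rw [← Real.exp_add]; ring_nf; simp
      have h5 : 0 ≤ W * (a i * rexp (-(l i) * 1.5)) := by positivity
      have := mul_le_mul_of_nonneg_left h0 hai
      linarith
    · rw [if_neg hY, zero_add]
      push Not at hY
      have h0 : ∑ k ∈ Finset.range (N + 1), (lam * l i) ^ k / k.factorial ≤ z⁻¹ ^ N * rexp (z * (lam * l i)) := by
        refine le_trans ?_ (mul_le_mul_of_nonneg_left (hle (z * (lam * l i)) (by positivity)) (by positivity))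
        rw [Finset.mul_sum]
        refine Finset.sum_le_sum fun k hk => ?_
        have hkN : k ≤ N := by simpa [Nat.lt_succ_iff] using hk
        have : 1 ≤ z⁻¹ ^ N * z ^ k := by
          rw [inv_pow, ← div_eq_inv_mul, one_le_div (by positivity)]
          exact pow_le_pow_of_le_one hz0.le hz1 hkN
        have h9 : 0 ≤ (lam * l i) ^ k / k.factorial := by positivity
        calc _ ≤ (z⁻¹ ^ N * z ^ k) * ((lam * l i) ^ k / k.factorial) := le_mul_of_one_le_left h9 this
          _ = _ := by rw [mul_pow z]; ring
      calc _ ≤ a i * (rexp (-(l i) * lam) * (z⁻¹ ^ N * rexp (z * (lam * l i)))) := by gcongr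
        _ = a i * z⁻¹ ^ N * rexp (-(l i) * lam + z * (lam * l i)) := by rw [Real.exp_add]; ring
        _ ≤ a i * z⁻¹ ^ N * rexp (1.5 * Y + -((1 - z) * lam * Y) + -(l i) * 1.5) := by
          refine mul_le_mul_of_nonneg_left (Real.exp_le_exp.2 ?_) (by positivity)
          have := mul_le_mul_of_nonneg_left hY.le (show 0 ≤ (1 - z) * lam - 1.5 by linarith)
          linarith
        _ = _ := by rw [hW, Real.exp_add, Real.exp_add]; ring

end HZ
end
end

section
open scoped Classical
set_option linter.unusedSectionVars false
open Real MeasureTheory Filter Topology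

noncomputable section
namespace HZ

variable {ι : Type*} {a l : ι → ℝ} {F : ℂ → ℂ} {T : ℝ}

lemma rN {lam y κ : ℝ} {N : ℕ} (hlam : 2 ≤ lam) (hy : y ≤ lam - 1) (hy0 : 0 ≤ y) (hk0 : 0 ≤ κ) (hk1 : κ ≤ 1) (hN : (N : ℝ) ≤ lam * y) :
    (lam / (lam - 1 + κ)) ^ N ≤ rexp (y - κ * y + 1) := by
  have h1 : lam / (lam - 1 + κ) ≤ rexp ((1 - κ) / (lam - 1)) := by
    calc lam / (lam - 1 + κ) = (1 - κ) / (lam - 1 + κ) + 1 := by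
          have : lam - 1 + κ ≠ 0 := by linarith
          field_simp; ring
      _ ≤ (1 - κ) / (lam - 1) + 1 := by
          have : 0 ≤ 1 - κ := by linarith
          have : 0 < lam - 1 := by linarith
          gcongr; linarith
      _ ≤ _ := Real.add_one_le_exp _
  have h2 : 0 ≤ (1 - κ) / (lam - 1) := div_nonneg (by linarith) (by linarith)
  calc _ ≤ rexp ((1 - κ) / (lam - 1)) ^ N := by
        have : 0 < lam - 1 + κ := by linarith
        gcongr
    _ = rexp (N * ((1 - κ) / (lam - 1))) := by rw [Real.exp_nat_mul]
    _ ≤ rexp ((lam * y) * ((1 - κ) / (lam - 1))) := by gcongr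
    _ ≤ _ := by
        refine Real.exp_le_exp.2 ?_
        rw [← mul_div_assoc, div_le_iff₀ (by linarith)]
        have : y * (1 - κ) ≤ y := by nlinarith
        nlinarith

lemma zN {η lam y δ : ℝ} {N : ℕ} (h0 : 0 < η) (h1 : η ≤ 1 / 2) (hN : (N : ℝ) ≤ lam * (y - δ)) :
    (1 - η)⁻¹ ^ N ≤ rexp (lam * (y - δ) * (η + 2 * η ^ 2)) := by
  have k : (1 - η)⁻¹ ≤ rexp (η + 2 * η ^ 2) := by
    refine le_trans ?_ (Real.add_one_le_exp _)
    rw [inv_le_comm₀ (by linarith) (by positivity), ← one_div, div_le_iff₀ (by positivity)]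
    nlinarith [pow_pos h0 3]
  have : 0 < 1 - η := by linarith
  calc _ ≤ rexp (η + 2 * η ^ 2) ^ N := by gcongr
    _ = rexp (N * (η + 2 * η ^ 2)) := by rw [Real.exp_nat_mul]
    _ ≤ _ := by gcongr

set_option maxHeartbeats 1000000 in
lemma psi_low (P : Pk a l F T) {b A w : ℝ} (hb : 1 ≤ b) (hTb : T ≤ b * rexp w) (hA : 0 < A) (hw : 1000 ≤ w)
    (hE : b * 1000000 * w ^ 200 ≤ rexp w) (hA1 : A * Real.log (8 * w ^ 40 + 3) ≤ w)
    (hz : ∀ ρ, F ρ = 0 → 1 / (A * w ^ 5 * Real.log (|ρ.im| + 3)) ≤ 1 - ρ.re) :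
    rexp (w ^ 8) * (1 - 0.1 / w ^ 8) ≤ psi a l (w ^ 8) := by
  have hT := P.hT
  have w0 : 0 < w := by linarith
  have w1 : 1 ≤ w := by linarith
  have hp : ∀ m n : ℕ, m ≤ n → w ^ m ≤ w ^ n := fun m n h => pow_le_pow_right₀ w1 h
  have hp1 : ∀ m : ℕ, 1 ≤ w ^ m := fun m => one_le_pow₀ w1
  have w2 : 1000 * w ≤ w ^ 2 := by nlinarith
  have w8 : w ^ 2 ≤ w ^ 8 := hp _ _ (by norm_num)
  set y := w ^ 8 with hy
  set lam := w ^ 40 with hlam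
  have hy1 : 1000 ≤ y := by nlinarith
  have hlamy : 1000 * y ≤ lam := by
    rw [hlam, hy, show w ^ 40 = w * w ^ 31 * w ^ 8 by ring]
    gcongr; nlinarith [hp1 31]
  set δ := 0.05 / y with hδ
  have hδ0 : 0 < δ := by positivity
  have hδ1 : δ ≤ 0.05 := div_le_self (by norm_num) (by linarith)
  set N := ⌊lam * (y - δ)⌋₊ with hN
  have hy2 : 0 ≤ y - δ := by linarith
  have hN1 : (N : ℝ) ≤ lam * (y - δ) := Nat.floor_le (by positivity)
  have hN2 : lam * (y - δ) ≤ N + 1 := (Nat.lt_floor_add_one _).le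
  have hN3 : (N : ℝ) ≤ lam * y := hN1.trans (by gcongr; linarith)
  set M := T * (1 + 25 * lam) ^ 2 with hM
  set Q := b * rexp w * w ^ 150 * 10000 with hQ
  have hlog : ∀ ρ : ℂ, F ρ = 0 → ‖lam - ρ‖ ≤ 8 * lam → 1 / w ^ 6 ≤ 1 - ρ.re := by
    intro ρ h0 h1
    refine le_trans ?_ (hz ρ h0)
    have him : |ρ.im| ≤ 8 * lam := by
      have := (Complex.abs_im_le_norm (lam - ρ)).trans h1
      simpa using this
    have l0 : 0 < Real.log (|ρ.im| + 3) := Real.log_pos (by linarith [abs_nonneg ρ.im])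
    apply one_div_le_one_div_of_le (by positivity)
    have l1 : Real.log (|ρ.im| + 3) ≤ Real.log (8 * lam + 3) := Real.log_le_log (by positivity) (by linarith)
    calc A * w ^ 5 * Real.log (|ρ.im| + 3) ≤ A * w ^ 5 * Real.log (8 * lam + 3) := by gcongr
      _ = w ^ 5 * (A * Real.log (8 * lam + 3)) := by ring
      _ ≤ w ^ 5 * w := by gcongr
      _ = w ^ 6 := by ring
  have low := s_low P (lam := lam) (κ := 1 / w ^ 6) (by linarith) (by positivity) (by rw [div_le_one (by positivity)]; exact hp1 6) hlog N
  set η := δ / (4 * y) with hη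
  have hη0 : 0 < η := by positivity
  have hη1 : η ≤ 1 / 2 := by rw [hη, div_le_iff₀ (by positivity)]; linarith
  have hηl : η * lam = 0.0125 * w ^ 24 := by rw [hη, hδ, hy, hlam]; field_simp; ring
  have up := s_up P (lam := lam) (z := 1 - η) (Y := y) (by linarith) (by linarith) (by linarith) (by
    rw [sub_sub_cancel, hηl]; have := hp 1 24 (by norm_num); rw [pow_one] at this; linarith) N
  rw [sub_sub_cancel] at up
  -- main term
  have main : rexp y * (1 - 0.05 / y) ≤ (lam / (lam - 1)) ^ (N + 1) := by
    have h1 : rexp (1 / lam) ≤ lam / (lam - 1) := by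
      refine (exp_le_inv ?_).trans (le_of_eq ?_)
      · rw [div_lt_one (by linarith)]; linarith
      · have : lam ≠ 0 := by linarith
        rw [show 1 - 1 / lam = (lam - 1) / lam by field_simp, one_div_div]
    calc _ ≤ rexp y * rexp (-δ) := by
          gcongr; linarith [Real.add_one_le_exp (-δ)]
      _ = rexp (y - δ) := by rw [← Real.exp_add]; rfl
      _ ≤ rexp ((N + 1 : ℕ) * (1 / lam)) := by
          refine Real.exp_le_exp.2 ?_
          rw [mul_one_div, le_div_iff₀ (by linarith)]; push_cast; linarith
      _ = rexp (1 / lam) ^ (N + 1) := by rw [Real.exp_nat_mul]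
      _ ≤ _ := by gcongr
  -- error bookkeeping
  have hQ0 : 0 < Q := by positivity
  have hQE : Q * rexp (y - 3 * w) ≤ rexp y * (0.01 / y) := by
    have h1 : b ≤ rexp w / (1000000 * w ^ 200) := by rw [le_div_iff₀ (by positivity)]; linarith
    have h3 : 1 ≤ rexp w := Real.one_le_exp w0.le
    calc _ = b * (rexp w * w ^ 150 * 10000 * rexp (y - 3 * w)) := by rw [hQ]; ring
      _ ≤ rexp w / (1000000 * w ^ 200) * (rexp w * w ^ 150 * 10000 * rexp (y - 3 * w)) := by gcongr
      _ = (rexp w * rexp w * rexp (y - 3 * w)) * (0.01 / w ^ 50) := by field_simp; ring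
      _ = rexp (y - w) * (0.01 / w ^ 50) := by rw [← Real.exp_add, ← Real.exp_add]; ring_nf
      _ ≤ rexp y * (0.01 / y) := by
          gcongr
          · linarith
          · rw [hy]; exact hp _ _ (by norm_num)
  have hlamM : M ≤ b * rexp w * (676 * w ^ 80) := by
    have : (1 + 25 * lam) ^ 2 ≤ (26 * w ^ 40) ^ 2 := by
      gcongr; linarith [hp1 40]
    rw [hM]
    calc _ ≤ b * rexp w * (26 * w ^ 40) ^ 2 := by gcongr
      _ = _ := by ring
  have hbe : 0 < b * rexp w := by positivity
  have hbe1 : 1 ≤ b * rexp w := hT.trans hTb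
  have E1 : (N + 1) * (M / Real.log 2 * (lam / (lam - 1 + 1 / w ^ 6)) ^ N) ≤ Q * rexp (y - 3 * w) := by
    have r := rN (lam := lam) (y := y) (κ := 1 / w ^ 6) (N := N) (by linarith) (by linarith) (by linarith) (by positivity) (by rw [div_le_one (by positivity)]; exact hp1 6) hN3
    have e : 1 / w ^ 6 * y = w ^ 2 := by rw [hy]; field_simp
    rw [e] at r
    have r2 := r.trans (Real.exp_le_exp.2 (show y - w ^ 2 + 1 ≤ y - 3 * w by linarith))
    have l2 : M / Real.log 2 ≤ 2 * M := by
      have := Real.log_two_gt_d9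
      have hM0 : 0 ≤ M := by positivity
      rw [div_le_iff₀ (by linarith)]; nlinarith
    have n2 : (N:ℝ) + 1 ≤ 2 * w ^ 48 := by
      have : lam * y = w ^ 48 := by rw [hlam, hy]; ring
      linarith [hp1 48]
    have hM0 : 0 ≤ M := by positivity
    calc _ ≤ (2 * w ^ 48) * (2 * (b * rexp w * (676 * w ^ 80)) * rexp (y - 3 * w)) := by
          have l3 : M / Real.log 2 ≤ 2 * (b * rexp w * (676 * w ^ 80)) := l2.trans (by linarith)
          have l4 : 0 < Real.log 2 := Real.log_pos (by norm_num)
          have l5 : 0 < lam - 1 + 1 / w ^ 6 := by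
            have : 0 < 1 / w ^ 6 := by positivity
            linarith
          exact mul_le_mul n2 (mul_le_mul l3 r2 (by positivity) (by positivity)) (by positivity) (by positivity)
      _ = (b * rexp w) * w ^ 128 * 2704 * rexp (y - 3 * w) := by ring
      _ ≤ Q * rexp (y - 3 * w) := by
          rw [hQ]
          have := hp 128 150 (by norm_num)
          gcongr
          norm_num
  have hone : 1 ≤ rexp (y - 3 * w) := Real.one_le_exp (by linarith)
  have E2 : 1 + 2 * (M / lam) ≤ Q * rexp (y - 3 * w) := by
    have k1 : M / lam ≤ M := div_le_self (by positivity) (by linarith)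
    have k2 : Q ≤ Q * rexp (y - 3 * w) := le_mul_of_one_le_right hQ0.le hone
    have k3 : b * rexp w * (w ^ 80) ≤ b * rexp w * w ^ 150 := mul_le_mul_of_nonneg_left (hp _ _ (by norm_num)) hbe.le
    have k4 : 1 ≤ b * rexp w * w ^ 150 := one_le_mul_of_one_le_of_one_le hbe1 (hp1 150)
    have : Q = b * rexp w * w ^ 150 * 10000 := rfl
    linarith
  have E3 : rexp (1.5 * y) * ((1 - η)⁻¹ ^ N * rexp (-(η * lam * y))) * (2 + 1301 * T) ≤ Q * rexp (y - 3 * w) := by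
    have zz := zN hη0 hη1 hN1
    have ex : 1.5 * y + (lam * (y - δ) * (η + 2 * η ^ 2) + -(η * lam * y)) ≤ y - 3 * w := by
      have k0 : lam * (y - δ) * (η + 2 * η ^ 2) ≤ lam * y * η - lam * δ * η + lam * y * (2 * η ^ 2) := by
        have : 0 ≤ lam * δ * (2 * η ^ 2) := by positivity
        linarith
      have k1 : lam * y * (2 * η ^ 2) = 0.0003125 * w ^ 16 := by rw [hη, hδ, hy, hlam]; field_simp; ring
      have k2 : lam * δ * η = 0.000625 * w ^ 16 := by rw [hη, hδ, hy, hlam]; field_simp; ring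
      have k3 : w ^ 16 = y * y := by rw [hy]; ring
      have k4 : 1000 ^ 4 ≤ w ^ 4 := by gcongr
      have k5 : w ^ 4 ≤ y := hp _ _ (by norm_num)
      have k6 : 1000 ^ 4 * y ≤ y * y := by gcongr; linarith
      linarith
    have t : 2 + 1301 * T ≤ Q := by
      have k4 : b * rexp w * 1 ≤ b * rexp w * w ^ 150 := by gcongr; exact hp1 150
      have : Q = b * rexp w * w ^ 150 * 10000 := rfl
      linarith
    calc _ ≤ rexp (1.5 * y) * (rexp (lam * (y - δ) * (η + 2 * η ^ 2)) * rexp (-(η * lam * y))) * Q := by gcongr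
      _ = rexp (1.5 * y + (lam * (y - δ) * (η + 2 * η ^ 2) + -(η * lam * y))) * Q := by rw [Real.exp_add, Real.exp_add]
      _ ≤ rexp (y - 3 * w) * Q := by gcongr
      _ = _ := mul_comm _ _
  have fin : rexp y * (1 - 0.1 / y) = rexp y * (1 - 0.05 / y) - 5 * (rexp y * (0.01 / y)) := by ring
  have : 0 ≤ rexp y * (0.01 / y) := by positivity
  linarith

end HZ
end
end

section
open scoped Classical
set_option linter.unusedSectionVars false
open Real MeasureTheory Filter Topology

noncomputable section
namespace HZ
open NumberField Module nonZeroDivisors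
variable (K : Type*) [Field K] [NumberField K]

lemma PS_fin (Y : ℝ) : {P : PR K | Real.log (Nid P.id) ≤ Y}.Finite := by
  have h := Ideal.finite_setOfPred_absNorm_le (S := 𝓞 K) ⌊rexp Y⌋₊
  refine (h.preimage (f := fun P : PR K => P.1) Subtype.val_injective.injOn).subset fun P hP => ?_
  have h1 : Nid P.id ≤ rexp Y := (Real.log_le_iff_le_exp (by linarith [NP_ge P])).1 hP
  exact Nat.le_floor h1

def PS (Y : ℝ) : Finset (PR K) := (PS_fin K Y).toFinset

variable {K}

lemma mem_PS {Y : ℝ} {P : PR K} : P ∈ PS K Y ↔ Real.log (Nid P.id) ≤ Y := by simp [PS]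

lemma g_eq {c Y : ℝ} (hc : 0 < c) (hY : 0 ≤ Y) : ∑' k : ℕ, (if ((k:ℝ) + 1) * c ≤ Y then c else 0) = ⌊Y / c⌋₊ * c := by
  have h : ∀ k : ℕ, ((k:ℝ) + 1) * c ≤ Y ↔ k < ⌊Y / c⌋₊ := by
    intro k
    rw [← Nat.succ_le_iff, Nat.le_floor_iff (by positivity), le_div_iff₀ hc]; push_cast; rfl
  rw [tsum_eq_sum (s := Finset.range ⌊Y / c⌋₊) (fun k hk => if_neg (by rw [h]; simpa using hk)),
    Finset.sum_congr rfl fun k hk => if_pos ((h k).2 (Finset.mem_range.1 hk))]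
  simp

lemma cnt1 {F : ℂ → ℂ} {T Y : ℝ} (P : Pk (aQ K) (lQ K) F T) (hY : 0 ≤ Y) :
    psi (aQ K) (lQ K) Y = ∑ p ∈ PS K Y, ⌊Y / Real.log (Nid p.id)⌋₊ * Real.log (Nid p.id) := by
  have hp : ∀ p : PR K, 0 < Real.log (Nid p.id) := fun p => Real.log_pos (by linarith [NP_ge p])
  unfold psi
  rw [(psi_summable P Y).tsum_prod]
  have e : ∀ p : PR K, ∑' k : ℕ, (if lQ K (p, k) ≤ Y then aQ K (p, k) else 0) = ⌊Y / Real.log (Nid p.id)⌋₊ * Real.log (Nid p.id) := fun p => by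
    simp only [lQ, aQ]; exact g_eq (hp p) hY
  rw [tsum_congr e]
  refine tsum_eq_sum fun p hpn => ?_
  rw [mem_PS, not_le] at hpn
  rw [Nat.floor_eq_zero.2 (by rw [div_lt_one (hp p)]; exact hpn)]; simp

lemma cnt2 {F : ℂ → ℂ} {T Y : ℝ} (P : Pk (aQ K) (lQ K) F T) (hY : 0 ≤ Y) : psi (aQ K) (lQ K) Y ≤ Y * (PS K Y).card := by
  rw [cnt1 P hY, mul_comm, ← nsmul_eq_mul]
  refine Finset.sum_le_card_nsmul _ _ _ fun p _ => ?_
  have hp : 0 < Real.log (Nid p.id) := Real.log_pos (by linarith [NP_ge p])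
  rw [← le_div_iff₀ hp]
  exact Nat.floor_le (by positivity)

lemma cnt3 {F : ℂ → ℂ} {T Y : ℝ} (P : Pk (aQ K) (lQ K) F T) (hY : 0 ≤ Y) : Real.log 2 * (PS K Y).card ≤ psi (aQ K) (lQ K) Y := by
  rw [cnt1 P hY, mul_comm, ← nsmul_eq_mul]
  refine Finset.card_nsmul_le_sum _ _ _ fun p hpm => ?_
  have h2 := NP_ge p
  have hp : 0 < Real.log (Nid p.id) := Real.log_pos (by linarith)
  have h3 : Real.log 2 ≤ Real.log (Nid p.id) := Real.log_le_log (by norm_num) h2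
  refine h3.trans (le_mul_of_one_le_left hp.le ?_)
  have : 1 ≤ ⌊Y / Real.log (Nid p.id)⌋₊ := by
    rw [Nat.one_le_floor_iff, one_le_div hp]; exact mem_PS.1 hpm
  exact_mod_cast this

lemma cnt4 {F : ℂ → ℂ} {T Y : ℝ} (P : Pk (aQ K) (lQ K) F T) (hY : 0 ≤ Y) :
    psi (aQ K) (lQ K) Y + Real.log 2 * ((PS K (Y - Real.log 2)).card - (PS K (Y / 2)).card) ≤ Y * (PS K Y).card := by
  have hl2 : 0 < Real.log 2 := Real.log_pos (by norm_num)
  set V := PS K (Y - Real.log 2) \ PS K (Y / 2) with hV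
  have hVs : V ⊆ PS K Y := fun p hp => by
    have := mem_PS.1 (Finset.mem_sdiff.1 hp).1
    exact mem_PS.2 (by linarith)
  have hVc : ((PS K (Y - Real.log 2)).card : ℝ) - (PS K (Y / 2)).card ≤ V.card := by
    have : (PS K (Y - Real.log 2)).card - (PS K (Y / 2)).card ≤ V.card := Finset.le_card_sdiff _ _
    rw [sub_le_iff_le_add]
    have : (PS K (Y - Real.log 2)).card ≤ V.card + (PS K (Y / 2)).card := by omega
    exact_mod_cast this
  have key : psi (aQ K) (lQ K) Y + Real.log 2 * V.card ≤ Y * (PS K Y).card := by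
    have e : Real.log 2 * V.card = ∑ p ∈ PS K Y, if p ∈ V then Real.log 2 else 0 := by
      rw [Finset.sum_ite_mem, Finset.inter_eq_right.2 hVs, Finset.sum_const, nsmul_eq_mul, mul_comm]
    rw [cnt1 P hY, e, ← Finset.sum_add_distrib, mul_comm, ← nsmul_eq_mul]
    refine Finset.sum_le_card_nsmul _ _ _ fun p hpm => ?_
    have hp : 0 < Real.log (Nid p.id) := Real.log_pos (by linarith [NP_ge p])
    have hf : (⌊Y / Real.log (Nid p.id)⌋₊ : ℝ) * Real.log (Nid p.id) ≤ Y := by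
      rw [← le_div_iff₀ hp]; exact Nat.floor_le (by positivity)
    split_ifs with h
    · obtain ⟨v1, v2⟩ := Finset.mem_sdiff.1 h
      rw [mem_PS] at v1 v2
      have : ⌊Y / Real.log (Nid p.id)⌋₊ < 2 := by
        rw [Nat.floor_lt (by positivity), div_lt_iff₀ hp]; push_cast; linarith
      have h1 : (⌊Y / Real.log (Nid p.id)⌋₊ : ℝ) ≤ 1 := by exact_mod_cast Nat.lt_succ_iff.1 this
      have := mul_le_mul_of_nonneg_right h1 hp.le
      linarith
    · linarith
  have := mul_le_mul_of_nonneg_left hVc hl2.le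
  linarith

lemma pi_low {F : ℂ → ℂ} {T y : ℝ} (P : Pk (aQ K) (lQ K) F T) (hy : 100 ≤ y)
    (h1 : rexp y * (1 - 0.1 / y) ≤ psi (aQ K) (lQ K) y)
    (h2 : rexp (y - Real.log 2) * (1 - 0.1 / (y - Real.log 2)) ≤ psi (aQ K) (lQ K) (y - Real.log 2))
    (h3 : 6600 * T * y ≤ rexp (y / 4)) : rexp y / y ≤ (PS K y).card := by
  have l2 := Real.log_two_gt_d9
  have l2' := Real.log_two_lt_d9
  have c4 := cnt4 P (Y := y) (by linarith)
  have c3 := cnt3 P (Y := y / 2) (by linarith)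
  have c2 := cnt2 P (Y := y - Real.log 2) (by linarith)
  have u := psi_le P (y / 2)
  have hT := P.hT
  set X := rexp y with hX
  have hX0 : 0 < X := Real.exp_pos _
  set Z := X / y with hZ
  have hZ0 : 0 < Z := by positivity
  have a1 : X * (1 - 0.1 / y) = X - 0.1 * Z := by rw [hZ]; ring
  have a2 : 0.49 * X ≤ psi (aQ K) (lQ K) (y - Real.log 2) := by
    refine le_trans ?_ h2
    rw [Real.exp_sub, Real.exp_log (by norm_num)]
    have : 0.1 / (y - Real.log 2) ≤ 0.01 := by rw [div_le_iff₀ (by linarith)]; linarith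
    have := mul_le_mul_of_nonneg_left (show 0.99 ≤ 1 - 0.1 / (y - Real.log 2) by linarith) (show 0 ≤ X / 2 by positivity)
    linarith
  have a3 : 0.49 * Z ≤ (PS K (y - Real.log 2)).card := by
    have : (y - Real.log 2) * ((PS K (y - Real.log 2)).card : ℝ) ≤ y * (PS K (y - Real.log 2)).card := by gcongr; linarith
    rw [hZ, ← mul_div_assoc, div_le_iff₀ (by linarith)]; linarith
  have a4 : rexp (1.5 * (y / 2)) * (2 + 1301 * T) ≤ 0.2 * Z := by
    rw [hZ, ← mul_div_assoc 0.2 X y, le_div_iff₀ (by linarith)]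
    have e : X = rexp (1.5 * (y / 2)) * rexp (y / 4) := by rw [hX, ← Real.exp_add]; ring_nf
    have h4 : (2 + 1301 * T) * y ≤ 0.2 * rexp (y / 4) := by
      have : 0 ≤ (T - 1) * y := mul_nonneg (by linarith) (by linarith)
      linarith
    have := mul_le_mul_of_nonneg_left h4 (Real.exp_pos (1.5 * (y / 2))).le
    rw [e]; linarith
  have a5 := mul_le_mul_of_nonneg_left a3 (show 0 ≤ Real.log 2 by linarith)
  have a6 : 0.69 * (0.49 * Z) ≤ Real.log 2 * (0.49 * Z) := by gcongr; linarith
  rw [hZ, div_le_iff₀ (by linarith)]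
  linarith

end HZ
end
end

section
set_option linter.unusedSectionVars false
open Real MeasureTheory Filter Topology
namespace HZ
open NumberField Module nonZeroDivisors

lemma evt (b A : ℝ) : ∃ W : ℝ, 1000 ≤ W ∧ ∀ w, W ≤ w → b * 1000000 * w ^ 200 ≤ rexp w ∧ A * Real.log (8 * w ^ 40 + 3) ≤ w := by
  have h1 := (Real.tendsto_pow_mul_exp_neg_atTop_nhds_zero 200).const_mul (b * 1000000)
  rw [mul_zero] at h1
  have e1 := h1.eventually_le_const (show (0:ℝ) < 1 by norm_num)
  have h2 := Real.isLittleO_log_id_atTop.bound (show (0:ℝ) < 1 / (200 * (|A| + 1)) by positivity)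
  obtain ⟨W, hW⟩ := Filter.eventually_atTop.1 (e1.and h2)
  refine ⟨max W 1000, le_max_right _ _, fun w hw => ?_⟩
  obtain ⟨k1, k2⟩ := hW w ((le_max_left _ _).trans hw)
  have hw1 : 1000 ≤ w := (le_max_right _ _).trans hw
  constructor
  · rw [Real.exp_neg, ← mul_assoc, ← div_eq_mul_inv, div_le_one (Real.exp_pos _)] at k1
    exact k1
  · have l0 : 0 ≤ Real.log w := Real.log_nonneg (by linarith)
    rw [Real.norm_of_nonneg l0, id, Real.norm_of_nonneg (by linarith), one_div, ← div_eq_inv_mul, le_div_iff₀ (by positivity)] at k2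
    have w40 : 1 ≤ w ^ 40 := one_le_pow₀ (by linarith)
    have l1 : Real.log (8 * w ^ 40 + 3) ≤ 41 * Real.log w := by
      rw [show (41:ℝ) = (41:ℕ) by norm_num, ← Real.log_pow]
      refine Real.log_le_log (by positivity) ?_
      rw [pow_succ]; nlinarith
    have l2 : 0 ≤ Real.log (8 * w ^ 40 + 3) := Real.log_nonneg (by linarith)
    calc _ ≤ |A| * Real.log (8 * w ^ 40 + 3) := by gcongr; exact le_abs_self A
      _ ≤ |A| * (41 * Real.log w) := by gcongr
      _ ≤ w := by nlinarith [mul_nonneg (abs_nonneg A) l0]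

lemma Bz_ge : 40 ≤ Bz := by
  have : 0 ≤ ∑' m : ℕ, (m : ℝ) ^ (-2 : ℝ) := tsum_nonneg fun m => by positivity
  rw [Bz]; linarith

lemma mdzh_pk {C : ℝ} (hC : 4 < C) (hm : MDZH C) (K : Type) [Field K] [NumberField K] (hK : 1 < finrank ℚ K) {L : ℝ}
    (hL : L = Real.log ((finrank ℚ K : ℝ) * Real.log (3 * ((discr K).natAbs : ℝ)))) (hL1 : 1 ≤ L) (hDL : Real.log (Dab K) ≤ rexp L) :
    ∃ F, Pk (aQ K) (lQ K) F (4 * Bz * Real.log (Dab K)) ∧ ∀ ρ, F ρ = 0 →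
      1 / (1000000 * (4 * Bz) * A1 (4 * Bz) * L ^ (C + 1) * Real.log (|ρ.im| + 3)) ≤ 1 - ρ.re := by
  obtain ⟨F, f1, f2, f3, f4, f5, f6⟩ := package K hK
  obtain ⟨hD1, hD2⟩ := logD K hK
  have hB := Bz_ge
  have P : Pk (aQ K) (lQ K) F (4 * Bz * Real.log (Dab K)) := ⟨aQ_nn, lQ_nn, fun σ h => (sumQ σ h).1, by nlinarith, f1, f2, f3, f4, f5,
    fun s hs => (f6 s hs).2.1, fun s hs => (f6 s hs).2.2⟩
  refine ⟨F, P, fun ρ hρ => ?_⟩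
  have hz : IsDedekindZeta K fun s => F s / (s - 1) := by
    refine ⟨fun s hs => ?_, fun s hs => ?_⟩
    · have : s - 1 ≠ 0 := sub_ne_zero.2 hs
      exact ((f1 s).div (by fun_prop) this).differentiableWithinAt
    · have : s - 1 ≠ 0 := by
        intro h
        rw [sub_eq_zero.1 h] at hs
        simp at hs
      change F s / (s - 1) = _
      rw [(f6 s hs).1, mul_div_cancel_left₀ _ this]
  obtain ⟨m1, m2⟩ := hm K hK _ hz
  refine z3 P (b := 4 * Bz) (lD := Real.log (Dab K)) (L := L) (C := C) (by linarith) rfl hD1 hDL hL1 (by linarith) ?_ ?_ hρ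
  · intro ρ h0 h1 h2
    have := m1 ρ (by simp [h0]) h1 (z1 P h0)
    rw [← hL] at this
    by_contra hc
    exact this ⟨h2, not_lt.1 hc⟩
  · intro β h0 h1
    have hb := z1 P h0
    rw [Complex.ofReal_re] at hb
    have := m2 β (by simp [h0]) h1 hb
    rw [← hL] at this
    exact not_lt.1 this

lemma big {C : ℝ} (hC : 4 < C) (hm : MDZH C) : ∃ Y0 : ℝ, 1 ≤ Y0 ∧ ∀ (K : Type) [Field K] [NumberField K], 1 < finrank ℚ K →
    ∀ L, L = Real.log ((finrank ℚ K : ℝ) * Real.log (3 * ((discr K).natAbs : ℝ))) → 1 ≤ L → Real.log (Dab K) ≤ rexp L →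
    ∀ y, Y0 ≤ y → L ^ (C ^ 2) ≤ y → rexp y / y ≤ (PS K y).card := by
  set b := 4 * Bz with hb
  have hb1 : 160 ≤ b := by linarith [Bz_ge]
  have hA1 := A1_ge (show 1 ≤ b by linarith)
  set A := 1000000 * b * A1 b with hA
  have hA0 : 0 < A := by positivity
  obtain ⟨W, hW0, hW⟩ := evt b A
  refine ⟨W ^ 8 + 4, by have : 0 ≤ W ^ 8 := by positivity
                        linarith, ?_⟩
  intro K _ _ hK L hL hL1 hDL y hy hLy
  obtain ⟨F, P, hz⟩ := mdzh_pk hC hm K hK hL hL1 hDL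
  have hT := P.hT
  have hT2 : 4 * Bz * Real.log (Dab K) ≤ b * rexp L := by rw [← hb]; gcongr
  set T := 4 * Bz * Real.log (Dab K) with hTd
  have hW8 : 0 ≤ W ^ 8 := by positivity
  have l2 := Real.log_two_gt_d9
  have l2' := Real.log_two_lt_d9
  have main : ∀ Y, W ^ 8 ≤ Y → y ≤ Y ^ 2 → rexp Y * (1 - 0.1 / Y) ≤ psi (aQ K) (lQ K) Y ∧ ∃ v, Y = v ^ 8 ∧ W ≤ v ∧ T ≤ b * rexp v := by
    intro Y hY1 hY2
    obtain ⟨v, hv0, hv⟩ : ∃ v, 0 ≤ v ∧ Y = v ^ 8 := by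
      refine ⟨Y ^ ((8:ℕ):ℝ)⁻¹, by have : 0 ≤ Y := by linarith
                                  positivity, ?_⟩
      rw [Real.rpow_inv_natCast_pow (by linarith) (by norm_num)]
    have hWv : W ≤ v := by rw [hv] at hY1; exact le_of_pow_le_pow_left₀ (by norm_num) hv0 hY1
    have hL16 : L ^ (C ^ 2) ≤ v ^ 16 := by
      refine hLy.trans (hY2.trans (le_of_eq ?_)); rw [hv]; ring
    have hLv : L ≤ v := by
      refine le_of_pow_le_pow_left₀ (n := 16) (by norm_num) hv0 (le_trans ?_ hL16)
      rw [← Real.rpow_natCast]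
      exact Real.rpow_le_rpow_of_exponent_le hL1 (by push_cast; nlinarith)
    have hX : L ^ (C + 1) ≤ v ^ 5 := by
      refine le_of_pow_le_pow_left₀ (n := 16) (by norm_num) (by positivity) ?_
      calc (L ^ (C + 1)) ^ 16 = L ^ ((C + 1) * (16:ℕ)) := (Real.rpow_mul_natCast (by linarith) _ _).symm
        _ ≤ L ^ (C ^ 2 * (5:ℕ)) := Real.rpow_le_rpow_of_exponent_le hL1 (by push_cast; nlinarith)
        _ = (L ^ (C ^ 2)) ^ 5 := Real.rpow_mul_natCast (by linarith) _ _
        _ ≤ (v ^ 16) ^ 5 := by gcongr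
        _ = _ := by ring
    obtain ⟨e1, e2⟩ := hW v hWv
    have hTv : T ≤ b * rexp v := hT2.trans (by gcongr)
    refine ⟨?_, v, hv, hWv, hTv⟩
    rw [hv]
    refine psi_low P (by linarith) hTv hA0 (hW0.trans hWv) e1 e2 fun ρ hρ => le_trans ?_ (hz ρ hρ)
    have lp : 0 < Real.log (|ρ.im| + 3) := Real.log_pos (by linarith [abs_nonneg ρ.im])
    apply one_div_le_one_div_of_le
    · rw [← hA]; positivity
    · rw [← hA]; gcongr
  have hW8' : 1000 ≤ W ^ 8 := hW0.trans (le_self_pow₀ (by linarith) (by norm_num))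
  obtain ⟨p1, v, v1, v2, v3⟩ := main y (by linarith) (by nlinarith)
  obtain ⟨p2, -⟩ := main (y - Real.log 2) (by linarith) (by nlinarith)
  refine pi_low P (by linarith) p1 p2 ?_
  have e1 := (hW v v2).1
  have hv1 : 1000 ≤ v := hW0.trans v2
  have k1 : 2 * v ≤ y / 4 := by
    rw [v1, show v ^ 8 = v * v ^ 7 by ring]
    have : v ≤ v ^ 7 := le_self_pow₀ (by linarith) (by norm_num)
    nlinarith
  have k2 : v ^ 8 ≤ v ^ 200 := pow_le_pow_right₀ (by linarith) (by norm_num)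
  calc 6600 * T * y ≤ 6600 * (b * rexp v) * v ^ 200 := by
        have : y ≤ v ^ 200 := by rw [v1]; exact k2
        have : 0 ≤ y := by linarith
        gcongr
    _ ≤ rexp v * rexp v := by
        have h0 : 0 ≤ b * v ^ 200 := by positivity
        have := mul_le_mul_of_nonneg_left (show 6600 * (b * v ^ 200) ≤ rexp v by linarith) (Real.exp_pos v).le
        linarith
    _ = rexp (2 * v) := by rw [← Real.exp_add]; ring_nf
    _ ≤ _ := Real.exp_le_exp.2 k1

lemma card_PS (K : Type) [Field K] [NumberField K] {x : ℝ} (hx : 0 < x) : (PS K (Real.log x)).card = piK K x := by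
  unfold piK
  rw [← Set.ncard_coe_finset, ← Set.ncard_image_of_injective _ (Subtype.val_injective (p := fun P : Ideal (𝓞 K) => P.IsPrime ∧ P ≠ ⊥))]
  congr 1
  ext I
  constructor
  · rintro ⟨P, hP, rfl⟩
    refine ⟨P.2.1, P.2.2, ?_⟩
    have hN : (2:ℝ) ≤ (Ideal.absNorm P.1 : ℝ) := NP_ge P
    exact (Real.log_le_log_iff (by linarith) hx).1 (mem_PS.1 hP)
  · rintro ⟨h1, h2, h3⟩
    refine ⟨⟨I, h1, h2⟩, ?_, rfl⟩
    have hN : (2:ℝ) ≤ (Ideal.absNorm I : ℝ) := NP_ge (⟨I, h1, h2⟩ : PR K)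
    refine mem_PS.2 (Real.log_le_log (?_ : (0:ℝ) < (Ideal.absNorm I : ℝ)) h3)
    linarith

end HZ
end

/-- Assuming MDZH with constant `C > 4`, the prime-ideal counting function satisfies
`π_K(x) ≥ x(1/log x − c·exp(−(log x)^{1/C}/(log(d log 3Δ))^C))` for all sufficiently
large `x`. -/
theorem piK_lower_bound_of_mdzh (C : ℝ) (hC : 4 < C) (hmdzh : MDZH C) :
    ∃ c : ℝ, 0 < c ∧
      ∀ (K : Type) [Field K] [NumberField K],
        1 < Module.finrank ℚ K →
        ∀ x : ℝ,
          Real.exp (4 * Real.log (Real.log (3 * ((NumberField.discr K).natAbs : ℝ))) ^ 2 *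
              (Real.log ((Module.finrank ℚ K : ℝ) *
                Real.log (3 * ((NumberField.discr K).natAbs : ℝ)))) ^ (C ^ 2)) ≤ x →
          (piK K x : ℝ) ≥
            x * (1 / Real.log x -
              c * Real.exp (-(Real.log x) ^ (1 / C) /
                (Real.log ((Module.finrank ℚ K : ℝ) *
                  Real.log (3 * ((NumberField.discr K).natAbs : ℝ)))) ^ C)) := by
  obtain ⟨Y0, hY0, hbig⟩ := HZ.big hC hmdzh
  refine ⟨Real.exp (Y0 ^ (1 / C)), Real.exp_pos _, ?_⟩
  intro K _ _ hK x hx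
  obtain ⟨hD1, -⟩ := HZ.logD K hK
  have hDab : HZ.Dab K = ((NumberField.discr K).natAbs : ℝ) := rfl
  have hD0 : 0 < HZ.Dab K := by
    by_contra hc
    have h0 : (0:ℝ) ≤ HZ.Dab K := by rw [hDab]; positivity
    rw [le_antisymm (not_lt.1 hc) h0, Real.log_zero] at hD1
    linarith
  have hl3 : 1 ≤ Real.log 3 := by
    rw [Real.le_log_iff_exp_le (by norm_num)]; linarith [Real.exp_one_lt_d9]
  have hlog : Real.log (3 * ((NumberField.discr K).natAbs : ℝ)) = Real.log 3 + Real.log (HZ.Dab K) := by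
    rw [← hDab, Real.log_mul (by norm_num) hD0.ne']
  have hd : (2:ℝ) ≤ (Module.finrank ℚ K : ℝ) := by exact_mod_cast hK
  generalize hLL : Real.log ((Module.finrank ℚ K : ℝ) * Real.log (3 * ((NumberField.discr K).natAbs : ℝ))) = L at hx ⊢
  generalize hl : Real.log (3 * ((NumberField.discr K).natAbs : ℝ)) = m at hx
  have hm : 2 ≤ m := by rw [← hl, hlog]; linarith
  have hdm : 4 ≤ (Module.finrank ℚ K : ℝ) * m := by nlinarith
  have hLm : L = Real.log ((Module.finrank ℚ K : ℝ) * m) := by rw [← hl, hLL]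
  have hL1 : 1 ≤ L := by
    rw [hLm, Real.le_log_iff_exp_le (by linarith)]; linarith [Real.exp_one_lt_d9]
  have hDL : Real.log (HZ.Dab K) ≤ Real.exp L := by
    rw [hLm, Real.exp_log (by linarith)]
    have : Real.log (HZ.Dab K) ≤ m := by rw [← hl, hlog]; linarith
    nlinarith
  have hx0 : 0 < x := (Real.exp_pos _).trans_le hx
  have hLC1 : 1 ≤ L ^ (C ^ 2) := Real.one_le_rpow hL1 (by positivity)
  have hy : L ^ (C ^ 2) ≤ Real.log x := by
    have h1 := (Real.le_log_iff_exp_le hx0).2 hx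
    refine le_trans ?_ h1
    have h2 : Real.log 2 ≤ Real.log m := Real.log_le_log (by norm_num) hm
    have h3 := Real.log_two_gt_d9
    have h4 : 1 ≤ 4 * Real.log m ^ 2 := by nlinarith
    exact le_mul_of_one_le_left (by linarith) h4
  have hy1 : 1 ≤ Real.log x := hLC1.trans hy
  have hexp := Real.exp_pos (-(Real.log x) ^ (1 / C) / L ^ C)
  rcases le_or_gt Y0 (Real.log x) with h | h
  · have q := hbig K hK L hLL.symm hL1 hDL _ h hy
    rw [HZ.card_PS K hx0, Real.exp_log hx0] at q
    refine le_trans ?_ q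
    rw [(mul_one_div x (Real.log x)).symm]
    refine mul_le_mul_of_nonneg_left ?_ hx0.le
    have := mul_pos (Real.exp_pos (Y0 ^ (1 / C))) hexp
    linarith
  · have h0 : (0:ℝ) ≤ piK K x := by positivity
    refine le_trans ?_ h0
    refine mul_nonpos_of_nonneg_of_nonpos hx0.le ?_
    have h1 : 1 / Real.log x ≤ 1 := by rw [div_le_one (by linarith)]; exact hy1
    have hC0 : 0 < C := by linarith
    have h2 : 1 ≤ Real.exp (Y0 ^ (1 / C)) * Real.exp (-(Real.log x) ^ (1 / C) / L ^ C) := by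
      rw [← Real.exp_add]
      refine Real.one_le_exp ?_
      have a1 : 1 ≤ L ^ C := Real.one_le_rpow hL1 hC0.le
      have a2 : 0 ≤ Real.log x ^ (1 / C) := Real.rpow_nonneg (by linarith) _
      have a3 : Real.log x ^ (1 / C) / L ^ C ≤ Real.log x ^ (1 / C) := div_le_self a2 a1
      have a4 : Real.log x ^ (1 / C) ≤ Y0 ^ (1 / C) := Real.rpow_le_rpow (by linarith) h.le (by positivity)
      rw [neg_div]
      linarith
    linarith

end
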